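/- arXiv:1511.02162 — 3 statements merged into one kernel-verified Lean document; each statement's English description precedes it below -/
import Mathlib

section
/- Let 1 + α < γ < (2+α)/(2−α). Then there exists a solution u of problem (P_∞), and there exist constants 0 < c₁ ≤ c₂ such that c₁ δ(x)^{−α/(γ−1)} ≤ u(x) ≤ c₂ δ(x)^{−α/(γ−1)} for every x ∈ B. -/
open MeasureTheory Real Filter Topology Metric Set

noncomputable section

abbrev EN (N : ℕ) := EuclideanSpace ℝ (Fin N)

/-- The normalizing constant `c_{N,α}` of the fractional Laplacian. -/
def fracLapCoeff (N : ℕ) (α : ℝ) : ℝ :=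
  2 ^ α * Real.pi ^ (-(N : ℝ) / 2) * Real.Gamma (((N : ℝ) + α) / 2) / |Real.Gamma (-α / 2)|

/-- `HasFracLap N α u x L` means the principal-value limit defining `Δ^{α/2} u (x)` exists
and equals `L`. -/
def HasFracLap (N : ℕ) (α : ℝ) (u : EN N → ℝ) (x : EN N) (L : ℝ) : Prop :=
  Tendsto (fun ε : ℝ =>
      fracLapCoeff N α * ∫ y in {y : EN N | ε < dist y x}, (u y - u x) / dist y x ^ ((N : ℝ) + α))
    (𝓝[>] (0 : ℝ)) (𝓝 L)

/-- The value of the fractional Laplacian at `x` (junk value `0` where the limit fails). -/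
def fracLap (N : ℕ) (α : ℝ) (u : EN N → ℝ) (x : EN N) : ℝ :=
  haveI := Classical.propDecidable (∃ L, HasFracLap N α u x L)
  if h : ∃ L, HasFracLap N α u x L then h.choose else 0

/-- The weighted space `𝓛_α`. -/
def memLalpha (N : ℕ) (α : ℝ) (u : EN N → ℝ) : Prop :=
  Integrable (fun y : EN N => u y * (1 + ‖y‖) ^ (-((N : ℝ) + α)))

/-- `δ(x) = 1 - |x|` on the unit ball, `0` outside. -/
def delta1 {N : ℕ} (x : EN N) : ℝ := if ‖x‖ < 1 then 1 - ‖x‖ else 0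

/-- The constant `κ_{N,α}`. -/
def greenCoeff (N : ℕ) (α : ℝ) : ℝ :=
  Real.Gamma ((N : ℝ) / 2) / (2 ^ α * Real.pi ^ ((N : ℝ) / 2) * Real.Gamma (α / 2) ^ 2)

/-- The Green function of the unit ball. -/
def greenB (N : ℕ) (α : ℝ) (x y : EN N) : ℝ :=
  if ‖x‖ < 1 ∧ ‖y‖ < 1 then
    greenCoeff N α * ‖x - y‖ ^ (α - (N : ℝ)) *
      ∫ s in (0:ℝ)..((1 - ‖x‖ ^ 2) * (1 - ‖y‖ ^ 2) / ‖x - y‖ ^ 2),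
        s ^ (α / 2 - 1) * (1 + s) ^ (-(N : ℝ) / 2)
  else 0

/-- The Green function of the ball `B(a,r)`, by scaling. -/
def greenBall (N : ℕ) (α : ℝ) (a : EN N) (r : ℝ) (x y : EN N) : ℝ :=
  r ^ (α - (N : ℝ)) * greenB N α (r⁻¹ • (x - a)) (r⁻¹ • (y - a))

/-- The constant `c_α^N` of the Poisson kernel. -/
def poissonCoeff (N : ℕ) (α : ℝ) : ℝ :=
  Real.pi ^ (-1 - (N : ℝ) / 2) * Real.Gamma ((N : ℝ) / 2) * Real.sin (Real.pi * α / 2)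

/-- The Poisson kernel of the ball `B(a,r)`. -/
def poissonBall (N : ℕ) (α : ℝ) (a : EN N) (r : ℝ) (x y : EN N) : ℝ :=
  poissonCoeff N α * ((r ^ 2 - ‖x - a‖ ^ 2) / (‖y - a‖ ^ 2 - r ^ 2)) ^ (α / 2) *
    ‖x - y‖ ^ (-(N : ℝ))

/-- The harmonic-measure operator `H^α_{B(a,r)} f`. -/
def Hball (N : ℕ) (α : ℝ) (a : EN N) (r : ℝ) (f : EN N → ℝ) (x : EN N) : ℝ :=
  ∫ y in {y : EN N | r < ‖y - a‖}, poissonBall N α a r x y * f y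

/-- Solution (in the distributional sense) of `Δ^{α/2} u = u^γ` in the open set `U`. -/
def IsSolution (N : ℕ) (α γ : ℝ) (U : Set (EN N)) (u : EN N → ℝ) : Prop :=
  (∀ x, 0 ≤ u x) ∧ ContinuousOn u U ∧ memLalpha N α u ∧
    ∀ φ : EN N → ℝ, ContDiff ℝ (⊤ : ℕ∞) φ → HasCompactSupport φ → tsupport φ ⊆ U →
      (∀ x, 0 ≤ φ x) →
        ∫ x, u x * fracLap N α φ x = ∫ x, u x ^ γ * φ x

/-- The surface measure `σ` on the unit sphere. -/
def sphereMeasure (N : ℕ) : Measure (Metric.sphere (0 : EN N) 1) :=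
  (volume : Measure (EN N)).toSphere

/-- The Martin integral `M_B^α g`. -/
def martinB (N : ℕ) (α : ℝ) (g : Metric.sphere (0 : EN N) 1 → ℝ) (x : EN N) : ℝ :=
  if ‖x‖ < 1 then
    ∫ y, (1 - ‖x‖ ^ 2) ^ (α / 2) * ‖x - (y : EN N)‖ ^ (-(N : ℝ)) * g y ∂(sphereMeasure N)
  else 0

/-- Solution of the moderate blow-up problem `(P_g)`. -/
def IsSolutionPg (N : ℕ) (α γ : ℝ) (g : Metric.sphere (0 : EN N) 1 → ℝ) (u : EN N → ℝ) : Prop :=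
  (∀ x, 0 ≤ u x) ∧ memLalpha N α u ∧ (∀ x : EN N, ¬ ‖x‖ < 1 → u x = 0) ∧
    IsSolution N α γ (Metric.ball (0 : EN N) 1) u ∧
    ∀ z : Metric.sphere (0 : EN N) 1,
      Tendsto (fun x => delta1 x ^ (1 - α / 2) * u x)
        (𝓝[Metric.ball (0 : EN N) 1] (z : EN N)) (𝓝 (g z))

/-- Solution of the blow-up problem `(P_∞)`. -/
def IsSolutionPinf (N : ℕ) (α γ : ℝ) (u : EN N → ℝ) : Prop :=
  (∀ x, 0 ≤ u x) ∧ memLalpha N α u ∧ (∀ x : EN N, ¬ ‖x‖ < 1 → u x = 0) ∧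
    IsSolution N α γ (Metric.ball (0 : EN N) 1) u ∧
    ∀ z : Metric.sphere (0 : EN N) 1,
      Tendsto (fun x => delta1 x ^ (1 - α / 2) * u x)
        (𝓝[Metric.ball (0 : EN N) 1] (z : EN N)) atTop


/-- truncated kernel -/
def kr (N : ℕ) (α r : ℝ) (z : EN N) : ℝ := if r < ‖z‖ then ‖z‖ ^ (-((N : ℝ) + α)) else 0

lemma kr_nonneg (N : ℕ) (α r : ℝ) (z : EN N) : 0 ≤ kr N α r z := by
  unfold kr; split_ifs <;> positivity

lemma kr_neg (N : ℕ) (α r : ℝ) (z : EN N) : kr N α r (-z) = kr N α r z := by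
  simp [kr]

lemma kr_le (N : ℕ) (α r : ℝ) (hα : 0 < α) (hr : 0 < r) (z : EN N) :
    kr N α r z ≤ r ^ (-((N : ℝ) + α)) := by
  unfold kr; split_ifs with h
  · exact Real.rpow_le_rpow_of_nonpos hr h.le (by have : (0:ℝ) ≤ N := by positivity
                                                  linarith)
  · positivity

lemma kr_measurable2 (N : ℕ) (α : ℝ) : Measurable (fun p : ℝ × EN N => kr N α p.1 p.2) := by
  unfold kr
  refine Measurable.ite (measurableSet_lt measurable_fst measurable_snd.norm) ?_ measurable_const
  exact measurable_snd.norm.pow_const _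

lemma kr_measurable (N : ℕ) (α r : ℝ) : Measurable (kr N α r) :=
  (kr_measurable2 N α).comp (measurable_const.prodMk measurable_id)

lemma EN_nontrivial (N : ℕ) (hN : 3 ≤ N) : Nontrivial (EN N) := by
  have : Nonempty (Fin N) := ⟨⟨0, by omega⟩⟩
  infer_instance

lemma pow_mul_rpow (N : ℕ) (hN : 3 ≤ N) (α s : ℝ) (hs : 0 < s) :
    s ^ (N - 1) * s ^ (-((N : ℝ) + α)) = s ^ (-1 - α) := by
  rw [← Real.rpow_natCast, ← Real.rpow_add hs, Nat.cast_sub (by omega)]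
  congr 1; push_cast; ring

lemma kr_radial_aux (N : ℕ) (hN : 3 ≤ N) (α r : ℝ) (hr : 0 < r) :
    EqOn (fun y : ℝ => y ^ (Module.finrank ℝ (EN N) - 1) •
      (if r < y then y ^ (-((N : ℝ) + α)) else 0))
      ((Ioi r).indicator (fun y => y ^ (-1 - α))) (Ioi 0) := by
  intro y hy
  simp only [finrank_euclideanSpace, Fintype.card_fin, smul_eq_mul, indicator, mem_Ioi]
  split_ifs with h
  · exact pow_mul_rpow N hN α y hy
  · simp

lemma kr_integrable (N : ℕ) (hN : 3 ≤ N) (α r : ℝ) (hα : 0 < α) (hr : 0 < r) :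
    Integrable (kr N α r) := by
  have := EN_nontrivial N hN
  have := (integrable_fun_norm_addHaar (volume : Measure (EN N))
    (f := fun y : ℝ => if r < y then y ^ (-((N : ℝ) + α)) else 0)).2 ?_
  · exact this
  · rw [integrableOn_congr_fun (kr_radial_aux N hN α r hr) measurableSet_Ioi]
    exact ((integrable_indicator_iff measurableSet_Ioi).2
      (integrableOn_Ioi_rpow_of_lt (by linarith) hr)).integrableOn

lemma kr_integral (N : ℕ) (hN : 3 ≤ N) (α : ℝ) (hα : 0 < α) : ∃ C : ℝ, 0 < C ∧
    ∀ r, 0 < r → ∫ z, kr N α r z = C * r ^ (-α) := by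
  have := EN_nontrivial N hN
  refine ⟨N * (volume : Measure (EN N)).real (ball 0 1) / α, ?_, fun r hr => ?_⟩
  · have : 0 < (volume : Measure (EN N)).real (ball 0 1) :=
      ENNReal.toReal_pos (measure_ball_pos _ _ one_pos).ne' measure_ball_lt_top.ne
    have : (0:ℝ) < N := by exact_mod_cast (by omega : 0 < N)
    positivity
  · have h := integral_fun_norm_addHaar (volume : Measure (EN N))
      (fun y : ℝ => if r < y then y ^ (-((N : ℝ) + α)) else 0)
    rw [setIntegral_congr_fun measurableSet_Ioi (kr_radial_aux N hN α r hr),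
      setIntegral_indicator measurableSet_Ioi] at h
    rw [show Ioi (0:ℝ) ∩ Ioi r = Ioi r by
      rw [Set.inter_eq_right]; exact Ioi_subset_Ioi hr.le,
      integral_Ioi_rpow_of_lt (by linarith) hr] at h
    unfold kr
    rw [h]
    simp only [finrank_euclideanSpace, Fintype.card_fin, smul_eq_mul, nsmul_eq_mul]
    rw [show -1 - α + 1 = -α by ring, neg_div_neg_eq]; ring

/-- polar coordinates -/
lemma polar_integral (N : ℕ) (hN : 3 ≤ N) (F : EN N → ℝ) (hF : Integrable F) :
    Integrable (fun ω : sphere (0 : EN N) 1 => ∫ s in Ioi (0:ℝ), s ^ (N - 1) * F (s • (ω : EN N)))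
      (sphereMeasure N) ∧
    ∫ z, F z = ∫ ω : sphere (0 : EN N) 1, (∫ s in Ioi (0:ℝ), s ^ (N - 1) * F (s • (ω : EN N)))
      ∂(sphereMeasure N) := by
  have := EN_nontrivial N hN
  have hmp := (volume : Measure (EN N)).measurePreserving_homeomorphUnitSphereProd
  simp only [finrank_euclideanSpace, Fintype.card_fin] at hmp
  have hG : ∀ x : ({(0 : EN N)}ᶜ : Set (EN N)),
      (fun p : sphere (0 : EN N) 1 × Ioi (0:ℝ) => F ((p.2 : ℝ) • (p.1 : EN N)))
        (homeomorphUnitSphereProd (EN N) x) = F x := by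
    intro x
    have hx : ‖(x : EN N)‖ ≠ 0 := norm_ne_zero_iff.2 x.2
    simp [smul_smul, hx]
  have key : ∀ ω : sphere (0 : EN N) 1,
      ∫ s : Ioi (0:ℝ), F ((s : ℝ) • (ω : EN N)) ∂(Measure.volumeIoiPow (N - 1))
      = ∫ s in Ioi (0:ℝ), s ^ (N - 1) * F (s • (ω : EN N)) := by
    intro ω
    simp only [Measure.volumeIoiPow, ENNReal.ofReal]
    rw [integral_withDensity_eq_integral_smul,
        integral_subtype_comap measurableSet_Ioi
          fun a ↦ Real.toNNReal (a ^ (N - 1)) • F (a • (ω : EN N)),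
        setIntegral_congr_fun measurableSet_Ioi fun x hx ↦ ?_]
    · rw [NNReal.smul_def, Real.coe_toNNReal _ (pow_nonneg (le_of_lt hx) _), smul_eq_mul]
    · exact (measurable_subtype_coe.pow_const _).real_toNNReal
  have hint : Integrable (fun p : sphere (0 : EN N) 1 × Ioi (0:ℝ) => F ((p.2 : ℝ) • (p.1 : EN N)))
      ((sphereMeasure N).prod (Measure.volumeIoiPow (N - 1))) := by
    rw [sphereMeasure, ← hmp.integrable_comp_emb (Homeomorph.measurableEmbedding _)]
    rw [show (fun p : sphere (0 : EN N) 1 × Ioi (0:ℝ) => F ((p.2 : ℝ) • (p.1 : EN N))) ∘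
      (homeomorphUnitSphereProd (EN N)) = F ∘ Subtype.val from funext hG]
    rw [← integrableOn_iff_comap_subtypeVal (measurableSet_singleton _).compl]
    exact hF.integrableOn
  have : IsFiniteMeasure (sphereMeasure N) := by unfold sphereMeasure; infer_instance
  constructor
  · have := hint.integral_prod_left
    simpa only [key] using this
  · calc ∫ z, F z = ∫ x : ({(0)}ᶜ : Set (EN N)), F x.1 ∂((volume : Measure (EN N)).comap (↑)) := by
          rw [integral_subtype_comap (measurableSet_singleton _).compl fun x ↦ F x,
            restrict_compl_singleton]
      _ = ∫ p, (fun p : sphere (0 : EN N) 1 × Ioi (0:ℝ) => F ((p.2 : ℝ) • (p.1 : EN N))) p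
            ∂((sphereMeasure N).prod (Measure.volumeIoiPow (N - 1))) := by
          rw [sphereMeasure, ← hmp.integral_comp (Homeomorph.measurableEmbedding _)]
          exact integral_congr_ae (Eventually.of_forall fun x => (hG x).symm)
      _ = _ := by
          rw [integral_prod _ hint]
          exact integral_congr_ae (Eventually.of_forall fun x => key x)

lemma polar_le (N : ℕ) (hN : 3 ≤ N) (F : EN N → ℝ) (hF : Integrable F) (C : ℝ)
    (h : ∀ ω : EN N, ‖ω‖ = 1 → ∫ s in Ioi (0:ℝ), s ^ (N - 1) * F (s • ω) ≤ C) :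
    ∫ z, F z ≤ C * (sphereMeasure N).real univ := by
  have : IsFiniteMeasure (sphereMeasure N) := by unfold sphereMeasure; infer_instance
  obtain ⟨h1, h2⟩ := polar_integral N hN F hF
  rw [h2]
  calc _ ≤ ∫ ω : sphere (0 : EN N) 1, C ∂(sphereMeasure N) := by
        apply integral_mono h1 (integrable_const _)
        intro ω
        exact h ω (by simpa using ω.2)
    _ = _ := by simp [mul_comm]

/-- truncated operator -/
def Lr (N : ℕ) (α r : ℝ) (u : EN N → ℝ) (x : EN N) : ℝ := ∫ z, (u (x + z) - u x) * kr N α r z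

lemma shift_kr_integrable (N : ℕ) (α r : ℝ) (hα : 0 < α) (hr : 0 < r)
    (u : EN N → ℝ) (hu : Integrable u) (x : EN N) :
    Integrable (fun z => u (x + z) * kr N α r z) := by
  refine (hu.comp_add_left x).mul_bdd (c := r ^ (-((N : ℝ) + α)))
    (kr_measurable N α r).aestronglyMeasurable (Eventually.of_forall fun z => ?_)
  rw [Real.norm_of_nonneg (kr_nonneg _ _ _ _)]
  exact kr_le N α r hα hr z

lemma Lr_integrable (N : ℕ) (hN : 3 ≤ N) (α r : ℝ) (hα : 0 < α) (hr : 0 < r)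
    (u : EN N → ℝ) (hu : Integrable u) (x : EN N) :
    Integrable (fun z => (u (x + z) - u x) * kr N α r z) := by
  simp only [sub_mul]
  exact (shift_kr_integrable N α r hα hr u hu x).sub ((kr_integrable N hN α r hα hr).const_mul _)

lemma Lr_eq (N : ℕ) (hN : 3 ≤ N) (α r : ℝ) (hα : 0 < α) (hr : 0 < r)
    (u : EN N → ℝ) (hu : Integrable u) (x : EN N) :
    Lr N α r u x = (∫ z, u (x + z) * kr N α r z) - u x * ∫ z, kr N α r z := by
  unfold Lr
  simp only [sub_mul]
  rw [integral_sub (shift_kr_integrable N α r hα hr u hu x)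
    ((kr_integrable N hN α r hα hr).const_mul _), integral_const_mul]

lemma Lr_symm (N : ℕ) (hN : 3 ≤ N) (α r : ℝ) (hα : 0 < α) (hr : 0 < r)
    (u : EN N → ℝ) (hu : Integrable u) (x : EN N) :
    Integrable (fun z => (u (x + z) + u (x - z) - 2 * u x) * kr N α r z) ∧
    ∫ z, (u (x + z) + u (x - z) - 2 * u x) * kr N α r z = 2 * Lr N α r u x := by
  have h1 := Lr_integrable N hN α r hα hr u hu x
  have h2 := h1.comp_neg
  have e2 : ∫ z, (u (x + -z) - u x) * kr N α r (-z) = Lr N α r u x :=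
    integral_neg_eq_self (fun z => (u (x + z) - u x) * kr N α r z) volume
  have e : (fun z => (u (x + z) + u (x - z) - 2 * u x) * kr N α r z) =
      fun z => (u (x + z) - u x) * kr N α r z + (u (x + -z) - u x) * kr N α r (-z) := by
    funext z; rw [kr_neg, ← sub_eq_add_neg]; ring
  rw [e]
  refine ⟨h1.add h2, ?_⟩
  rw [integral_add h1 h2, e2]; unfold Lr; ring

lemma Lr_polar_le (N : ℕ) (hN : 3 ≤ N) (α r : ℝ) (hα : 0 < α) (hr : 0 < r)
    (u : EN N → ℝ) (hu : Integrable u) (x : EN N) (C : ℝ)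
    (h : ∀ ω : EN N, ‖ω‖ = 1 → ∫ s in Ioi r,
      (u (x + s • ω) + u (x - s • ω) - 2 * u x) * s ^ (-1 - α) ≤ C) :
    Lr N α r u x ≤ C * ((sphereMeasure N).real univ / 2) := by
  obtain ⟨h1, h2⟩ := Lr_symm N hN α r hα hr u hu x
  have := polar_le N hN _ h1 C ?_
  · rw [h2] at this; linarith
  · intro ω hω
    refine le_trans (le_of_eq ?_) (h ω hω)
    rw [show Ioi r = Ioi 0 ∩ Ioi r by
      rw [Set.inter_eq_right.2]; exact Ioi_subset_Ioi hr.le, ← setIntegral_indicator measurableSet_Ioi]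
    refine setIntegral_congr_fun measurableSet_Ioi fun s hs => ?_
    have hs : 0 < s := hs
    simp only [kr, norm_smul, hω, mul_one, Real.norm_of_nonneg hs.le, indicator, mem_Ioi]
    split_ifs
    · rw [← pow_mul_rpow N hN α s hs]; ring
    · simp

lemma Lr_neg (N : ℕ) (α r : ℝ) (u : EN N → ℝ) (x : EN N) :
    Lr N α r (fun y => - u y) x = - Lr N α r u x := by
  unfold Lr; rw [← integral_neg]; congr 1; funext z; ring

lemma Lr_const_mul (N : ℕ) (α r c : ℝ) (u : EN N → ℝ) (x : EN N) :
    Lr N α r (fun y => c * u y) x = c * Lr N α r u x := by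
  unfold Lr; rw [← integral_const_mul]; congr 1; funext z; ring

/-- restriction of `(1-|x|^2)_+^{-q}` to a line -/
def g1 (q a b s : ℝ) : ℝ := if 0 < (a - s) * (b + s) then ((a - s) * (b + s)) ^ (-q) else 0

lemma g1_of_lt (q a b s : ℝ) (hb : 0 < b) (hs : 0 < s) (h : s < a) :
    g1 q a b s = ((a - s) * (b + s)) ^ (-q) := by
  unfold g1; rw [if_pos]; exact mul_pos (by linarith) (by linarith)

lemma g1_of_ge (q a b s : ℝ) (hb : 0 < b) (hs : 0 < s) (h : a ≤ s) :
    g1 q a b s = 0 := by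
  unfold g1; rw [if_neg]; 
  have := mul_nonneg (show 0 ≤ s - a by linarith) (show 0 ≤ b + s by linarith)
  nlinarith

lemma g1_nonneg (q a b s : ℝ) : 0 ≤ g1 q a b s := by
  unfold g1; split_ifs <;> positivity

lemma g1_rescale (q a b s : ℝ) (ha : 0 < a) (hb : 0 < b) (hs : 0 < s) (h : s < a) :
    g1 q a b s = (a * b) ^ (-q) * ((1 - s / a) * (1 + s / b)) ^ (-q) := by
  rw [g1_of_lt q a b s hb hs h, ← Real.mul_rpow (by positivity)]
  · congr 1; field_simp
  · apply mul_nonneg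
    · rw [sub_nonneg, div_le_one ha]; exact h.le
    · positivity

lemma inv_rpow_bern (q y : ℝ) (hq0 : 0 < q) (hq1 : q < 1) (hy : 0 < y) :
    y ^ (-q) ≤ 1 + q * (1 / y - 1) := by
  have := rpow_one_add_le_one_add_mul_self (s := 1 / y - 1) (p := q)
    (by have : 0 < 1 / y := by positivity
        linarith) hq0.le hq1.le
  rw [add_sub_cancel, one_div, Real.inv_rpow hy.le, ← Real.rpow_neg hy.le] at this
  simpa using this

lemma rat_bound (x y t : ℝ) (hx : 0 < x) (hy : 0 < y) (hx1 : x ≤ t) (hy1 : y ≤ t) (ht : t ≤ 1 / 2) :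
    1 / ((1 - x) * (1 + y)) + 1 / ((1 + x) * (1 - y)) - 2 ≤ 8 * t ^ 2 := by
  have h1 : 0 < 1 - x := by linarith
  have h2 : 0 < 1 - y := by linarith
  have e : 1 / ((1 - x) * (1 + y)) + 1 / ((1 + x) * (1 - y)) - 2 =
    (2 * x ^ 2 + 2 * y ^ 2 - 2 * x * y - 2 * (x * y) ^ 2) / ((1 - x ^ 2) * (1 - y ^ 2)) := by
    rw [show (1 - x ^ 2) * (1 - y ^ 2) = (1 - x) * (1 + x) * ((1 - y) * (1 + y)) by ring]
    field_simp; ring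
  have hx2 : x ^ 2 ≤ t ^ 2 := by nlinarith
  have hy2 : y ^ 2 ≤ t ^ 2 := by nlinarith
  have ht2 : t ^ 2 ≤ 1 / 4 := by nlinarith
  have hden : 9 / 16 ≤ (1 - x ^ 2) * (1 - y ^ 2) := by nlinarith [sq_nonneg x, sq_nonneg y]
  rw [e, div_le_iff₀ (by linarith)]
  have : 8 * t ^ 2 * (9 / 16) ≤ 8 * t ^ 2 * ((1 - x ^ 2) * (1 - y ^ 2)) := by gcongr
  nlinarith [mul_pos hx hy, sq_nonneg (x * y)]

lemma g1_near (q a b d s : ℝ) (hq0 : 0 < q) (hq1 : q < 1) (hd : 0 < d) (hda : d ≤ a) (hdb : d ≤ b)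
    (hs : 0 < s) (hsd : s ≤ d / 2) :
    g1 q a b s + g1 q b a s - 2 * (a * b) ^ (-q) ≤ (a * b) ^ (-q) * (8 * (s / d) ^ 2) := by
  have ha : 0 < a := by linarith
  have hb : 0 < b := by linarith
  rw [g1_rescale q a b s ha hb hs (by linarith), g1_rescale q b a s hb ha hs (by linarith),
    mul_comm b a]
  have hx1 : s / a ≤ s / d := by gcongr
  have hy1 : s / b ≤ s / d := by gcongr
  have ht : s / d ≤ 1 / 2 := by rw [div_le_iff₀ hd]; linarith
  have hx : 0 < s / a := by positivity
  have hy : 0 < s / b := by positivity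
  have k := rat_bound _ _ _ hx hy hx1 hy1 ht
  have k1 := inv_rpow_bern q ((1 - s / a) * (1 + s / b)) hq0 hq1
    (mul_pos (by linarith) (by linarith))
  have k2 := inv_rpow_bern q ((1 - s / b) * (1 + s / a)) hq0 hq1
    (mul_pos (by linarith) (by linarith))
  rw [mul_comm (1 - s / b)] at k2
  rw [mul_comm (1 - s / b)]
  have hP : 0 ≤ (a * b) ^ (-q) := by positivity
  have : ((1 - s / a) * (1 + s / b)) ^ (-q) + ((1 + s / a) * (1 - s / b)) ^ (-q) - 2 ≤
      8 * (s / d) ^ 2 := by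
    nlinarith [sq_nonneg (s / d)]
  nlinarith [mul_le_mul_of_nonneg_left this hP]

lemma g1_far (q α a b s : ℝ) (hq0 : 0 < q) (hq1 : q < 1) (hα : 0 < α) (ha : 0 < a) (hb : 0 < b)
    (hs : 0 < s) :
    g1 q a b s * s ^ (-1 - α) ≤ (a * b) ^ (-q) * (2 * s ^ (-1 - α) +
      (a / 2) ^ (-1 - α) * (Ioc 0 a).indicator (fun s => a ^ q * (a - s) ^ (-q)) s) := by
  have hP : 0 ≤ (a * b) ^ (-q) := by positivity
  have hind : 0 ≤ (Ioc 0 a).indicator (fun s => a ^ q * (a - s) ^ (-q)) s := by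
    apply indicator_nonneg
    intro t ht
    have : 0 ≤ a - t := by linarith [ht.2]
    positivity
  rcases le_or_gt a s with h | h
  · rw [g1_of_ge q a b s hb hs h, zero_mul]
    positivity
  rw [g1_rescale q a b s ha hb hs h, mul_assoc]
  apply mul_le_mul_of_nonneg_left _ hP
  have hsa : 0 < 1 - s / a := by rw [sub_pos, div_lt_one ha]; exact h
  have h1 : ((1 - s / a) * (1 + s / b)) ^ (-q) ≤ (1 - s / a) ^ (-q) := by
    apply Real.rpow_le_rpow_of_nonpos hsa _ (by linarith)
    have : 0 < s / b := by positivity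
    nlinarith
  rcases le_or_gt s (a / 2) with h2 | h2
  · have h3 : (1 - s / a) ^ (-q) ≤ 2 := by
      have h4 := inv_rpow_bern q (1 - s / a) hq0 hq1 hsa
      have h5 : 1 / (1 - s / a) ≤ 2 := by
        rw [div_le_iff₀ hsa]
        have : s / a ≤ 1 / 2 := by rw [div_le_iff₀ ha]; linarith
        linarith
      nlinarith
    have h6 : 0 ≤ (a / 2) ^ (-1 - α) * (Ioc 0 a).indicator (fun s => a ^ q * (a - s) ^ (-q)) s := by
      positivity
    have h7 : 0 ≤ s ^ (-1 - α) := by positivity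
    nlinarith
  · have h3 : s ^ (-1 - α) ≤ (a / 2) ^ (-1 - α) :=
      Real.rpow_le_rpow_of_nonpos (by positivity) h2.le (by linarith)
    have h7 : 0 ≤ s ^ (-1 - α) := by positivity
    rw [indicator_of_mem (show s ∈ Ioc 0 a from ⟨hs, h.le⟩)]
    have h8 : (1 - s / a) ^ (-q) = a ^ q * (a - s) ^ (-q) := by
      rw [show 1 - s / a = a⁻¹ * (a - s) by field_simp, Real.mul_rpow (by positivity) (by linarith),
        Real.inv_rpow ha.le, Real.rpow_neg ha.le, inv_inv]
    rw [← h8]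
    have h9 : 0 ≤ (1 - s / a) ^ (-q) := by positivity
    nlinarith [mul_le_mul h1 h3 h7 h9]

lemma int_le (f G : ℝ → ℝ) (r : ℝ) (hr : 0 < r) (hfG : ∀ s, 0 < s → f s ≤ G s)
    (hG : ∀ s, 0 < s → 0 ≤ G s) (hi : IntegrableOn G (Ioi 0)) :
    ∫ s in Ioi r, f s ≤ ∫ s in Ioi 0, G s := by
  have hsub : Ioi r ⊆ Ioi (0:ℝ) := Ioi_subset_Ioi hr.le
  have h2 : ∫ s in Ioi r, G s ≤ ∫ s in Ioi 0, G s := by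
    apply setIntegral_mono_set hi _ hsub.eventuallyLE
    filter_upwards [ae_restrict_mem measurableSet_Ioi] with s hs using hG s hs
  by_cases hf : IntegrableOn f (Ioi r)
  · refine le_trans ?_ h2
    exact setIntegral_mono_on hf (hi.mono_set hsub) measurableSet_Ioi
      (fun s hs => hfG s (hr.trans hs))
  · rw [integral_undef hf]
    exact setIntegral_nonneg measurableSet_Ioi hG

lemma int_piece (q a : ℝ) (hq0 : 0 < q) (hq1 : q < 1) (ha : 0 < a) :
    IntegrableOn ((Ioc 0 a).indicator (fun s => a ^ q * (a - s) ^ (-q))) (Ioi 0) ∧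
    ∫ s in Ioi 0, (Ioc 0 a).indicator (fun s => a ^ q * (a - s) ^ (-q)) s = a / (1 - q) := by
  have hii : IntervalIntegrable (fun s : ℝ => s ^ (-q)) volume 0 a :=
    intervalIntegral.intervalIntegrable_rpow' (by linarith)
  have hii2 : IntervalIntegrable (fun s : ℝ => (a - s) ^ (-q)) volume 0 a := by
    have := hii.comp_sub_left a
    simpa using this.symm
  have hint : IntegrableOn (fun s : ℝ => a ^ q * (a - s) ^ (-q)) (Ioc 0 a) :=
    ((intervalIntegrable_iff_integrableOn_Ioc_of_le ha.le).1 hii2).const_mul _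
  refine ⟨((integrable_indicator_iff measurableSet_Ioc).2 hint).integrableOn, ?_⟩
  rw [setIntegral_indicator measurableSet_Ioc, show Ioi (0:ℝ) ∩ Ioc 0 a = Ioc 0 a from
    inter_eq_right.2 (fun s hs => hs.1), ← intervalIntegral.integral_of_le ha.le,
    intervalIntegral.integral_const_mul]
  rw [intervalIntegral.integral_comp_sub_left (fun s => s ^ (-q)), integral_rpow (Or.inl (by linarith))]
  simp only [sub_self, sub_zero]
  rw [Real.zero_rpow (by linarith), sub_zero, ← mul_div_assoc, ← Real.rpow_add ha]
  simp [neg_add_eq_sub]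

lemma super1 (q α : ℝ) (hq0 : 0 < q) (hq1 : q < 1) (hα : 0 < α) (hα2 : α < 2) :
    ∃ C : ℝ, 0 < C ∧ ∀ a b d r : ℝ, 0 < d → d ≤ a → d ≤ b → 0 < r →
      ∫ s in Ioi r, (g1 q a b s + g1 q b a s - 2 * (a * b) ^ (-q)) * s ^ (-1 - α) ≤
        C * (a * b) ^ (-q) * d ^ (-α) := by
  have h1q : 0 < 1 - q := by linarith
  have h2a : 0 < 2 - α := by linarith
  refine ⟨8 * (1 / 2) ^ (2 - α) / (2 - α) + 4 * (1 / 2) ^ (-α) / α +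
    2 * ((1 / 2) ^ (-1 - α) / (1 - q)), by positivity, fun a b d r hd hda hdb hr => ?_⟩
  have ha : 0 < a := by linarith
  have hb : 0 < b := by linarith
  have hP : 0 ≤ (a * b) ^ (-q) := by positivity
  obtain ⟨ia, ea⟩ := int_piece q a hq0 hq1 ha
  obtain ⟨ib, eb⟩ := int_piece q b hq0 hq1 hb
  have i1 : IntegrableOn ((Ioc 0 (d/2)).indicator (fun s : ℝ => s ^ (1 - α))) (Ioi 0) := by
    apply Integrable.integrableOn
    rw [integrable_indicator_iff measurableSet_Ioc,
      ← intervalIntegrable_iff_integrableOn_Ioc_of_le (by positivity)]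
    exact intervalIntegral.intervalIntegrable_rpow' (by linarith)
  have e1 : ∫ s in Ioi (0:ℝ), (Ioc 0 (d/2)).indicator (fun s : ℝ => s ^ (1 - α)) s =
      (d/2) ^ (2 - α) / (2 - α) := by
    rw [setIntegral_indicator measurableSet_Ioc, show Ioi (0:ℝ) ∩ Ioc 0 (d/2) = Ioc 0 (d/2) from
      inter_eq_right.2 (fun s hs => hs.1), ← intervalIntegral.integral_of_le (by positivity),
      integral_rpow (Or.inl (by linarith)), Real.zero_rpow (by linarith), sub_zero]
    rw [show 1 - α + 1 = 2 - α by ring]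
  have i2 : IntegrableOn ((Ioi (d/2)).indicator (fun s : ℝ => s ^ (-1 - α))) (Ioi 0) := by
    apply Integrable.integrableOn
    rw [integrable_indicator_iff measurableSet_Ioi]
    exact integrableOn_Ioi_rpow_of_lt (by linarith) (by positivity)
  have e2 : ∫ s in Ioi (0:ℝ), (Ioi (d/2)).indicator (fun s : ℝ => s ^ (-1 - α)) s =
      (d/2) ^ (-α) / α := by
    rw [setIntegral_indicator measurableSet_Ioi, show Ioi (0:ℝ) ∩ Ioi (d/2) = Ioi (d/2) from
      inter_eq_right.2 (Ioi_subset_Ioi (by positivity)),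
      integral_Ioi_rpow_of_lt (by linarith) (by positivity), show -1 - α + 1 = -α by ring,
      neg_div_neg_eq]
  have nn : ∀ c s : ℝ, 0 ≤ (Ioc 0 c).indicator (fun s => c ^ q * (c - s) ^ (-q)) s := by
    intro c s
    apply indicator_nonneg
    intro t ht
    have : 0 ≤ c - t := by linarith [ht.2]
    have : 0 ≤ c := by linarith [ht.2, ht.1]
    positivity
  have nn1 : ∀ s : ℝ, 0 < s → 0 ≤ (Ioc 0 (d/2)).indicator (fun s : ℝ => s ^ (1 - α)) s := by
    intro s hs; apply indicator_apply_nonneg; intro _; positivity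
  have nn2 : ∀ s : ℝ, 0 < s → 0 ≤ (Ioi (d/2)).indicator (fun s : ℝ => s ^ (-1 - α)) s := by
    intro s hs; apply indicator_apply_nonneg; intro _; positivity
  have J1 := i1.const_mul (8 / d ^ 2)
  have J2 := i2.const_mul 4
  have J3 := ia.const_mul ((a/2) ^ (-1 - α))
  have J4 := ib.const_mul ((b/2) ^ (-1 - α))
  refine le_trans (int_le _ (fun s => (a * b) ^ (-q) * ((8 / d ^ 2 *
      (Ioc 0 (d/2)).indicator (fun s : ℝ => s ^ (1 - α)) s +
      4 * (Ioi (d/2)).indicator (fun s : ℝ => s ^ (-1 - α)) s) +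
      ((a/2) ^ (-1 - α) * (Ioc 0 a).indicator (fun s => a ^ q * (a - s) ^ (-q)) s +
      (b/2) ^ (-1 - α) * (Ioc 0 b).indicator (fun s => b ^ q * (b - s) ^ (-q)) s))) r hr ?_ ?_ ?_) ?_
  · intro s hs
    have hsp : 0 ≤ s ^ (-1 - α) := by positivity
    have A3 : 0 ≤ (a/2) ^ (-1 - α) * (Ioc 0 a).indicator (fun s => a ^ q * (a - s) ^ (-q)) s :=
      mul_nonneg (by positivity) (nn _ _)
    have A4 : 0 ≤ (b/2) ^ (-1 - α) * (Ioc 0 b).indicator (fun s => b ^ q * (b - s) ^ (-q)) s :=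
      mul_nonneg (by positivity) (nn _ _)
    rcases le_or_gt s (d/2) with h | h
    · rw [indicator_of_mem (show s ∈ Ioc 0 (d/2) from ⟨hs, h⟩),
        indicator_of_notMem (show s ∉ Ioi (d/2) by simpa using h)]
      have k := mul_le_mul_of_nonneg_right (g1_near q a b d s hq0 hq1 hd hda hdb hs h) hsp
      refine k.trans ?_
      rw [mul_assoc]
      apply mul_le_mul_of_nonneg_left _ hP
      have : 8 * (s / d) ^ 2 * s ^ (-1 - α) = 8 / d ^ 2 * s ^ (1 - α) := by
        rw [show (1 - α) = 2 + (-1 - α) by ring, Real.rpow_add hs, Real.rpow_two]; field_simp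
      rw [this]; linarith
    · rw [indicator_of_notMem (show s ∉ Ioc 0 (d/2) by simp; intro _; linarith),
        indicator_of_mem (show s ∈ Ioi (d/2) from h)]
      have k1 := g1_far q α a b s hq0 hq1 hα ha hb hs
      have k2 := g1_far q α b a s hq0 hq1 hα hb ha hs
      rw [mul_comm b a] at k2
      have k3 : 0 ≤ 2 * (a * b) ^ (-q) * s ^ (-1 - α) := by positivity
      nlinarith
  · intro s hs
    apply mul_nonneg hP
    have := nn1 s hs
    have := nn2 s hs
    have := nn a s
    have := nn b s
    positivity
  · exact ((J1.add J2).add (J3.add J4)).const_mul _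
  · have E : (∫ s in Ioi (0:ℝ), (a * b) ^ (-q) * ((8 / d ^ 2 *
      (Ioc 0 (d/2)).indicator (fun s : ℝ => s ^ (1 - α)) s +
      4 * (Ioi (d/2)).indicator (fun s : ℝ => s ^ (-1 - α)) s) +
      ((a/2) ^ (-1 - α) * (Ioc 0 a).indicator (fun s => a ^ q * (a - s) ^ (-q)) s +
      (b/2) ^ (-1 - α) * (Ioc 0 b).indicator (fun s => b ^ q * (b - s) ^ (-q)) s))) =
      (a * b) ^ (-q) * ((8 / d ^ 2 * ((d/2) ^ (2 - α) / (2 - α)) + 4 * ((d/2) ^ (-α) / α)) +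
        ((a/2) ^ (-1 - α) * (a / (1 - q)) + (b/2) ^ (-1 - α) * (b / (1 - q)))) := by
      have F1 := integral_add (J1.add J2) (J3.add J4)
      simp only [Pi.add_apply] at F1
      rw [integral_const_mul, F1, integral_add J1 J2, integral_add J3 J4, integral_const_mul, integral_const_mul, integral_const_mul,
        integral_const_mul, e1, e2, ea, eb]
    rw [E]
    have t : ∀ c, 0 < c → d ≤ c → (c/2) ^ (-1 - α) * (c / (1 - q)) ≤
        (1/2) ^ (-1 - α) / (1 - q) * d ^ (-α) := by
      intro c hc hdc
      have : (c/2) ^ (-1 - α) * (c / (1 - q)) = (1/2) ^ (-1 - α) / (1 - q) * c ^ (-α) := by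
        rw [show c / 2 = 1 / 2 * c by ring, Real.mul_rpow (by positivity) hc.le,
          show -α = (-1 - α) + 1 by ring, Real.rpow_add hc, Real.rpow_one]; field_simp
      rw [this]
      apply mul_le_mul_of_nonneg_left _ (by positivity)
      exact Real.rpow_le_rpow_of_nonpos hd hdc (by linarith)
    have t1 : 8 / d ^ 2 * ((d/2) ^ (2 - α) / (2 - α)) = 8 * (1 / 2) ^ (2 - α) / (2 - α) * d ^ (-α) := by
      rw [show d / 2 = 1 / 2 * d by ring, Real.mul_rpow (by positivity) hd.le,
          show (2 - α) = 2 + (-α) by ring, Real.rpow_add hd, Real.rpow_two]; field_simp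
    have t2 : 4 * ((d/2) ^ (-α) / α) = 4 * (1 / 2) ^ (-α) / α * d ^ (-α) := by
      rw [show d / 2 = 1 / 2 * d by ring, Real.mul_rpow (by positivity) hd.le]; field_simp
    have ta := t a ha hda
    have tb := t b hb hdb
    rw [t1, t2]
    nlinarith [mul_le_mul_of_nonneg_left ta hP, mul_le_mul_of_nonneg_left tb hP]

lemma harm_base (α c T : ℝ) (hα : 0 < α) (hc : 0 < c) (hT : c ≤ T) :
    IntervalIntegrable (fun t : ℝ => t * (t ^ 2 - c ^ 2) ^ (α / 2 - 1)) volume c T ∧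
    ∫ t in c..T, t * (t ^ 2 - c ^ 2) ^ (α / 2 - 1) = (T ^ 2 - c ^ 2) ^ (α / 2) / α := by
  have hcont : ContinuousOn (fun t : ℝ => (t ^ 2 - c ^ 2) ^ (α / 2) / α) (Icc c T) := by
    apply ContinuousOn.div_const
    apply ContinuousOn.rpow_const (by fun_prop)
    intro t _; right; positivity
  have hder : ∀ t ∈ Ioo c T, HasDerivAt (fun t : ℝ => (t ^ 2 - c ^ 2) ^ (α / 2) / α)
      (t * (t ^ 2 - c ^ 2) ^ (α / 2 - 1)) t := by
    intro t ht
    have hpos : 0 < t ^ 2 - c ^ 2 := by nlinarith [ht.1]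
    have h1 : HasDerivAt (fun t : ℝ => t ^ 2 - c ^ 2) (2 * t) t := by
      have := (hasDerivAt_pow 2 t).sub_const (c ^ 2)
      simpa using this
    have := (h1.rpow_const (p := α / 2) (Or.inl hpos.ne')).div_const α
    have e : t * (t ^ 2 - c ^ 2) ^ (α / 2 - 1) = 2 * t * (α / 2) * (t ^ 2 - c ^ 2) ^ (α / 2 - 1) / α := by
      rw [eq_div_iff hα.ne']; ring
    rw [e]; exact this
  have hint : IntervalIntegrable (fun t : ℝ => t * (t ^ 2 - c ^ 2) ^ (α / 2 - 1)) volume c T := by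
    rw [intervalIntegrable_iff_integrableOn_Ioc_of_le hT]
    apply intervalIntegral.integrableOn_deriv_of_nonneg hcont hder
    intro t ht
    have hpos : 0 < t ^ 2 - c ^ 2 := by nlinarith [ht.1]
    have : 0 < t := by linarith [ht.1]
    positivity
  refine ⟨hint, ?_⟩
  rw [intervalIntegral.integral_eq_sub_of_hasDerivAt_of_le hT hcont hder hint]
  simp [Real.zero_rpow (show α / 2 ≠ 0 by positivity)]

lemma harm_base2 (α c T : ℝ) (hα : 0 < α) (hc : 0 < c) (hT : c ≤ T) :
    IntervalIntegrable (fun t : ℝ => (t ^ 2 - c ^ 2) ^ (α / 2 - 1)) volume c T := by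
  have h := (harm_base α c T hα hc hT).1
  have h2 := h.mul_continuousOn (g := fun t => t⁻¹) (by
    rw [uIcc_of_le hT]
    apply ContinuousOn.inv₀ continuousOn_id
    intro t ht; exact (hc.trans_le ht.1).ne')
  refine h2.congr ?_
  rw [uIoc_of_le hT]
  intro t ht
  have : t ≠ 0 := (hc.trans ht.1).ne'
  simp only []
  rw [mul_comm t, mul_assoc, mul_inv_cancel₀ this, mul_one]

lemma harm_cv (α a b r : ℝ) (hα : 0 < α) (ha : 0 < a) (hb : 0 < b) (hr : 0 < r) (hra : r < a)
    (C D : ℝ) (hC : C = (1 / a + 1 / b) / 2) (hD : D = (1 / a - 1 / b) / 2) :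
    IntegrableOn (fun s => g1 (1 - α / 2) a b s * s ^ (-1 - α)) (Ioi r) ∧
    ∫ s in Ioi r, g1 (1 - α / 2) a b s * s ^ (-1 - α) =
      (a * b) ^ (-(1 - α / 2)) * ∫ t in C..(1 / r - D), (t + D) * (t ^ 2 - C ^ 2) ^ (α / 2 - 1) := by
  have hA : 0 < 1 / a := by positivity
  have hB : 0 < 1 / b := by positivity
  have hCp : 0 < C := by rw [hC]; positivity
  have hCD : C + D = 1 / a := by rw [hC, hD]; ring
  have hCD' : C - D = 1 / b := by rw [hC, hD]; ring
  have hR : 1 / a < 1 / r := by gcongr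
  have hle : C ≤ 1 / r - D := by linarith
  set S : Set ℝ := Ioo C (1 / r - D) with hS
  have himg : (fun t : ℝ => (t + D)⁻¹) '' S = Ioo r a := by
    ext y
    simp only [hS, mem_image, mem_Ioo]
    constructor
    · rintro ⟨t, ⟨h1, h2⟩, rfl⟩
      have h3 : 1 / a < t + D := by linarith
      have h4 : t + D < 1 / r := by linarith
      have h5 : 0 < t + D := by linarith
      constructor
      · rw [lt_inv_comm₀ hr h5, ← one_div]; exact h4
      · rw [inv_lt_comm₀ h5 ha, ← one_div]; exact h3
    · rintro ⟨h1, h2⟩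
      have hy : 0 < y := by linarith
      have h3 : 1 / a < 1 / y := by gcongr
      have h4 : 1 / y < 1 / r := by gcongr
      refine ⟨1 / y - D, ⟨by linarith, by linarith⟩, by simp⟩
  have hder : ∀ t ∈ S, HasDerivWithinAt (fun t : ℝ => (t + D)⁻¹) (-1 / (t + D) ^ 2) S t := by
    intro t ht
    have h5 : 0 < t + D := by linarith [ht.1]
    exact (((hasDerivAt_id t).add_const D).fun_inv h5.ne').hasDerivWithinAt
  have hinj : InjOn (fun t : ℝ => (t + D)⁻¹) S := by
    intro t _ t' _ h
    have := inv_injective h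
    linarith
  have hfun : EqOn (fun t => |(-1 / (t + D) ^ 2)| • ((fun s => g1 (1 - α / 2) a b s * s ^ (-1 - α)) (t + D)⁻¹))
      (fun t => (a * b) ^ (-(1 - α / 2)) * ((t + D) * (t ^ 2 - C ^ 2) ^ (α / 2 - 1))) S := by
    intro t ht
    have h5 : 1 / a < t + D := by linarith [ht.1]
    have h6 : 0 < t + D := by linarith
    have h7 : (t + D)⁻¹ < a := by
      rw [inv_lt_comm₀ h6 ha, ← one_div]; exact h5
    have hpos : 0 < t ^ 2 - C ^ 2 := by nlinarith [ht.1]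
    simp only [smul_eq_mul]
    rw [g1_of_lt _ _ _ _ hb (by positivity) h7]
    have e1 : (a - (t + D)⁻¹) * (b + (t + D)⁻¹) = a * b * (t ^ 2 - C ^ 2) * ((t + D) ^ 2)⁻¹ := by
      have e2 : t ^ 2 - C ^ 2 = (t + D - 1 / a) * (t + D + 1 / b) := by
        rw [← hCD, ← hCD']; ring
      rw [e2]; field_simp
    rw [e1, Real.mul_rpow (by positivity) (by positivity), Real.mul_rpow (by positivity) (by positivity)]
    rw [abs_div, abs_neg, abs_one, abs_of_pos (by positivity), Real.inv_rpow (by positivity),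
      Real.inv_rpow h6.le, ← Real.rpow_neg h6.le, ← Real.rpow_neg (by positivity),
      ← Real.rpow_natCast (t + D) 2, ← Real.rpow_mul h6.le]
    rw [one_div, ← Real.rpow_neg h6.le, show -(1 - α / 2) = α / 2 - 1 by ring]
    have e3 : (t + D) = (t + D) ^ (-((2:ℕ):ℝ)) * (t + D) ^ (((2:ℕ):ℝ) * -(α / 2 - 1)) *
        (t + D) ^ (-(-1 - α)) := by
      rw [← Real.rpow_add h6, ← Real.rpow_add h6]
      push_cast
      rw [show (-2:ℝ) + 2 * -(α / 2 - 1) + -(-1 - α) = 1 by ring, Real.rpow_one]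
    conv_rhs => rw [e3]
    ring
  have hbase : IntervalIntegrable (fun t : ℝ => (t + D) * (t ^ 2 - C ^ 2) ^ (α / 2 - 1)) volume C (1 / r - D) := by
    have := (harm_base α C (1 / r - D) hα hCp hle).1.add
      ((harm_base2 α C (1 / r - D) hα hCp hle).const_mul D)
    refine this.congr (fun t _ => ?_)
    ring
  have hInt : IntegrableOn (fun s => g1 (1 - α / 2) a b s * s ^ (-1 - α)) (Ioo r a) := by
    rw [← himg, integrableOn_image_iff_integrableOn_abs_deriv_smul measurableSet_Ioo hder hinj,
      integrableOn_congr_fun hfun measurableSet_Ioo]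
    exact (((intervalIntegrable_iff_integrableOn_Ioc_of_le hle).1 hbase).mono_set
      Ioo_subset_Ioc_self).const_mul _
  have hz : ∀ s ∈ Ici a, g1 (1 - α / 2) a b s * s ^ (-1 - α) = 0 := by
    intro s hs
    rw [g1_of_ge _ _ _ _ hb (ha.trans_le hs) hs, zero_mul]
  have hu : Ioi r = Ioo r a ∪ Ici a := (Ioo_union_Ici_eq_Ioi hra).symm
  have hz0 : IntegrableOn (fun s => g1 (1 - α / 2) a b s * s ^ (-1 - α)) (Ici a) := by
    rw [integrableOn_congr_fun hz measurableSet_Ici]; exact integrableOn_zero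
  constructor
  · rw [hu]; exact hInt.union hz0
  · rw [hu, setIntegral_union (by
      rw [Set.disjoint_left]; intro s hs hs'; exact absurd hs.2 (not_lt.2 hs')) measurableSet_Ici hInt hz0,
      setIntegral_congr_fun measurableSet_Ici hz, integral_zero, add_zero]
    rw [← himg, integral_image_eq_integral_abs_deriv_smul measurableSet_Ioo hder hinj,
      setIntegral_congr_fun measurableSet_Ioo hfun, integral_const_mul,
      intervalIntegral.integral_of_le hle, integral_Ioc_eq_integral_Ioo]

lemma harm_alg (e R A B d : ℝ) (he0 : 0 < e) (he1 : e < 1) (hd : 0 < d) (hA : 0 < A) (hB : 0 < B)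
    (hAd : A ≤ 1 / d) (hBd : B ≤ 1 / d) (hR : 4 / d ≤ R) (C D : ℝ) (hC : C = (A + B) / 2)
    (hD : D = (A - B) / 2) :
    2 * (R ^ 2) ^ e - 2 * (R ^ 2) ^ (e - 1) / d ^ 2 ≤
      ((R - D) ^ 2 - C ^ 2) ^ e + ((R + D) ^ 2 - C ^ 2) ^ e := by
  have hd1 : 0 < 1 / d := by positivity
  have hR' : 4 * (1 / d) ≤ R := by rw [mul_one_div]; exact hR
  have hRp : 0 < R := by linarith
  set X := (R - D) ^ 2 - C ^ 2
  set Y := (R + D) ^ 2 - C ^ 2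
  set Z := R ^ 2 - (1 / d) ^ 2 with hZ
  have hX : X = (R - A) * (R + B) := by simp only [X, hC, hD]; ring
  have hY : Y = (R - B) * (R + A) := by simp only [Y, hC, hD]; ring
  have hX0 : 0 < X := by rw [hX]; exact mul_pos (by linarith) (by linarith)
  have hY0 : 0 < Y := by rw [hY]; exact mul_pos (by linarith) (by linarith)
  have hZ0 : 0 < Z := by rw [hZ]; nlinarith
  have hXY : Z ^ 2 ≤ X * Y := by
    rw [hX, hY, show (R - A) * (R + B) * ((R - B) * (R + A)) = (R ^ 2 - A ^ 2) * (R ^ 2 - B ^ 2) by ring,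
      sq]
    have h1 : A ^ 2 ≤ (1 / d) ^ 2 := by gcongr
    have h2 : B ^ 2 ≤ (1 / d) ^ 2 := by gcongr
    apply mul_le_mul (by linarith) (by linarith) hZ0.le
    linarith
  have h1 : Z ^ e * Z ^ e ≤ X ^ e * Y ^ e := by
    rw [← Real.mul_rpow hZ0.le hZ0.le, ← Real.mul_rpow hX0.le hY0.le, ← sq]
    exact Real.rpow_le_rpow (by positivity) hXY he0.le
  have hXe : 0 < X ^ e := by positivity
  have hYe : 0 < Y ^ e := by positivity
  have hZe : 0 < Z ^ e := by positivity
  have h2 : 2 * Z ^ e ≤ X ^ e + Y ^ e := by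
    apply (fun h h' => (pow_le_pow_iff_left₀ (by positivity) h' (two_ne_zero)).1 h : (2 * Z ^ e)^2 ≤ (X ^ e + Y ^ e)^2 → 0 ≤ X ^ e + Y ^ e → 2 * Z ^ e ≤ X ^ e + Y ^ e) _ (by positivity); nlinarith [sq_nonneg (X ^ e - Y ^ e)]
  have h3 : (R ^ 2) ^ e - (R ^ 2) ^ (e - 1) / d ^ 2 ≤ Z ^ e := by
    set y := (1 / d) ^ 2 / R ^ 2 with hy
    have hy0 : 0 < y := by positivity
    have hy1 : y < 1 := by rw [hy, div_lt_one (by positivity)]; linarith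
    have hZy : Z = R ^ 2 * (1 - y) := by rw [hZ, hy]; field_simp
    rw [hZy, Real.mul_rpow (by positivity) (by linarith)]
    have h4 : 1 - y ≤ (1 - y) ^ e := by
      conv_lhs => rw [← Real.rpow_one (1 - y)]
      exact Real.rpow_le_rpow_of_exponent_ge (by linarith) (by linarith) he1.le
    have h5 : (R ^ 2) ^ e - (R ^ 2) ^ (e - 1) / d ^ 2 = (R ^ 2) ^ e * (1 - y) := by
      rw [Real.rpow_sub_one (by positivity), hy]; field_simp
    rw [h5]
    exact mul_le_mul_of_nonneg_left h4 (by positivity)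
  have h6 : 2 * (R ^ 2) ^ (e - 1) / d ^ 2 = 2 * ((R ^ 2) ^ (e - 1) / d ^ 2) := by ring
  linarith

lemma harm1 (α : ℝ) (hα : 0 < α) (hα2 : α < 2) :
    ∃ K : ℝ, 0 < K ∧ ∀ a b d r : ℝ, 0 < d → d ≤ a → d ≤ b → 0 < r → r ≤ d / 4 →
      - (K * (a * b) ^ (-(1 - α / 2)) * ((r ^ 2) ^ (1 - α / 2) / d ^ 2)) ≤
      ∫ s in Ioi r, (g1 (1 - α / 2) a b s + g1 (1 - α / 2) b a s - 2 * (a * b) ^ (-(1 - α / 2))) * s ^ (-1 - α)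
        := by
  refine ⟨2 / α + 2 * (1 / 4) ^ (α / 2 - 1), by positivity, fun a b d r hd hda hdb hr hrd => ?_⟩
  have ha : 0 < a := by linarith
  have hb : 0 < b := by linarith
  obtain ⟨i1, e1⟩ := harm_cv α a b r hα ha hb hr (by linarith) ((1 / a + 1 / b) / 2) _ rfl rfl
  obtain ⟨i2, e2⟩ := harm_cv α b a r hα hb ha hr (by linarith) ((1 / a + 1 / b) / 2)
    (-((1 / a - 1 / b) / 2)) (by ring) (by ring)
  set A := 1 / a with hAdef
  set B := 1 / b with hBdef
  set C := (A + B) / 2 with hC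
  set D := (A - B) / 2 with hD
  set R := 1 / r with hRdef
  have hA : 0 < A := by positivity
  have hB : 0 < B := by positivity
  have hAd : A ≤ 1 / d := by rw [hAdef]; gcongr
  have hBd : B ≤ 1 / d := by rw [hBdef]; gcongr
  have hR : 4 / d ≤ R := by
    rw [hRdef, div_le_div_iff₀ hd hr]; linarith
  have hd1 : 0 < 1 / d := by positivity
  have hR' : 4 * (1 / d) ≤ R := by rw [mul_one_div]; exact hR
  have hRp : 0 < R := by linarith
  have hCp : 0 < C := by positivity
  have i3 : IntegrableOn (fun s : ℝ => s ^ (-1 - α)) (Ioi r) := integrableOn_Ioi_rpow_of_lt (by linarith) hr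
  have e3 : ∫ s in Ioi r, s ^ (-1 - α) = (R ^ 2) ^ (α / 2) / α := by
    rw [integral_Ioi_rpow_of_lt (by linarith) hr, show -1 - α + 1 = -α by ring, neg_div_neg_eq,
      ← Real.rpow_natCast, ← Real.rpow_mul hRp.le, hRdef, one_div, Real.inv_rpow hr.le, ← Real.rpow_neg hr.le]
    congr 2; push_cast; ring
  have hsplit : ∫ s in Ioi r, (g1 (1 - α / 2) a b s + g1 (1 - α / 2) b a s - 2 * (a * b) ^ (-(1 - α / 2))) * s ^ (-1 - α)
      = (∫ s in Ioi r, g1 (1 - α / 2) a b s * s ^ (-1 - α)) + (∫ s in Ioi r, g1 (1 - α / 2) b a s * s ^ (-1 - α))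
        - 2 * (a * b) ^ (-(1 - α / 2)) * ∫ s in Ioi r, s ^ (-1 - α) := by
    have F := integral_sub (i1.add i2) (i3.const_mul (2 * (a * b) ^ (-(1 - α / 2))))
    simp only [Pi.add_apply] at F
    rw [← integral_add i1 i2, ← integral_const_mul, ← F]
    congr 1; funext s; ring
  rw [hsplit, e1, e2, e3, mul_comm b a]
  have hle1 : C ≤ R - D := by rw [hC, hD]; linarith
  have hle2 : C ≤ R + D := by rw [hC, hD]; linarith
  obtain ⟨b1, f1⟩ := harm_base α C (R - D) hα hCp hle1
  obtain ⟨b2, f2⟩ := harm_base α C (R + D) hα hCp hle2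
  have c1 := harm_base2 α C (R - D) hα hCp hle1
  have c2 := harm_base2 α C (R + D) hα hCp hle2
  have s1 : ∫ t in C..(R - D), (t + D) * (t ^ 2 - C ^ 2) ^ (α / 2 - 1) =
      ((R - D) ^ 2 - C ^ 2) ^ (α / 2) / α + D * ∫ t in C..(R - D), (t ^ 2 - C ^ 2) ^ (α / 2 - 1) := by
    rw [← f1, ← intervalIntegral.integral_const_mul, ← intervalIntegral.integral_add b1 (c1.const_mul _)]
    congr 1; funext t; ring
  have s2 : ∫ t in C..(R - -D), (t + -D) * (t ^ 2 - C ^ 2) ^ (α / 2 - 1) =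
      ((R + D) ^ 2 - C ^ 2) ^ (α / 2) / α - D * ∫ t in C..(R + D), (t ^ 2 - C ^ 2) ^ (α / 2 - 1) := by
    rw [sub_neg_eq_add, ← f2, ← intervalIntegral.integral_const_mul, ← intervalIntegral.integral_sub b2 (c2.const_mul _)]
    congr 1; funext t; ring
  have s3 : (∫ t in C..(R + D), (t ^ 2 - C ^ 2) ^ (α / 2 - 1)) -
     (∫ t in C..(R - D), (t ^ 2 - C ^ 2) ^ (α / 2 - 1)) = ∫ t in (R - D)..(R + D), (t ^ 2 - C ^ 2) ^ (α / 2 - 1) :=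
    intervalIntegral.integral_interval_sub_left c2 c1
  have hDabs : |D| ≤ 1 / d := by
    rw [hD, abs_le]; constructor <;> linarith
  have hDabs2 : |D| ≤ 1 / d / 2 := by
    rw [hD, abs_le]; constructor <;> linarith
  have s4 : |∫ t in (R - D)..(R + D), (t ^ 2 - C ^ 2) ^ (α / 2 - 1)| ≤
      (R ^ 2 * (1 / 4)) ^ (α / 2 - 1) * |R + D - (R - D)| := by
    rw [← Real.norm_eq_abs]
    apply intervalIntegral.norm_integral_le_of_norm_le_const
    intro t ht
    have ht1 : R - |D| ≤ t := by
      have : min (R - D) (R + D) < t := ht.1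
      refine le_trans ?_ this.le
      rw [le_min_iff]; constructor
      · linarith [le_abs_self D]
      · linarith [neg_abs_le D]
    have hCR : C ≤ R / 4 := by rw [hC]; linarith
    have htR : R * (7 / 8) ≤ t := by linarith
    have h1 : R ^ 2 * (1 / 4) ≤ t ^ 2 - C ^ 2 := by nlinarith
    have h2 : 0 < R ^ 2 * (1 / 4) := by positivity
    rw [Real.norm_of_nonneg (Real.rpow_nonneg (by linarith) _)]
    exact Real.rpow_le_rpow_of_nonpos h2 h1 (by linarith)
  have s5 : D * ∫ t in (R - D)..(R + D), (t ^ 2 - C ^ 2) ^ (α / 2 - 1) ≤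
      2 * (1 / 4) ^ (α / 2 - 1) * ((R ^ 2) ^ (α / 2 - 1) / d ^ 2) := by
    refine (le_abs_self _).trans ?_
    rw [abs_mul]
    rw [Real.mul_rpow (by positivity) (by positivity), show R + D - (R - D) = 2 * D by ring, abs_mul, abs_two] at s4
    have hD2 : |D| * |D| ≤ 1 / d ^ 2 := by
      rw [show 1 / d ^ 2 = 1 / d * (1 / d) by field_simp]; gcongr
    calc _ ≤ |D| * ((R ^ 2) ^ (α / 2 - 1) * (1 / 4) ^ (α / 2 - 1) * (2 * |D|)) := by gcongr
      _ = 2 * (1 / 4) ^ (α / 2 - 1) * (R ^ 2) ^ (α / 2 - 1) * (|D| * |D|) := by ring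
      _ ≤ 2 * (1 / 4) ^ (α / 2 - 1) * (R ^ 2) ^ (α / 2 - 1) * (1 / d ^ 2) := by gcongr
      _ = _ := by ring
  have s6 := harm_alg (α / 2) R A B d (by linarith) (by linarith) hd hA hB hAd hBd hR C D hC hD
  have s7 : (R ^ 2) ^ (α / 2 - 1) = (r ^ 2) ^ (1 - α / 2) := by
    rw [hRdef, one_div, inv_pow, Real.inv_rpow (by positivity), ← Real.rpow_neg (by positivity)]
    congr 1; ring
  rw [s1, s2]
  rw [s7] at s5 s6
  have hP : 0 < (a * b) ^ (-(1 - α / 2)) := by positivity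
  have s8 : - ((2 / α + 2 * (1 / 4) ^ (α / 2 - 1)) * ((r ^ 2) ^ (1 - α / 2) / d ^ 2)) ≤
     ((R - D) ^ 2 - C ^ 2) ^ (α / 2) / α + ((R + D) ^ 2 - C ^ 2) ^ (α / 2) / α -
     D * (∫ t in (R - D)..(R + D), (t ^ 2 - C ^ 2) ^ (α / 2 - 1)) - 2 * ((R ^ 2) ^ (α / 2) / α) := by
    have s9 := div_le_div_of_nonneg_right s6 hα.le
    have e9 : (2 * (R ^ 2) ^ (α / 2) - 2 * (r ^ 2) ^ (1 - α / 2) / d ^ 2) / α =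
      2 * ((R ^ 2) ^ (α / 2) / α) - 2 / α * ((r ^ 2) ^ (1 - α / 2) / d ^ 2) := by field_simp
    rw [e9, add_div] at s9
    rw [add_mul]
    linarith
  have s10 := mul_le_mul_of_nonneg_left s8 hP.le
  rw [← s3] at s10
  linarith

/-- barrier function -/
def Vq (N : ℕ) (q : ℝ) (x : EN N) : ℝ := if ‖x‖ < 1 then (1 - ‖x‖ ^ 2) ^ (-q) else 0

lemma rho_pos {N : ℕ} (x : EN N) (hx : ‖x‖ < 1) : 0 < 1 - ‖x‖ ^ 2 := by
  nlinarith [norm_nonneg x]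

lemma Vq_nonneg (N : ℕ) (q : ℝ) (x : EN N) : 0 ≤ Vq N q x := by
  unfold Vq; split_ifs with h
  · exact (Real.rpow_pos_of_pos (rho_pos x h) _).le
  · exact le_rfl

lemma Vq_measurable (N : ℕ) (q : ℝ) : Measurable (Vq N q) := by
  unfold Vq
  refine Measurable.ite (measurableSet_lt measurable_norm measurable_const) ?_ measurable_const
  exact (measurable_const.sub (measurable_norm.pow_const 2)).pow_const _

lemma Vq_of_lt {N : ℕ} (q : ℝ) (x : EN N) (hx : ‖x‖ < 1) : Vq N q x = (1 - ‖x‖ ^ 2) ^ (-q) := by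
  simp [Vq, hx]

lemma Vq_pos {N : ℕ} (q : ℝ) (x : EN N) (hx : ‖x‖ < 1) : 0 < Vq N q x := by
  rw [Vq_of_lt q x hx]; exact Real.rpow_pos_of_pos (rho_pos x hx) _

lemma Vq_of_ge {N : ℕ} (q : ℝ) (x : EN N) (hx : ¬ ‖x‖ < 1) : Vq N q x = 0 := by
  simp [Vq, hx]

lemma Vq_eq_if {N : ℕ} (q : ℝ) (x : EN N) :
    Vq N q x = if 0 < 1 - ‖x‖ ^ 2 then (1 - ‖x‖ ^ 2) ^ (-q) else 0 := by
  unfold Vq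
  have : ‖x‖ < 1 ↔ 0 < 1 - ‖x‖ ^ 2 := by
    constructor
    · exact rho_pos x
    · intro h; nlinarith [norm_nonneg x]
  simp only [this]

lemma Vq_integrable (N : ℕ) (hN : 3 ≤ N) (q : ℝ) (hq0 : 0 < q) (hq1 : q < 1) :
    Integrable (Vq N q) := by
  have := EN_nontrivial N hN
  have := (integrable_fun_norm_addHaar (volume : Measure (EN N))
    (f := fun y : ℝ => if y < 1 then (1 - y ^ 2) ^ (-q) else 0)).2 ?_
  · exact this
  · have h1 : IntervalIntegrable (fun s : ℝ => (1 - s) ^ (-q)) volume 0 1 := by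
      have := (intervalIntegral.intervalIntegrable_rpow' (a := 0) (b := 1) (r := -q) (by linarith)).comp_sub_left 1
      simpa using this.symm
    rw [intervalIntegrable_iff_integrableOn_Ioo_of_le zero_le_one] at h1
    have h2 : IntegrableOn (fun y : ℝ => y ^ (Module.finrank ℝ (EN N) - 1) •
        (if y < 1 then (1 - y ^ 2) ^ (-q) else 0)) (Ioo 0 1) := by
      refine Integrable.mono' h1 ?_ ?_
      · apply Measurable.aestronglyMeasurable
        refine Measurable.smul (f := fun y : ℝ => y ^ (Module.finrank ℝ (EN N) - 1)) (measurable_id.pow_const _) ?_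
        refine Measurable.ite measurableSet_Iio ?_ measurable_const
        exact (measurable_const.sub (measurable_id.pow_const 2)).pow_const _
      · filter_upwards [ae_restrict_mem measurableSet_Ioo] with y hy
        have hp : 0 < 1 - y := by linarith [hy.2]
        have hp2 : 0 < 1 - y ^ 2 := by nlinarith [hy.1, hy.2]
        rw [if_pos hy.2, smul_eq_mul, Real.norm_of_nonneg (by have := hy.1; positivity)]
        calc _ ≤ 1 * (1 - y) ^ (-q) := by
              apply mul_le_mul (pow_le_one₀ hy.1.le hy.2.le)
              · exact Real.rpow_le_rpow_of_nonpos hp (by nlinarith [hy.1, hy.2]) (by linarith)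
              · positivity
              · norm_num
          _ = _ := one_mul _
    have h3 : IntegrableOn (fun y : ℝ => y ^ (Module.finrank ℝ (EN N) - 1) •
        (if y < 1 then (1 - y ^ 2) ^ (-q) else 0)) (Ici 1) := by
      have : EqOn (fun y : ℝ => y ^ (Module.finrank ℝ (EN N) - 1) •
        (if y < 1 then (1 - y ^ 2) ^ (-q) else 0)) (fun _ => 0) (Ici 1) := by
        intro y hy; simp only []; rw [if_neg (not_lt.2 hy), smul_zero]
      rw [integrableOn_congr_fun this measurableSet_Ici]; exact integrableOn_zero
    rw [← Ioo_union_Ici_eq_Ioi (zero_lt_one (α := ℝ))]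
    exact h2.union h3

lemma line_decomp {N : ℕ} (x ω : EN N) (hx : ‖x‖ < 1) (hω : ‖ω‖ = 1) :
    ∃ a b : ℝ, 1 - ‖x‖ ≤ a ∧ 1 - ‖x‖ ≤ b ∧ a * b = 1 - ‖x‖ ^ 2 ∧
      ∀ s : ℝ, 1 - ‖x + s • ω‖ ^ 2 = (a - s) * (b + s) := by
  set m := inner ℝ x ω with hm
  have hmt : |m| ≤ ‖x‖ := by
    have := abs_real_inner_le_norm x ω
    rwa [hω, mul_one] at this
  have hm1 := (abs_le.1 hmt).1
  have hm2 := (abs_le.1 hmt).2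
  set t := ‖x‖ with ht
  have ht0 : 0 ≤ t := norm_nonneg x
  have hpos : 0 ≤ m ^ 2 + (1 - t ^ 2) := by nlinarith
  have hsq := Real.sq_sqrt hpos
  set S := √(m ^ 2 + (1 - t ^ 2)) with hS
  have h1 : 1 - t + m ≤ S := by
    apply Real.le_sqrt_of_sq_le; nlinarith
  have h2 : 1 - t - m ≤ S := by
    apply Real.le_sqrt_of_sq_le; nlinarith
  refine ⟨-m + S, m + S, by linarith, by linarith, by nlinarith, fun s => ?_⟩
  rw [norm_add_sq_real, norm_smul, hω, inner_smul_right, ← hm, Real.norm_eq_abs, mul_one, sq_abs]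
  nlinarith

lemma Vq_super (N : ℕ) (hN : 3 ≤ N) (q α : ℝ) (hq0 : 0 < q) (hq1 : q < 1) (hα : 0 < α) (hα2 : α < 2) :
    ∃ C : ℝ, 0 < C ∧ ∀ (x : EN N) (r : ℝ), ‖x‖ < 1 → 0 < r →
      Lr N α r (Vq N q) x ≤ C * (1 - ‖x‖ ^ 2) ^ (-q - α) := by
  obtain ⟨C, hC, h⟩ := super1 q α hq0 hq1 hα hα2
  refine ⟨C * (1 / 2) ^ (-α) * ((sphereMeasure N).real univ / 2) + 1, by positivity, fun x r hx hr => ?_⟩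
  have hρ := rho_pos x hx
  have h1 := Lr_polar_le N hN α r hα hr (Vq N q) (Vq_integrable N hN q hq0 hq1) x
    (C * (1 - ‖x‖ ^ 2) ^ (-q) * ((1 / 2) * (1 - ‖x‖ ^ 2)) ^ (-α)) ?_
  · refine h1.trans ?_
    have : (1 - ‖x‖ ^ 2) ^ (-q) * ((1 / 2) * (1 - ‖x‖ ^ 2)) ^ (-α) =
        (1 / 2) ^ (-α) * (1 - ‖x‖ ^ 2) ^ (-q - α) := by
      rw [Real.mul_rpow (by norm_num) hρ.le, sub_eq_add_neg (-q), Real.rpow_add hρ]; ring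
    rw [mul_assoc C, this, add_mul, one_mul]
    have : 0 < (1 - ‖x‖ ^ 2) ^ (-q - α) := by positivity
    nlinarith
  · intro ω hω
    obtain ⟨a, b, ha, hb, hab, hl⟩ := line_decomp x ω hx hω
    have := h a b ((1 / 2) * (1 - ‖x‖ ^ 2)) r (by positivity)
      (by nlinarith [norm_nonneg x]) (by nlinarith [norm_nonneg x]) hr
    rw [hab] at this
    refine le_trans (le_of_eq ?_) this
    congr 1; funext s
    rw [Vq_of_lt q x hx]
    have e1 : Vq N q (x + s • ω) = g1 q a b s := by
      rw [Vq_eq_if, hl s, g1]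
    have e2 : Vq N q (x - s • ω) = g1 q b a s := by
      rw [show x - s • ω = x + (-s) • ω by rw [neg_smul, sub_eq_add_neg], Vq_eq_if, hl (-s), g1, show (a - -s) * (b + -s) = (b - s) * (a + s) by ring]
    rw [e1, e2]

lemma Vq_harm (N : ℕ) (hN : 3 ≤ N) (α : ℝ) (hα : 0 < α) (hα2 : α < 2) :
    ∃ K : ℝ, 0 < K ∧ ∀ (x : EN N) (r κ : ℝ), ‖x‖ < 1 → 0 < r → κ ≤ 1 / 8 →
      r ≤ κ * (1 - ‖x‖ ^ 2) →
      - (K * (κ ^ 2) ^ (1 - α / 2) * (1 - ‖x‖ ^ 2) ^ (-(1 - α / 2) - α)) ≤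
        Lr N α r (Vq N (1 - α / 2)) x := by
  obtain ⟨K, hK, h⟩ := harm1 α hα hα2
  refine ⟨K * 4 * ((sphereMeasure N).real univ / 2) + 1, by positivity, fun x r κ hx hr hκ hrκ => ?_⟩
  have hρ := rho_pos x hx
  set q := 1 - α / 2 with hq
  have hq0 : 0 < q := by rw [hq]; linarith
  have hq1 : q < 1 := by rw [hq]; linarith
  have hκ0 : 0 < κ := by
    by_contra hc; push Not at hc; nlinarith
  have hI := Vq_integrable N hN q hq0 hq1
  have h1 := Lr_polar_le N hN α r hα hr (fun y => - Vq N q y) hI.neg x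
    (K * (1 - ‖x‖ ^ 2) ^ (-q) * ((r ^ 2) ^ q / ((1 / 2) * (1 - ‖x‖ ^ 2)) ^ 2)) ?_
  · rw [Lr_neg] at h1
    have e : (1 - ‖x‖ ^ 2) ^ (-q) * ((r ^ 2) ^ q / ((1 / 2) * (1 - ‖x‖ ^ 2)) ^ 2) ≤
        4 * (κ ^ 2) ^ q * (1 - ‖x‖ ^ 2) ^ (-q - α) := by
      have e1 : (r ^ 2) ^ q ≤ (κ ^ 2) ^ q * (1 - ‖x‖ ^ 2) ^ (2 - α) := by
        have : (1 - ‖x‖ ^ 2) ^ (2 - α) = ((1 - ‖x‖ ^ 2) ^ 2) ^ q := by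
          rw [← Real.rpow_natCast (1 - ‖x‖ ^ 2), ← Real.rpow_mul hρ.le]; congr 1; rw [hq]; push_cast; ring
        rw [this, ← Real.mul_rpow (by positivity) (by positivity), ← mul_pow]
        exact Real.rpow_le_rpow (by positivity) (by gcongr) hq0.le
      calc _ ≤ (1 - ‖x‖ ^ 2) ^ (-q) * ((κ ^ 2) ^ q * (1 - ‖x‖ ^ 2) ^ (2 - α) / ((1 / 2) * (1 - ‖x‖ ^ 2)) ^ 2) := by
            gcongr
        _ = _ := by
            rw [show -q - α = -q + (2 - α) + (-2) by ring, Real.rpow_add hρ, Real.rpow_add hρ,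
              Real.rpow_neg hρ.le 2]
            rw [show ((1 - ‖x‖ ^ 2) ^ (2:ℝ)) = (1 - ‖x‖ ^ 2) ^ 2 by norm_cast]
            field_simp; norm_num
    have hX : 0 ≤ (κ ^ 2) ^ q * (1 - ‖x‖ ^ 2) ^ (-q - α) := by positivity
    have hs : 0 ≤ (sphereMeasure N).real univ / 2 := by positivity
    have h2 := mul_le_mul_of_nonneg_right (mul_le_mul_of_nonneg_left e hK.le) hs
    rw [mul_assoc K] at h1
    have : (K * 4 * ((sphereMeasure N).real univ / 2) + 1) * (κ ^ 2) ^ q * (1 - ‖x‖ ^ 2) ^ (-q - α)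
      = K * (4 * (κ ^ 2) ^ q * (1 - ‖x‖ ^ 2) ^ (-q - α)) * ((sphereMeasure N).real univ / 2) +
        (κ ^ 2) ^ q * (1 - ‖x‖ ^ 2) ^ (-q - α) := by ring
    rw [this]; linarith
  · intro ω hω
    obtain ⟨a, b, ha, hb, hab, hl⟩ := line_decomp x ω hx hω
    have := h a b ((1 / 2) * (1 - ‖x‖ ^ 2)) r (by positivity)
      (by nlinarith [norm_nonneg x]) (by nlinarith [norm_nonneg x]) hr (by nlinarith)
    rw [hab] at this
    rw [neg_le, ← integral_neg] at this
    refine le_trans (le_of_eq ?_) this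
    congr 1; funext s
    rw [Vq_of_lt q x hx]
    have e1 : Vq N q (x + s • ω) = g1 q a b s := by
      rw [Vq_eq_if, hl s, g1]
    have e2 : Vq N q (x - s • ω) = g1 q b a s := by
      rw [show x - s • ω = x + (-s) • ω by rw [neg_smul, sub_eq_add_neg], Vq_eq_if, hl (-s), g1, show (a - -s) * (b + -s) = (b - s) * (a + s) by ring]
    rw [e1, e2]; ring

lemma ext_mass (N : ℕ) (hN : 3 ≤ N) (α : ℝ) (hα : 0 < α) :
    ∃ c : ℝ, 0 < c ∧ ∀ (x : EN N) (r : ℝ), ‖x‖ < 1 → 0 < r → r ≤ (1 - ‖x‖ ^ 2) / 2 →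
      c * (1 - ‖x‖ ^ 2) ^ (-α) ≤
        ∫ z, ({z : EN N | ¬ ‖x + z‖ < 1}.indicator (kr N α r)) z := by
  have := EN_nontrivial N hN
  have hv : 0 < (volume : Measure (EN N)).real (ball 0 1) :=
      ENNReal.toReal_pos (measure_ball_pos _ _ one_pos).ne' measure_ball_lt_top.ne
  refine ⟨3 ^ (-((N:ℝ) + α)) * (volume : Measure (EN N)).real (ball 0 1), by positivity,
    fun x r hx hr hrx => ?_⟩
  have hρ := rho_pos x hx
  set δ := 1 - ‖x‖ with hδ
  have hδ0 : 0 < δ := by rw [hδ]; linarith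
  have hδr : r ≤ δ := by nlinarith [norm_nonneg x]
  obtain ⟨e, he, hxe⟩ : ∃ e : EN N, ‖e‖ = 1 ∧ x = ‖x‖ • e := by
    by_cases h0 : x = 0
    · obtain ⟨e, he⟩ := exists_norm_eq (EN N) (zero_le_one)
      exact ⟨e, he, by simp [h0]⟩
    · refine ⟨‖x‖⁻¹ • x, ?_, ?_⟩
      · rw [norm_smul, norm_inv, norm_norm, inv_mul_cancel₀ (norm_ne_zero_iff.2 h0)]
      · rw [smul_smul, mul_inv_cancel₀ (norm_ne_zero_iff.2 h0), one_smul]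
  have hsub : ∀ z ∈ ball ((2 * δ) • e) δ, ¬ ‖x + z‖ < 1 ∧ r < ‖z‖ ∧ ‖z‖ ≤ 3 * δ := by
    intro z hz
    rw [mem_ball, dist_eq_norm] at hz
    have n1 : ‖(2 * δ) • e‖ = 2 * δ := by rw [norm_smul, he, Real.norm_of_nonneg (by positivity), mul_one]
    have n2 : ‖x + (2 * δ) • e‖ = 1 + δ := by
      conv_lhs => rw [hxe, ← add_smul, norm_smul, he, mul_one]
      rw [Real.norm_of_nonneg (by positivity)]; rw [hδ]; ring
    have n3 : ‖x + (2 * δ) • e‖ ≤ ‖x + z‖ + ‖z - (2 * δ) • e‖ := by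
      have : x + (2 * δ) • e = (x + z) - (z - (2 * δ) • e) := by abel
      rw [this]; exact norm_sub_le _ _
    have n4 : ‖(2 * δ) • e‖ ≤ ‖z‖ + ‖z - (2 * δ) • e‖ := by
      have : (2 * δ) • e = z - (z - (2 * δ) • e) := by abel
      conv_lhs => rw [this]
      exact norm_sub_le _ _
    have n5 : ‖z‖ ≤ ‖(2 * δ) • e‖ + ‖z - (2 * δ) • e‖ := by
      have : z = (2 * δ) • e + (z - (2 * δ) • e) := by abel
      conv_lhs => rw [this]
      exact norm_add_le _ _
    refine ⟨by linarith, by linarith, by linarith⟩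
  have hNα : 0 ≤ (N:ℝ) + α := by positivity
  have hint : Integrable ((ball ((2 * δ) • e) δ).indicator (fun _ : EN N => (3 * δ) ^ (-((N:ℝ) + α)))) := by
    rw [integrable_indicator_iff measurableSet_ball]
    exact integrableOn_const (by exact measure_ball_lt_top.ne)
  have hmeas : MeasurableSet {z : EN N | ¬ ‖x + z‖ < 1} :=
    (measurableSet_lt (measurable_const.add measurable_id).norm measurable_const).compl
  have hmono : ∫ z, ((ball ((2 * δ) • e) δ).indicator (fun _ : EN N => (3 * δ) ^ (-((N:ℝ) + α)))) z ≤
      ∫ z, ({z : EN N | ¬ ‖x + z‖ < 1}.indicator (kr N α r)) z := by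
    apply integral_mono hint ((kr_integrable N hN α r hα hr).indicator hmeas)
    intro z
    by_cases hz : z ∈ ball ((2 * δ) • e) δ
    · obtain ⟨z1, z2, z3⟩ := hsub z hz
      rw [indicator_of_mem hz, indicator_of_mem (by exact z1), kr, if_pos z2]
      exact Real.rpow_le_rpow_of_nonpos (by linarith) z3 (by linarith)
    · rw [indicator_of_notMem hz]
      exact indicator_nonneg (fun z _ => kr_nonneg N α r z) z
  refine le_trans ?_ hmono
  have hvol : (volume : Measure (EN N)).real (ball ((2 * δ) • e) δ) =
      δ ^ N * (volume : Measure (EN N)).real (ball 0 1) := by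
    rw [measureReal_def, Measure.addHaar_ball _ _ hδ0.le, ENNReal.toReal_mul, ENNReal.toReal_ofReal (by positivity),
      finrank_euclideanSpace, Fintype.card_fin, ← measureReal_def]
  rw [integral_indicator measurableSet_ball, setIntegral_const, smul_eq_mul, hvol]
  have e1 : δ ^ N * (volume : Measure (EN N)).real (ball 0 1) * (3 * δ) ^ (-((N:ℝ) + α)) =
      3 ^ (-((N:ℝ) + α)) * (volume : Measure (EN N)).real (ball 0 1) * δ ^ (-α) := by
    rw [Real.mul_rpow (by norm_num) hδ0.le, show -α = (N:ℝ) + -((N:ℝ) + α) by ring, Real.rpow_add hδ0,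
      Real.rpow_natCast]
    ring
  rw [e1]
  apply mul_le_mul_of_nonneg_left _ (by positivity)
  exact Real.rpow_le_rpow_of_nonpos hδ0 (by nlinarith [norm_nonneg x]) (by linarith)

lemma Vq_sub (N : ℕ) (hN : 3 ≤ N) (β α : ℝ) (hβ0 : 1 - α / 2 < β) (hβ1 : β < 1) (hα : 0 < α) (hα2 : α < 2) :
    ∃ κ c : ℝ, 0 < κ ∧ κ ≤ 1 / 8 ∧ 0 < c ∧ ∀ (x : EN N) (r : ℝ), ‖x‖ < 1 → 0 < r →
      r ≤ κ * (1 - ‖x‖ ^ 2) →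
      c * (1 - ‖x‖ ^ 2) ^ (-β - α) ≤ Lr N α r (Vq N β) x := by
  obtain ⟨K, hK, hH⟩ := Vq_harm N hN α hα hα2
  obtain ⟨c, hc, hE⟩ := ext_mass N hN α hα
  set q := 1 - α / 2 with hq
  have hq0 : 0 < q := by rw [hq]; linarith
  have hq1 : q < 1 := by rw [hq]; linarith
  set p := β / q with hp
  have hp1 : 1 < p := by rw [hp, one_lt_div hq0]; exact hβ0
  have hpq : q * p = β := by rw [hp]; field_simp
  set A := (p - 1) * c / (2 * p * K) with hA
  have hp1' : 0 < p - 1 := by linarith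
  have hp0 : 0 < p := by linarith
  have hA0 : 0 < A := by positivity
  refine ⟨min (1 / 8) (A ^ (1 / (2 * q))), (p - 1) * c / 2, ?_, min_le_left _ _, by positivity, ?_⟩
  · exact lt_min (by norm_num) (by positivity)
  intro x r hx hr hrx
  set κ := min (1 / 8) (A ^ (1 / (2 * q))) with hκ
  have hκ0 : 0 < κ := lt_min (by norm_num) (by positivity)
  have hκ8 : κ ≤ 1 / 8 := min_le_left _ _
  have hκA : (κ ^ 2) ^ q ≤ A := by
    rw [← Real.rpow_natCast, ← Real.rpow_mul hκ0.le]
    calc _ ≤ (A ^ (1 / (2 * q))) ^ (((2:ℕ):ℝ) * q) :=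
          Real.rpow_le_rpow hκ0.le (min_le_right _ _) (by positivity)
      _ = A := by
        rw [← Real.rpow_mul hA0.le, show 1 / (2 * q) * (((2:ℕ):ℝ) * q) = 1 by push_cast; field_simp, Real.rpow_one]
  have hρ := rho_pos x hx
  have h1 := hH x r κ hx hr hκ8 hrx
  have h2 := hE x r hx hr (by nlinarith)
  set ρ := 1 - ‖x‖ ^ 2 with hρdef
  have hIβ := Vq_integrable N hN β (by linarith) hβ1
  have hIq := Vq_integrable N hN q hq0 hq1
  set S := {z : EN N | ¬ ‖x + z‖ < 1} with hS
  have hmeas : MeasurableSet S :=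
    (measurableSet_lt (measurable_const.add measurable_id).norm measurable_const).compl
  have hkey : p * ρ ^ (q - β) * Lr N α r (Vq N q) x + (p - 1) * ρ ^ (-β) * ∫ z, S.indicator (kr N α r) z ≤
      Lr N α r (Vq N β) x := by
    unfold Lr
    rw [← integral_const_mul, ← integral_const_mul, ← integral_add ((Lr_integrable N hN α r hα hr _ hIq x).const_mul _)
      (((kr_integrable N hN α r hα hr).indicator hmeas).const_mul _)]
    apply integral_mono (((Lr_integrable N hN α r hα hr _ hIq x).const_mul _).add
      (((kr_integrable N hN α r hα hr).indicator hmeas).const_mul _)) (Lr_integrable N hN α r hα hr _ hIβ x)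
    intro z
    simp only [Pi.add_apply]
    have hk := kr_nonneg N α r z
    have eρ : ρ ^ (q - β) * ρ ^ (-q) = ρ ^ (-β) := by
      rw [← Real.rpow_add hρ]; congr 1; ring
    by_cases hz : ‖x + z‖ < 1
    · rw [indicator_of_notMem (by simpa [hS] using hz), mul_zero, add_zero, ← mul_assoc]
      apply mul_le_mul_of_nonneg_right _ hk
      rw [Vq_of_lt q x hx, Vq_of_lt q _ hz, Vq_of_lt β x hx, Vq_of_lt β _ hz, ← hρdef]
      have hy := rho_pos _ hz
      set y := 1 - ‖x + z‖ ^ 2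
      have hb := one_add_mul_self_le_rpow_one_add (s := y ^ (-q) / ρ ^ (-q) - 1) (p := p)
        (by have : 0 < y ^ (-q) / ρ ^ (-q) := by positivity
            linarith) hp1.le
      rw [add_sub_cancel, Real.div_rpow (by positivity) (by positivity), ← Real.rpow_mul hy.le,
        ← Real.rpow_mul hρ.le, neg_mul, hpq] at hb
      have hb2 := mul_le_mul_of_nonneg_right hb (by positivity : 0 ≤ ρ ^ (-β))
      rw [div_mul_cancel₀ _ (by positivity)] at hb2
      have e3 : (1 + p * (y ^ (-q) / ρ ^ (-q) - 1)) * ρ ^ (-β) =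
          ρ ^ (-β) + p * ρ ^ (q - β) * (y ^ (-q) - ρ ^ (-q)) := by
        rw [← eρ]
        have : ρ ^ (-q) ≠ 0 := by positivity
        field_simp
      linarith
    · rw [indicator_of_mem (by exact hz), Vq_of_ge _ _ hz, Vq_of_ge _ _ hz, Vq_of_lt q x hx, Vq_of_lt β x hx,
        ← hρdef, ← eρ]
      apply le_of_eq; ring
  refine le_trans ?_ hkey
  have hρ1 : 0 < ρ ^ (q - β) := by positivity
  have hρ2 : 0 < ρ ^ (-β) := by positivity
  have h3 := mul_le_mul_of_nonneg_left h1 (by positivity : 0 ≤ p * ρ ^ (q - β))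
  have h4 := mul_le_mul_of_nonneg_left h2 (by positivity : 0 ≤ (p - 1) * ρ ^ (-β))
  have e1 : ρ ^ (q - β) * ρ ^ (-q - α) = ρ ^ (-β - α) := by
    rw [← Real.rpow_add hρ]; congr 1; ring
  have e2 : ρ ^ (-β) * ρ ^ (-α) = ρ ^ (-β - α) := by
    rw [← Real.rpow_add hρ]; congr 1
  have hX : 0 < ρ ^ (-β - α) := by positivity
  have h5 : p * ρ ^ (q - β) * -(K * (κ ^ 2) ^ q * ρ ^ (-q - α)) = - (p * K * (κ ^ 2) ^ q) * ρ ^ (-β - α) := by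
    rw [← e1]; ring
  have h6 : (p - 1) * ρ ^ (-β) * (c * ρ ^ (-α)) = (p - 1) * c * ρ ^ (-β - α) := by
    rw [← e2]; ring
  have h7 : p * K * (κ ^ 2) ^ q ≤ (p - 1) * c / 2 := by
    calc _ ≤ p * K * A := by gcongr
      _ = _ := by rw [hA]; field_simp
  have h8 := mul_le_mul_of_nonneg_right h7 hX.le
  rw [h5] at h3; rw [h6] at h4
  linarith

lemma rpow_lip (γ v s t : ℝ) (hγ : 1 < γ) (ht : 0 ≤ t) (hts : t ≤ s) (hsv : s ≤ v) :
    s ^ γ - t ^ γ ≤ γ * v ^ (γ - 1) * (s - t) := by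
  rcases eq_or_lt_of_le (ht.trans hts) with h0 | h0
  · have : t = s := by linarith
    simp [this]
  · have hb := one_add_mul_self_le_rpow_one_add (s := t / s - 1) (p := γ)
      (by have : 0 ≤ t / s := by positivity
          linarith) hγ.le
    rw [add_sub_cancel, Real.div_rpow ht h0.le, le_div_iff₀ (by positivity)] at hb
    have e : s ^ γ = s ^ (γ - 1) * s := by
      rw [Real.rpow_sub_one h0.ne']; field_simp
    have e2 : (1 + γ * (t / s - 1)) * s ^ γ = s ^ γ + γ * s ^ (γ - 1) * (t - s) := by
      conv_lhs => rw [add_mul, one_mul]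
      congr 1
      rw [e]; field_simp
    rw [e2] at hb
    have h1 : s ^ (γ - 1) ≤ v ^ (γ - 1) := Real.rpow_le_rpow h0.le hsv (by linarith)
    have h2 : γ * s ^ (γ - 1) * (s - t) ≤ γ * v ^ (γ - 1) * (s - t) := by
      apply mul_le_mul_of_nonneg_right _ (by linarith)
      apply mul_le_mul_of_nonneg_left h1 (by linarith)
    linarith

/-- integral part of the iteration -/
def Ir (N : ℕ) (α : ℝ) (r : EN N → ℝ) (f : EN N → ℝ) (x : EN N) : ℝ :=
  ∫ z, f (x + z) * kr N α (r x) z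

lemma Ir_measurable (N : ℕ) (α : ℝ) (r : EN N → ℝ) (hr : Measurable r) (f : EN N → ℝ) (hf : Measurable f) :
    Measurable (Ir N α r f) := by
  have h : Measurable (fun p : EN N × EN N => f (p.1 + p.2) * kr N α (r p.1) p.2) :=
    (hf.comp (measurable_fst.add measurable_snd)).mul
      ((kr_measurable2 N α).comp ((hr.comp measurable_fst).prodMk measurable_snd))
  exact (h.stronglyMeasurable.integral_prod_right (ν := volume)).measurable

/-- one iteration step -/
def Tst (N : ℕ) (α γ c : ℝ) (r v f : EN N → ℝ) (x : EN N) : ℝ :=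
  if ‖x‖ < 1 then (c * Ir N α r f x + γ * v x ^ (γ - 1) * f x - f x ^ γ) /
    (γ * v x ^ (γ - 1) + c * Ir N α r (fun _ => 1) x) else 0

lemma Tst_measurable (N : ℕ) (α γ c : ℝ) (r v f : EN N → ℝ) (hr : Measurable r) (hv : Measurable v)
    (hf : Measurable f) : Measurable (Tst N α γ c r v f) := by
  unfold Tst
  refine Measurable.ite (measurableSet_lt measurable_norm measurable_const) ?_ measurable_const
  have h1 := Ir_measurable N α r hr f hf
  have h2 := Ir_measurable N α r hr (fun _ => 1) measurable_const
  have h3 : Measurable fun x => γ * v x ^ (γ - 1) := (hv.pow_const _).const_mul _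
  exact (((h1.const_mul c).add (h3.mul hf)).sub (hf.pow_const _)).div (h3.add (h2.const_mul c))

lemma exist_trunc (N : ℕ) (hN : 3 ≤ N) (α γ c : ℝ) (hα : 0 < α) (hγ : 1 < γ) (hc : 0 < c)
    (r v w : EN N → ℝ) (hrm : Measurable r) (hr : ∀ x, ‖x‖ < 1 → 0 < r x)
    (hvm : Measurable v) (hwm : Measurable w) (hvi : Integrable v)
    (hw0 : ∀ x, 0 ≤ w x) (hwv : ∀ x, w x ≤ v x) (hvB : ∀ x, ¬ ‖x‖ < 1 → v x = 0)
    (hvp : ∀ x, ‖x‖ < 1 → 0 < v x)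
    (hsub : ∀ x, ‖x‖ < 1 → w x ^ γ ≤ c * Lr N α (r x) w x)
    (hsup : ∀ x, ‖x‖ < 1 → c * Lr N α (r x) v x ≤ v x ^ γ) :
    ∃ u : EN N → ℝ, Measurable u ∧ (∀ x, w x ≤ u x) ∧ (∀ x, u x ≤ v x) ∧
      ∀ x, ‖x‖ < 1 → c * Lr N α (r x) u x = u x ^ γ := by
  have hInt : ∀ f : EN N → ℝ, Measurable f → (∀ x, 0 ≤ f x) → (∀ x, f x ≤ v x) → Integrable f := by
    intro f hf h0 h1
    refine hvi.mono' hf.aestronglyMeasurable (Eventually.of_forall fun x => ?_)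
    rw [Real.norm_of_nonneg (h0 x)]; exact h1 x
  have hden : ∀ x, ‖x‖ < 1 → 0 < γ * v x ^ (γ - 1) + c * Ir N α r (fun _ => 1) x := by
    intro x hx
    have h1 := hvp x hx
    have h2 : 0 ≤ Ir N α r (fun _ => 1) x := integral_nonneg fun z => by
      simpa using kr_nonneg N α (r x) z
    have : 0 < γ * v x ^ (γ - 1) := by positivity
    have := mul_nonneg hc.le h2
    linarith
  have hLr : ∀ f : EN N → ℝ, Integrable f → ∀ x, ‖x‖ < 1 →
      Lr N α (r x) f x = Ir N α r f x - f x * Ir N α r (fun _ => 1) x := by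
    intro f hf x hx
    rw [Lr_eq N hN α (r x) hα (hr x hx) f hf x]
    simp [Ir]
  have hmono : ∀ f g : EN N → ℝ, Measurable f → Measurable g → (∀ x, 0 ≤ f x) → (∀ x, f x ≤ g x) →
      (∀ x, g x ≤ v x) → ∀ x, Tst N α γ c r v f x ≤ Tst N α γ c r v g x := by
    intro f g hf hg h0 hfg hgv x
    unfold Tst
    split_ifs with hx
    · have hI : Ir N α r f x ≤ Ir N α r g x := by
        apply integral_mono (shift_kr_integrable N α (r x) hα (hr x hx) f
          (hInt f hf h0 (fun x => (hfg x).trans (hgv x))) x) (shift_kr_integrable N α (r x) hα (hr x hx) g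
          (hInt g hg (fun x => (h0 x).trans (hfg x)) hgv) x)
        intro z
        exact mul_le_mul_of_nonneg_right (hfg _) (kr_nonneg _ _ _ _)
      apply div_le_div_of_nonneg_right _ (hden x hx).le
      have := rpow_lip γ (v x) (g x) (f x) hγ (h0 x) (hfg x) (hgv x)
      have := mul_le_mul_of_nonneg_left hI hc.le
      linarith
    · exact le_rfl
  have hTv : ∀ x, Tst N α γ c r v v x ≤ v x := by
    intro x
    unfold Tst
    split_ifs with hx
    · rw [div_le_iff₀ (hden x hx)]
      have := hsup x hx
      rw [hLr v hvi x hx] at this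
      linarith
    · rw [hvB x hx]
  have hTw : ∀ x, w x ≤ Tst N α γ c r v w x := by
    intro x
    unfold Tst
    split_ifs with hx
    · rw [le_div_iff₀ (hden x hx)]
      have := hsub x hx
      rw [hLr w (hInt w hwm hw0 hwv) x hx] at this
      linarith
    · have := hwv x; rw [hvB x hx] at this; exact this
  let U : ℕ → EN N → ℝ := fun k => Nat.rec v (fun _ f => Tst N α γ c r v f) k
  have hU0 : U 0 = v := rfl
  have hUs : ∀ k, U (k + 1) = Tst N α γ c r v (U k) := fun k => rfl
  have hall : ∀ k, Measurable (U k) ∧ (∀ x, w x ≤ U k x) ∧ (∀ x, U k x ≤ v x) ∧ ∀ x, U (k + 1) x ≤ U k x := by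
    intro k
    induction k with
    | zero =>
      refine ⟨hvm, hwv, fun x => le_rfl, fun x => ?_⟩
      rw [hUs, hU0]; exact hTv x
    | succ k ih =>
      obtain ⟨i1, i2, i3, i4⟩ := ih
      have m1 : Measurable (U (k + 1)) := by rw [hUs]; exact Tst_measurable N α γ c r v _ hrm hvm i1
      have w1 : ∀ x, w x ≤ U (k + 1) x := fun x => by
        rw [hUs]; exact (hTw x).trans (hmono w (U k) hwm i1 hw0 i2 i3 x)
      have v1 : ∀ x, U (k + 1) x ≤ v x := fun x => (i4 x).trans (i3 x)
      refine ⟨m1, w1, v1, fun x => ?_⟩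
      change Tst N α γ c r v (U (k + 1)) x ≤ Tst N α γ c r v (U k) x
      exact hmono _ _ m1 i1 (fun x => (hw0 x).trans (w1 x)) i4 i3 x
  have hbdd : ∀ x, BddBelow (range fun k => U k x) := fun x => ⟨w x, by rintro _ ⟨k, rfl⟩; exact (hall k).2.1 x⟩
  have hlim : ∀ x, Tendsto (fun k => U k x) atTop (𝓝 (⨅ k, U k x)) := fun x =>
    tendsto_atTop_ciInf (antitone_nat_of_succ_le fun k => (hall k).2.2.2 x) (hbdd x)
  set u : EN N → ℝ := fun x => ⨅ k, U k x with hu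
  have hum : Measurable u := measurable_of_tendsto_metrizable (fun k => (hall k).1) (tendsto_pi_nhds.2 hlim)
  have hwu : ∀ x, w x ≤ u x := fun x => ge_of_tendsto' (hlim x) fun k => (hall k).2.1 x
  have huv : ∀ x, u x ≤ v x := fun x => le_of_tendsto' (hlim x) fun k => (hall k).2.2.1 x
  have hu0 : ∀ x, 0 ≤ u x := fun x => (hw0 x).trans (hwu x)
  refine ⟨u, hum, hwu, huv, fun x hx => ?_⟩
  have hIlim : Tendsto (fun k => Ir N α r (U k) x) atTop (𝓝 (Ir N α r u x)) := by
    unfold Ir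
    refine tendsto_integral_of_dominated_convergence (fun z => v (x + z) * kr N α (r x) z) ?_
      (shift_kr_integrable N α (r x) hα (hr x hx) v hvi x) ?_ ?_
    · intro k
      exact (((hall k).1.comp (measurable_const.add measurable_id)).mul (kr_measurable N α (r x))).aestronglyMeasurable
    · intro k
      refine Eventually.of_forall fun z => ?_
      rw [Real.norm_of_nonneg (mul_nonneg ((hw0 _).trans ((hall k).2.1 _)) (kr_nonneg _ _ _ _))]
      exact mul_le_mul_of_nonneg_right ((hall k).2.2.1 _) (kr_nonneg _ _ _ _)
    · exact Eventually.of_forall fun z => (hlim _).mul_const _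
  have hT1 : Tendsto (fun k => U (k + 1) x) atTop (𝓝 (Tst N α γ c r v u x)) := by
    simp only [hUs, Tst, if_pos hx]
    refine Tendsto.div_const ?_ _
    refine ((hIlim.const_mul c).add ((hlim x).const_mul _)).sub ?_
    exact (hlim x).rpow_const (Or.inr (by linarith))
  have hT2 : Tendsto (fun k => U (k + 1) x) atTop (𝓝 (u x)) := (hlim x).comp (tendsto_add_atTop_nat 1)
  have e := tendsto_nhds_unique hT1 hT2
  rw [Tst, if_pos hx, div_eq_iff (hden x hx).ne'] at e
  rw [hLr u (hInt u hum hu0 huv) x hx]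
  linarith

lemma coeff_pos (N : ℕ) (α : ℝ) (hα : 0 < α) (hα2 : α < 2) : 0 < fracLapCoeff N α := by
  unfold fracLapCoeff
  have h1 : Real.Gamma (-α / 2) ≠ 0 := by
    apply Real.Gamma_ne_zero
    intro m h
    rcases Nat.eq_zero_or_pos m with h0 | h0
    · rw [h0] at h; norm_num at h; linarith
    · have : (1:ℝ) ≤ m := by exact_mod_cast h0
      linarith
  have h2 : 0 < Real.Gamma (((N : ℝ) + α) / 2) := Real.Gamma_pos_of_pos (by positivity)
  have := Real.pi_pos
  positivity

lemma exist_seq (N : ℕ) (hN : 3 ≤ N) (α γ c : ℝ) (hα : 0 < α) (hα2 : α < 2) (hγ1 : 1 + α < γ)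
    (hγ2 : γ < (2 + α) / (2 - α)) (hc : 0 < c) :
    ∃ c1 c2 κ : ℝ, 0 < c1 ∧ c1 ≤ c2 ∧ 0 < κ ∧ ∀ ε : ℝ, 0 < ε → ∃ u : EN N → ℝ, Measurable u ∧
      (∀ x, c1 * Vq N (α / (γ - 1)) x ≤ u x) ∧ (∀ x, u x ≤ c2 * Vq N (α / (γ - 1)) x) ∧
      ∀ x, ‖x‖ < 1 → c * Lr N α (min ε (κ * (1 - ‖x‖ ^ 2))) u x = u x ^ γ := by
  have hg : 0 < γ - 1 := by linarith
  set β := α / (γ - 1) with hβ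
  have hβ1 : β < 1 := by rw [hβ, div_lt_one hg]; linarith
  have hβ0 : 1 - α / 2 < β := by
    rw [hβ, lt_div_iff₀ hg]
    rw [lt_div_iff₀ (by linarith)] at hγ2
    nlinarith
  have hβp : 0 < β := by positivity
  have hβγ : -β * γ = -β - α := by rw [hβ]; field_simp; ring
  obtain ⟨κ, c0, hκ, hκ8, hc0, hsub⟩ := Vq_sub N hN β α hβ0 hβ1 hα hα2
  obtain ⟨C, hC, hsup⟩ := Vq_super N hN β α hβp hβ1 hα hα2
  have hpow : ∀ a : ℝ, 0 < a → ((a ^ (1 / (γ - 1))) ^ γ = a * a ^ (1 / (γ - 1))) := by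
    intro a ha
    rw [← Real.rpow_mul ha.le]
    conv_rhs => rw [← Real.rpow_one_add' ha.le (by positivity)]
    congr 1; field_simp; ring
  refine ⟨(c * c0) ^ (1 / (γ - 1)), (c * max C c0) ^ (1 / (γ - 1)), κ, by positivity, ?_, hκ, ?_⟩
  · apply Real.rpow_le_rpow (by positivity) _ (by positivity)
    exact mul_le_mul_of_nonneg_left (le_max_right _ _) hc.le
  intro ε hε
  have hCm : 0 < max C c0 := lt_max_of_lt_left hC
  have hle : (c * c0) ^ (1 / (γ - 1)) ≤ (c * max C c0) ^ (1 / (γ - 1)) := by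
    apply Real.rpow_le_rpow (by positivity) _ (by positivity)
    exact mul_le_mul_of_nonneg_left (le_max_right _ _) hc.le
  set c1 := (c * c0) ^ (1 / (γ - 1)) with hc1
  set c2 := (c * max C c0) ^ (1 / (γ - 1)) with hc2
  have hc1p : 0 < c1 := by positivity
  have hc2p : 0 < c2 := by positivity
  have hrm : Measurable fun x : EN N => min ε (κ * (1 - ‖x‖ ^ 2)) :=
    measurable_const.min ((measurable_const.sub (measurable_norm.pow_const 2)).const_mul κ)
  have hr : ∀ x : EN N, ‖x‖ < 1 → 0 < min ε (κ * (1 - ‖x‖ ^ 2)) := fun x hx =>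
    lt_min hε (mul_pos hκ (rho_pos x hx))
  have hV : ∀ (x : EN N) (a : ℝ), 0 < a → ‖x‖ < 1 → (a * Vq N β x) ^ γ = a ^ γ * (1 - ‖x‖ ^ 2) ^ (-β - α) := by
    intro x a ha hx
    rw [Real.mul_rpow ha.le (Vq_nonneg _ _ _), Vq_of_lt _ _ hx, ← Real.rpow_mul (rho_pos x hx).le, hβγ]
  refine exist_trunc N hN α γ c hα (by linarith) hc _ (fun x => c2 * Vq N β x) (fun x => c1 * Vq N β x) hrm hr
    ((Vq_measurable N β).const_mul _) ((Vq_measurable N β).const_mul _)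
    ((Vq_integrable N hN β hβp hβ1).const_mul _) (fun x => mul_nonneg hc1p.le (Vq_nonneg _ _ _))
    (fun x => mul_le_mul_of_nonneg_right hle (Vq_nonneg _ _ _)) (fun x hx => by rw [Vq_of_ge _ _ hx, mul_zero])
    (fun x hx => mul_pos hc2p (Vq_pos _ _ hx)) ?_ ?_
  · intro x hx
    rw [hV x c1 hc1p hx, Lr_const_mul, hc1, hpow _ (by positivity), ← hc1]
    have h := hsub x _ hx (hr x hx) (min_le_right _ _)
    have := mul_le_mul_of_nonneg_left h (mul_pos hc hc1p).le
    linarith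
  · intro x hx
    rw [hV x c2 hc2p hx, Lr_const_mul, hc2, hpow _ (by positivity), ← hc2]
    have h := hsup x _ hx (hr x hx)
    have h' : C * (1 - ‖x‖ ^ 2) ^ (-β - α) ≤ max C c0 * (1 - ‖x‖ ^ 2) ^ (-β - α) :=
      mul_le_mul_of_nonneg_right (le_max_left _ _) (Real.rpow_pos_of_pos (rho_pos x hx) _).le
    have := mul_le_mul_of_nonneg_left (h.trans h') (mul_pos hc hc2p).le
    linarith

lemma second_diff (N : ℕ) (φ : EN N → ℝ) (hφ : ContDiff ℝ 2 φ) (hs : HasCompactSupport φ) :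
    ∃ C : ℝ, 0 < C ∧ ∀ x z : EN N, |φ (x + z) + φ (x - z) - 2 * φ x| ≤ C * min (‖z‖ ^ 2) 1 := by
  obtain ⟨M, hM⟩ := hφ.continuous.bounded_above_of_compact_support hs
  have hd : ContDiff ℝ 1 (fderiv ℝ φ) := hφ.fderiv_right (by norm_num)
  obtain ⟨L, hL⟩ := ContDiff.lipschitzWith_of_hasCompactSupport (hs.fderiv ℝ) hd (by norm_num)
  have hM0 : 0 ≤ M := (norm_nonneg _).trans (hM 0)
  have key : ∀ x z : EN N, |φ (x + z) - φ x - fderiv ℝ φ x z| ≤ L * ‖z‖ ^ 2 := by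
    intro x z
    have := Convex.norm_image_sub_le_of_norm_fderiv_le' (𝕜 := ℝ) (s := closedBall x ‖z‖) (f := φ)
      (φ := fderiv ℝ φ x) (C := L * ‖z‖) (x := x) (y := x + z)
      (fun y _ => (hφ.differentiable (by norm_num)) y)
      (fun y hy => by
        have h := hL.dist_le_mul y x
        rw [dist_eq_norm] at h
        refine h.trans ?_
        exact mul_le_mul_of_nonneg_left (mem_closedBall.1 hy) L.2)
      (convex_closedBall x ‖z‖) (by simp) (by simp)
    rw [add_sub_cancel_left, Real.norm_eq_abs] at this
    calc _ ≤ _ := this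
      _ = _ := by ring
  refine ⟨2 * L + 4 * M + 1, by positivity, fun x z => ?_⟩
  have hz2 : 0 ≤ min (‖z‖ ^ 2) 1 := by positivity
  have h1 : |φ (x + z) + φ (x - z) - 2 * φ x| ≤ 2 * L * ‖z‖ ^ 2 := by
    have a := key x z
    have b := key x (-z)
    rw [map_neg, norm_neg, ← sub_eq_add_neg] at b
    rw [abs_le] at a b ⊢
    constructor <;> linarith [a.1, a.2, b.1, b.2]
  have h2 : |φ (x + z) + φ (x - z) - 2 * φ x| ≤ 4 * M := by
    have a := hM (x + z)
    have b := hM (x - z)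
    have d := hM x
    rw [Real.norm_eq_abs, abs_le] at a b d
    rw [abs_le]
    constructor <;> linarith [a.1, a.2, b.1, b.2, d.1, d.2]
  have hL0 : (0:ℝ) ≤ L := L.2
  rcases min_cases (‖z‖ ^ 2) 1 with ⟨h, _⟩ | ⟨h, _⟩ <;> rw [h]
  · nlinarith [sq_nonneg ‖z‖, mul_nonneg hM0 (sq_nonneg ‖z‖)]
  · linarith

lemma k2_integrable (N : ℕ) (hN : 3 ≤ N) (α : ℝ) (hα : 0 < α) (hα2 : α < 2) :
    Integrable (fun z : EN N => min (‖z‖ ^ 2) 1 * kr N α 0 z) := by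
  have := EN_nontrivial N hN
  have := (integrable_fun_norm_addHaar (volume : Measure (EN N))
    (f := fun y : ℝ => min (y ^ 2) 1 * if 0 < y then y ^ (-((N : ℝ) + α)) else 0)).2 ?_
  · exact this
  · have e : EqOn (fun y : ℝ => y ^ (Module.finrank ℝ (EN N) - 1) •
        (min (y ^ 2) 1 * if 0 < y then y ^ (-((N : ℝ) + α)) else 0))
        (fun y => min (y ^ 2) 1 * y ^ (-1 - α)) (Ioi 0) := by
      intro y hy
      simp only [finrank_euclideanSpace, Fintype.card_fin, smul_eq_mul]
      rw [if_pos (mem_Ioi.1 hy), mul_left_comm, pow_mul_rpow N hN α y hy]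
    rw [integrableOn_congr_fun e measurableSet_Ioi, ← Ioc_union_Ioi_eq_Ioi zero_le_one]
    refine IntegrableOn.union ?_ ?_
    · have h1 : IntegrableOn (fun y : ℝ => y ^ (1 - α)) (Ioc 0 1) := by
        rw [← intervalIntegrable_iff_integrableOn_Ioc_of_le zero_le_one]
        exact intervalIntegral.intervalIntegrable_rpow' (by linarith)
      refine h1.congr_fun ?_ measurableSet_Ioc
      intro y hy
      simp only []
      rw [min_eq_left (by nlinarith [hy.1, hy.2]), ← Real.rpow_natCast, ← Real.rpow_add hy.1]
      congr 1; push_cast; ring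
    · have h1 : IntegrableOn (fun y : ℝ => y ^ (-1 - α)) (Ioi 1) :=
        integrableOn_Ioi_rpow_of_lt (by linarith) one_pos
      refine h1.congr_fun ?_ measurableSet_Ioi
      intro y hy
      have : (1:ℝ) < y := hy
      simp only []
      rw [min_eq_right (by nlinarith), one_mul]

lemma kr_le_zero (N : ℕ) (α r : ℝ) (hr : 0 < r) (z : EN N) : kr N α r z ≤ kr N α 0 z := by
  unfold kr
  split_ifs with h1 h2 h2
  · exact le_rfl
  · exact absurd (hr.trans h1) h2
  · positivity
  · exact le_rfl

lemma cs_integrable (N : ℕ) (φ : EN N → ℝ) (hφ : ContDiff ℝ 2 φ) (hs : HasCompactSupport φ) : Integrable φ :=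
  hφ.continuous.integrable_of_hasCompactSupport hs

lemma Lr_bound (N : ℕ) (hN : 3 ≤ N) (α : ℝ) (hα : 0 < α) (hα2 : α < 2) (φ : EN N → ℝ)
    (hφ : ContDiff ℝ 2 φ) (hs : HasCompactSupport φ) :
    ∃ M : ℝ, 0 < M ∧ ∀ ε : ℝ, 0 < ε → ∀ x, |Lr N α ε φ x| ≤ M := by
  obtain ⟨C, hC, h⟩ := second_diff N φ hφ hs
  have hI := k2_integrable N hN α hα hα2
  have hI0 : 0 ≤ ∫ z : EN N, min (‖z‖ ^ 2) 1 * kr N α 0 z :=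
    integral_nonneg fun z => mul_nonneg (by positivity) (kr_nonneg _ _ _ _)
  refine ⟨C * (∫ z : EN N, min (‖z‖ ^ 2) 1 * kr N α 0 z) + 1, by positivity, fun ε hε x => ?_⟩
  obtain ⟨i1, e1⟩ := Lr_symm N hN α ε hα hε φ (cs_integrable N φ hφ hs) x
  have h2 : |2 * Lr N α ε φ x| ≤ C * ∫ z : EN N, min (‖z‖ ^ 2) 1 * kr N α 0 z := by
    rw [← e1, ← integral_const_mul, ← Real.norm_eq_abs]
    apply norm_integral_le_of_norm_le (hI.const_mul C)
    refine Eventually.of_forall fun z => ?_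
    rw [norm_mul, Real.norm_eq_abs, Real.norm_of_nonneg (kr_nonneg _ _ _ _), ← mul_assoc]
    apply mul_le_mul (h x z) (kr_le_zero N α ε hε z) (kr_nonneg _ _ _ _)
    positivity
  rw [abs_mul, abs_two] at h2
  linarith [abs_nonneg (Lr N α ε φ x)]

lemma pv_eq (N : ℕ) (α ε : ℝ) (φ : EN N → ℝ) (x : EN N) :
    ∫ y in {y : EN N | ε < dist y x}, (φ y - φ x) / dist y x ^ ((N : ℝ) + α) = Lr N α ε φ x := by
  have hm : MeasurableSet {y : EN N | ε < dist y x} :=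
    measurableSet_lt measurable_const (measurable_id.dist measurable_const)
  rw [← integral_indicator hm, ← integral_add_left_eq_self _ x, Lr]
  congr 1; funext z
  simp only [indicator, mem_setOf_eq, kr, dist_eq_norm, add_sub_cancel_left]
  split_ifs with h
  · rw [Real.rpow_neg (norm_nonneg _), div_eq_mul_inv]
  · simp

lemma fracLap_lim (N : ℕ) (hN : 3 ≤ N) (α : ℝ) (hα : 0 < α) (hα2 : α < 2) (φ : EN N → ℝ)
    (hφ : ContDiff ℝ 2 φ) (hs : HasCompactSupport φ) (x : EN N) :
    Tendsto (fun ε => fracLapCoeff N α * Lr N α ε φ x) (𝓝[>] 0) (𝓝 (fracLap N α φ x)) := by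
  obtain ⟨C, hC, h⟩ := second_diff N φ hφ hs
  have hI := k2_integrable N hN α hα hα2
  have hlim : Tendsto (fun ε => ∫ z, (φ (x + z) + φ (x - z) - 2 * φ x) * kr N α ε z) (𝓝[>] 0)
      (𝓝 (∫ z, (φ (x + z) + φ (x - z) - 2 * φ x) * kr N α 0 z)) := by
    refine tendsto_integral_filter_of_dominated_convergence
      (fun z => C * (min (‖z‖ ^ 2) 1 * kr N α 0 z)) ?_ ?_ (hI.const_mul C) ?_
    · filter_upwards with ε
      have hc := hφ.continuous
      apply AEStronglyMeasurable.mul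
      · exact Continuous.aestronglyMeasurable (by fun_prop)
      · exact (kr_measurable N α ε).aestronglyMeasurable
    · filter_upwards [self_mem_nhdsWithin] with ε hε
      refine Eventually.of_forall fun z => ?_
      rw [norm_mul, Real.norm_eq_abs, Real.norm_of_nonneg (kr_nonneg _ _ _ _), ← mul_assoc]
      apply mul_le_mul (h x z) (kr_le_zero N α ε hε z) (kr_nonneg _ _ _ _)
      positivity
    · refine Eventually.of_forall fun z => ?_
      apply Tendsto.const_mul
      apply tendsto_const_nhds.congr'
      by_cases hz : 0 < ‖z‖
      · filter_upwards [Ioo_mem_nhdsGT hz] with ε hε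
        simp [kr, hz, hε.2]
      · filter_upwards [self_mem_nhdsWithin] with ε hε
        have : ¬ ε < ‖z‖ := fun h => hz (lt_trans hε h)
        simp [kr, hz, this]
  have hlim2 : Tendsto (fun ε => fracLapCoeff N α * Lr N α ε φ x) (𝓝[>] 0)
      (𝓝 (fracLapCoeff N α * (1 / 2 * ∫ z, (φ (x + z) + φ (x - z) - 2 * φ x) * kr N α 0 z))) := by
    apply Tendsto.const_mul
    refine (hlim.const_mul (1 / 2)).congr' ?_
    filter_upwards [self_mem_nhdsWithin] with ε hε
    rw [(Lr_symm N hN α ε hα hε φ (cs_integrable N φ hφ hs) x).2]; ring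
  have hex : ∃ L, HasFracLap N α φ x L := ⟨_, by
    unfold HasFracLap
    simp only [pv_eq]
    exact hlim2⟩
  have : HasFracLap N α φ x (fracLap N α φ x) := by
    unfold fracLap; rw [dif_pos hex]; exact hex.choose_spec
  unfold HasFracLap at this
  simpa only [pv_eq] using this

lemma Lr_scale (N : ℕ) (α ε ρ : ℝ) (hρ : 0 < ρ) (b : EN N → ℝ) (x0 x : EN N) :
    Lr N α ε (fun y => b (ρ⁻¹ • (y - x0))) x = ρ ^ (-α) * Lr N α (ε / ρ) b (ρ⁻¹ • (x - x0)) := by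
  unfold Lr
  have h := Measure.integral_comp_smul (volume : Measure (EN N))
    (fun z => (b (ρ⁻¹ • (x + z - x0)) - b (ρ⁻¹ • (x - x0))) * kr N α ε z) ρ
  rw [finrank_euclideanSpace, Fintype.card_fin, smul_eq_mul, abs_of_pos (by positivity)] at h
  have h2 : ∫ z, (b (ρ⁻¹ • (x + z - x0)) - b (ρ⁻¹ • (x - x0))) * kr N α ε z =
      ρ ^ N * ∫ z, (b (ρ⁻¹ • (x + ρ • z - x0)) - b (ρ⁻¹ • (x - x0))) * kr N α ε (ρ • z) := by
    rw [h, ← mul_assoc, mul_inv_cancel₀ (by positivity), one_mul]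
  rw [h2, ← integral_const_mul, ← integral_const_mul]
  congr 1; funext z
  have e1 : ρ⁻¹ • (x + ρ • z - x0) = ρ⁻¹ • (x - x0) + z := by
    rw [show x + ρ • z - x0 = (x - x0) + ρ • z by abel, smul_add, smul_smul, inv_mul_cancel₀ hρ.ne', one_smul]
  have e2 : ρ ^ N * kr N α ε (ρ • z) = ρ ^ (-α) * kr N α (ε / ρ) z := by
    simp only [kr, norm_smul, Real.norm_of_nonneg hρ.le, div_lt_iff₀ hρ, mul_comm ‖z‖ ρ]
    split_ifs with hz
    · rw [Real.mul_rpow hρ.le (norm_nonneg _), ← mul_assoc, ← Real.rpow_natCast, ← Real.rpow_add hρ]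
      congr 2; ring
    · simp
  rw [e1, mul_left_comm, e2]; ring

lemma Lr_y (N : ℕ) (α r : ℝ) (u : EN N → ℝ) (x : EN N) :
    ∫ y, (u y - u x) * kr N α r (y - x) = Lr N α r u x := by
  have h := integral_sub_right_eq_self (μ := volume)
    (fun z => (u (x + z) - u x) * kr N α r z) x
  simp only [add_sub_cancel] at h
  rw [Lr, ← h]

lemma Lr_y_int (N : ℕ) (hN : 3 ≤ N) (α r : ℝ) (hα : 0 < α) (hr : 0 < r)
    (u : EN N → ℝ) (hu : Integrable u) (x : EN N) :
    Integrable (fun y => (u y - u x) * kr N α r (y - x)) := by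
  have := (Lr_integrable N hN α r hα hr u hu x).comp_sub_right x
  simpa only [add_sub_cancel] using this

lemma osc_point (w θ η a uy ux uz bys bx bz N1 N2 : ℝ) (hw : 0 < w) (hη : 0 < η) (hθ : 0 < θ)
    (h1 : uz - ux ≤ -(2 * θ * w) * (bz - bx) + η)
    (h2 : -(uz - uy) ≤ -(2 * θ * w) * (bz - bys) + η)
    (h3 : (1 - θ) * w + 2 * θ * w * ((1 - bx) + (1 - bys)) ≤ ux - uy) (hb : bz ≤ 1)
    (ha : 0 ≤ a) (hN1 : a ≤ N1) (hN2 : a ≤ N2) :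
    (uz - ux) * N1 - (uz - uy) * N2 ≤ (-(2 * θ * w) * (bz - bx) + η) * N1 +
      (-(2 * θ * w) * (bz - bys) + η) * N2 - (1 - θ) * w * a := by
  have e1 := mul_le_mul_of_nonneg_right h1 (sub_nonneg.2 hN1)
  have e2 := mul_le_mul_of_nonneg_right h2 (sub_nonneg.2 hN2)
  have e3 : 0 ≤ a * ((ux - uy) - ((1 - θ) * w + 2 * θ * w * ((1 - bx) + (1 - bys)))
      + 2 * η + 4 * (θ * w * (1 - bz))) := by
    apply mul_nonneg ha
    have : 0 ≤ θ * w * (1 - bz) := mul_nonneg (by positivity) (by linarith)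
    linarith
  nlinarith

lemma osc_step (N : ℕ) (hN : 3 ≤ N) (α : ℝ) (hα : 0 < α) (hα2 : α < 2) :
    ∃ θ C : ℝ, 0 < θ ∧ θ < 1 ∧ 0 < C ∧ ∀ (ρ ε R w M' T : ℝ) (x0 : EN N) (u : EN N → ℝ),
      0 < ε → ε < ρ → 4 * ρ ≤ R → 0 < w → Integrable u →
      (∀ x ∈ ball x0 R, ∀ y ∈ ball x0 R, u x - u y ≤ w) →
      (∀ x ∈ ball x0 ρ, |Lr N α ε u x| ≤ M') →
      (∀ x ∈ ball x0 ρ, ∫ y, (ball x0 R)ᶜ.indicator (fun y => |u y - u x| * kr N α ε (y - x)) y ≤ T) →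
      2 * M' + 2 * T < C * w * ρ ^ (-α) →
      ∀ x ∈ ball x0 (ρ / 2), ∀ y ∈ ball x0 (ρ / 2), u x - u y ≤ (1 - θ) * w := by
  have := EN_nontrivial N hN
  have hv : 0 < (volume : Measure (EN N)).real (ball 0 1) :=
      ENNReal.toReal_pos (measure_ball_pos _ _ one_pos).ne' measure_ball_lt_top.ne
  let b : ContDiffBump (0 : EN N) := ⟨1 / 2, 1, by norm_num, by norm_num⟩
  have hbC : ContDiff ℝ 2 (b : EN N → ℝ) := b.contDiff
  obtain ⟨Cb, hCb, hLb⟩ := Lr_bound N hN α hα hα2 b hbC b.hasCompactSupport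
  set cD : ℝ := 5 ^ (-((N:ℝ) + α)) * (volume : Measure (EN N)).real (ball 0 1) with hcD
  have hcD0 : 0 < cD := by positivity
  refine ⟨cD / (2 * (4 * Cb + cD)), cD / 2, by positivity, ?_, by positivity, ?_⟩
  · rw [div_lt_one (by positivity)]; linarith
  set θ := cD / (2 * (4 * Cb + cD)) with hθ
  have hθ0 : 0 < θ := by positivity
  have hθe : 4 * θ * Cb + θ * cD = cD / 2 := by rw [hθ]; field_simp
  intro ρ ε R w M' T x0 u hε hερ hR hw hu hosc hM hT hsmall p hp q hq
  have hρ : 0 < ρ := hε.trans hερ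
  by_contra hcon
  push Not at hcon
  set bρ : EN N → ℝ := fun y => b (ρ⁻¹ • (y - x0)) with hbρ
  have hb0 : ∀ y, 0 ≤ bρ y := fun y => b.nonneg
  have hb1 : ∀ y, bρ y ≤ 1 := fun y => b.le_one
  have hnorm : ∀ y : EN N, ‖ρ⁻¹ • (y - x0)‖ = ρ⁻¹ * dist y x0 := fun y => by
    rw [norm_smul, norm_inv, Real.norm_of_nonneg hρ.le, dist_eq_norm]
  have hbin : ∀ y ∈ ball x0 (ρ / 2), bρ y = 1 := by
    intro y hy
    apply b.one_of_mem_closedBall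
    rw [mem_closedBall, dist_zero_right, hnorm, inv_mul_le_iff₀ hρ]
    have := mem_ball.1 hy
    change dist y x0 ≤ ρ * (1 / 2)
    linarith
  have hbout : ∀ y, y ∉ ball x0 ρ → bρ y = 0 := by
    intro y hy
    apply b.zero_of_le_dist
    rw [dist_zero_right, hnorm, le_inv_mul_iff₀ hρ]
    have := not_lt.1 (fun h => hy (mem_ball.2 h))
    change ρ * 1 ≤ _
    linarith
  have hbint : Integrable bρ := by
    have := ((cs_integrable N b hbC b.hasCompactSupport).comp_smul (inv_ne_zero hρ.ne')).comp_sub_right x0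
    exact this
  have hLbρ : ∀ x, |Lr N α ε bρ x| ≤ Cb * ρ ^ (-α) := by
    intro x
    rw [hbρ, Lr_scale N α ε ρ hρ b x0 x, abs_mul, abs_of_pos (by positivity), mul_comm]
    exact mul_le_mul_of_nonneg_right (hLb _ (by positivity) _) (by positivity)
  set mε := ∫ z, kr N α ε z with hmε
  have hmε0 : 0 ≤ mε := integral_nonneg fun z => kr_nonneg _ _ _ _
  set gap := cD / 2 * w * ρ ^ (-α) - (2 * M' + 2 * T) with hgap
  have hgap0 : 0 < gap := by rw [hgap]; linarith
  obtain ⟨η, hη0, hη1, hη2, hη3⟩ : ∃ η : ℝ, 0 < η ∧ 2 * η ≤ u p - u q - (1 - θ) * w ∧ 2 * η * mε < gap ∧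
      2 * η < θ * w := by
    have h4 : 0 < u p - u q - (1 - θ) * w := by linarith
    have h5 : 0 < gap / (2 * (mε + 1)) := by positivity
    have h6 : 0 < θ * w / 4 := by positivity
    refine ⟨min ((u p - u q - (1 - θ) * w) / 2) (min (gap / (2 * (mε + 1)) ) (θ * w / 4)),
      lt_min (by linarith) (lt_min h5 h6), ?_, ?_, ?_⟩
    · have := min_le_left ((u p - u q - (1 - θ) * w) / 2) (min (gap / (2 * (mε + 1)) ) (θ * w / 4))
      linarith
    · have := (min_le_right ((u p - u q - (1 - θ) * w) / 2) (min (gap / (2 * (mε + 1)) ) (θ * w / 4))).trans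
        (min_le_left _ _)
      have h7 : gap / (2 * (mε + 1)) * (2 * (mε + 1)) = gap := by field_simp
      set η := min ((u p - u q - (1 - θ) * w) / 2) (min (gap / (2 * (mε + 1)) ) (θ * w / 4))
      have hη : 0 < η := lt_min (by linarith) (lt_min h5 h6)
      have h8 : η * (2 * (mε + 1)) ≤ gap := by
        rw [← h7]; exact mul_le_mul_of_nonneg_right this (by positivity)
      nlinarith
    · have := (min_le_right ((u p - u q - (1 - θ) * w) / 2) (min (gap / (2 * (mε + 1)) ) (θ * w / 4))).trans
        (min_le_right _ _)
      linarith
  have hpR : p ∈ ball x0 R := ball_subset_ball (by linarith) hp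
  have hqR : q ∈ ball x0 R := ball_subset_ball (by linarith) hq
  have hne : (ball x0 R).Nonempty := ⟨p, hpR⟩
  -- near-maximum point
  obtain ⟨xs, hxs, hFx⟩ : ∃ xs ∈ ball x0 R, ∀ z ∈ ball x0 R,
      u z - 2 * θ * w * (1 - bρ z) ≤ u xs - 2 * θ * w * (1 - bρ xs) + η := by
    set F : EN N → ℝ := fun z => u z - 2 * θ * w * (1 - bρ z) with hF
    have hbdd : BddAbove (F '' ball x0 R) := by
      refine ⟨u p + w, ?_⟩
      rintro _ ⟨z, hz, rfl⟩
      have h1 := hosc z hz p hpR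
      have h2 : 0 ≤ 2 * θ * w * (1 - bρ z) := mul_nonneg (by positivity) (by linarith [hb1 z])
      simp only [hF]; linarith
    obtain ⟨_, ⟨xs, hxs, rfl⟩, h⟩ := exists_lt_of_lt_csSup (hne.image F)
      (show sSup (F '' ball x0 R) - η < sSup (F '' ball x0 R) by linarith)
    refine ⟨xs, hxs, fun z hz => ?_⟩
    have := le_csSup hbdd (mem_image_of_mem F hz)
    change F z ≤ F xs + η
    linarith
  obtain ⟨ys, hys, hFy⟩ : ∃ ys ∈ ball x0 R, ∀ z ∈ ball x0 R,
      u ys + 2 * θ * w * (1 - bρ ys) - η ≤ u z + 2 * θ * w * (1 - bρ z) := by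
    set F : EN N → ℝ := fun z => u z + 2 * θ * w * (1 - bρ z) with hF
    have hbdd : BddBelow (F '' ball x0 R) := by
      refine ⟨u p - w, ?_⟩
      rintro _ ⟨z, hz, rfl⟩
      have h1 := hosc p hpR z hz
      have h2 : 0 ≤ 2 * θ * w * (1 - bρ z) := mul_nonneg (by positivity) (by linarith [hb1 z])
      simp only [hF]; linarith
    obtain ⟨_, ⟨xs, hxs, rfl⟩, h⟩ := exists_lt_of_csInf_lt (hne.image F)
      (show sInf (F '' ball x0 R) < sInf (F '' ball x0 R) + η by linarith)
    refine ⟨xs, hxs, fun z hz => ?_⟩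
    have := csInf_le hbdd (mem_image_of_mem F hz)
    change F xs - η ≤ F z
    linarith
  have h3 : (1 - θ) * w + 2 * θ * w * ((1 - bρ xs) + (1 - bρ ys)) ≤ u xs - u ys := by
    have h1 := hFx p hpR
    have h2 := hFy q hqR
    rw [hbin p hp] at h1
    rw [hbin q hq] at h2
    linarith
  have hw1 := hosc xs hxs ys hys
  have hθw : 0 < θ * w := by positivity
  have hxρ : xs ∈ ball x0 ρ := by
    by_contra hc
    have e := hbout xs hc
    have := mul_nonneg hθw.le (sub_nonneg.2 (hb1 ys))
    rw [e] at h3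
    nlinarith
  have hyρ : ys ∈ ball x0 ρ := by
    by_contra hc
    have e := hbout ys hc
    have := mul_nonneg hθw.le (sub_nonneg.2 (hb1 xs))
    rw [e] at h3
    nlinarith
  obtain ⟨v, hvn⟩ := exists_norm_eq (EN N) (by positivity : 0 ≤ 3 * ρ)
  set D := ball (x0 + v) ρ with hD
  have hNα : 0 ≤ (N:ℝ) + α := by positivity
  set a := (5 * ρ) ^ (-((N:ℝ) + α)) with ha
  have ha0 : 0 < a := by positivity
  have hDgeo : ∀ z ∈ D, z ∈ ball x0 R ∧ ∀ x ∈ ball x0 ρ, a ≤ kr N α ε (z - x) := by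
    intro z hz
    rw [hD, mem_ball, dist_eq_norm] at hz
    have n1 : ‖v‖ ≤ ‖z - x0‖ + ‖z - (x0 + v)‖ := by
      have : v = (z - x0) - (z - (x0 + v)) := by abel
      conv_lhs => rw [this]
      exact norm_sub_le _ _
    have n2 : ‖z - x0‖ ≤ ‖v‖ + ‖z - (x0 + v)‖ := by
      have : z - x0 = v + (z - (x0 + v)) := by abel
      rw [this]; exact norm_add_le _ _
    refine ⟨by rw [mem_ball, dist_eq_norm]; linarith, fun x hx => ?_⟩
    rw [mem_ball, dist_eq_norm] at hx
    have n3 : ‖z - x0‖ ≤ ‖z - x‖ + ‖x - x0‖ := by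
      have : z - x0 = (z - x) + (x - x0) := by abel
      rw [this]; exact norm_add_le _ _
    have n4 : ‖z - x‖ ≤ ‖z - x0‖ + ‖x - x0‖ := by
      have : z - x = (z - x0) - (x - x0) := by abel
      rw [this]; exact norm_sub_le _ _
    rw [kr, if_pos (by linarith)]
    exact Real.rpow_le_rpow_of_nonpos (by linarith) (by linarith) (by linarith)
  have hpt : ∀ z, (u z - u xs) * kr N α ε (z - xs) - (u z - u ys) * kr N α ε (z - ys) ≤
      (-(2 * θ * w)) * ((bρ z - bρ xs) * kr N α ε (z - xs)) + η * kr N α ε (z - xs) +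
      ((-(2 * θ * w)) * ((bρ z - bρ ys) * kr N α ε (z - ys)) + η * kr N α ε (z - ys)) +
      ((ball x0 R)ᶜ.indicator (fun y => |u y - u xs| * kr N α ε (y - xs)) z +
       (ball x0 R)ᶜ.indicator (fun y => |u y - u ys| * kr N α ε (y - ys)) z) +
      D.indicator (fun _ => -((1 - θ) * w * a)) z := by
    intro z
    have k1 := kr_nonneg N α ε (z - xs)
    have k2 := kr_nonneg N α ε (z - ys)
    by_cases hz : z ∈ ball x0 R
    · rw [indicator_of_notMem (by simpa using hz), indicator_of_notMem (by simpa using hz)]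
      have g1 := hFx z hz
      have g2 := hFy z hz
      by_cases hzD : z ∈ D
      · rw [indicator_of_mem hzD]
        have := osc_point w θ η a (u ys) (u xs) (u z) (bρ ys) (bρ xs) (bρ z) (kr N α ε (z - xs))
          (kr N α ε (z - ys)) hw hη0 hθ0 (by linarith) (by linarith) h3 (hb1 z) ha0.le
          ((hDgeo z hzD).2 xs hxρ) ((hDgeo z hzD).2 ys hyρ)
        linarith
      · rw [indicator_of_notMem hzD]
        have := osc_point w θ η 0 (u ys) (u xs) (u z) (bρ ys) (bρ xs) (bρ z) (kr N α ε (z - xs))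
          (kr N α ε (z - ys)) hw hη0 hθ0 (by linarith) (by linarith) h3 (hb1 z) le_rfl k1 k2
        linarith
    · have hzD : z ∉ D := fun h => hz (hDgeo z h).1
      rw [indicator_of_mem (by exact hz), indicator_of_mem (by exact hz), indicator_of_notMem hzD]
      have hbz : bρ z = 0 := hbout z fun h => hz (ball_subset_ball (by linarith) h)
      rw [hbz]
      have a1 : (u z - u xs) * kr N α ε (z - xs) ≤ |u z - u xs| * kr N α ε (z - xs) :=
        mul_le_mul_of_nonneg_right (le_abs_self _) k1
      have a2 : -((u z - u ys) * kr N α ε (z - ys)) ≤ |u z - u ys| * kr N α ε (z - ys) := by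
        rw [← neg_mul]; exact mul_le_mul_of_nonneg_right (neg_le_abs _) k2
      have a3 : 0 ≤ θ * w * (bρ xs * kr N α ε (z - xs)) := mul_nonneg hθw.le (mul_nonneg (hb0 _) k1)
      have a4 : 0 ≤ θ * w * (bρ ys * kr N α ε (z - ys)) := mul_nonneg hθw.le (mul_nonneg (hb0 _) k2)
      have a5 := mul_nonneg hη0.le k1
      have a6 := mul_nonneg hη0.le k2
      linarith
  have hmB : MeasurableSet (ball x0 R)ᶜ := measurableSet_ball.compl
  have I1 := fun x => Lr_y_int N hN α ε hα hε u hu x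
  have I2 := fun x => (Lr_y_int N hN α ε hα hε bρ hbint x).const_mul (-(2 * θ * w))
  have I3 := fun x : EN N => ((kr_integrable N hN α ε hα hε).comp_sub_right x).const_mul η
  have I4 : ∀ x, Integrable ((ball x0 R)ᶜ.indicator (fun y => |u y - u x| * kr N α ε (y - x))) := by
    intro x
    apply Integrable.indicator _ hmB
    refine (I1 x).norm.congr (Eventually.of_forall fun y => ?_)
    simp only []
    rw [norm_mul, Real.norm_eq_abs, Real.norm_of_nonneg (kr_nonneg _ _ _ _)]
  have I5 : Integrable (D.indicator (fun _ : EN N => -((1 - θ) * w * a))) := by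
    rw [integrable_indicator_iff measurableSet_ball]
    exact integrableOn_const (by exact measure_ball_lt_top.ne)
  have hmono := integral_mono ((I1 xs).sub (I1 ys)) (((((I2 xs).add (I3 xs)).add ((I2 ys).add (I3 ys))).add
    ((I4 xs).add (I4 ys))).add I5) hpt
  have L1 : ∫ z, ((fun y => (u y - u xs) * kr N α ε (y - xs)) - fun y => (u y - u ys) * kr N α ε (y - ys)) z =
      Lr N α ε u xs - Lr N α ε u ys := by
    rw [integral_sub' (I1 xs) (I1 ys), Lr_y, Lr_y]
  have L3 : ∀ x : EN N, ∫ z, η * kr N α ε (z - x) = η * mε := fun x => by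
    rw [integral_const_mul, integral_sub_right_eq_self (kr N α ε) x]
  have L2 : ∀ x : EN N, ∫ z, (-(2 * θ * w)) * ((bρ z - bρ x) * kr N α ε (z - x)) =
      (-(2 * θ * w)) * Lr N α ε bρ x := fun x => by
    rw [integral_const_mul, Lr_y]
  have hvol : (volume : Measure (EN N)).real D = ρ ^ N * (volume : Measure (EN N)).real (ball 0 1) := by
    rw [measureReal_def, Measure.addHaar_ball _ _ hρ.le, ENNReal.toReal_mul, ENNReal.toReal_ofReal (by positivity),
      finrank_euclideanSpace, Fintype.card_fin, ← measureReal_def]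
  have L5 : ∫ z, D.indicator (fun _ : EN N => -((1 - θ) * w * a)) z = -((1 - θ) * w * (cD * ρ ^ (-α))) := by
    rw [integral_indicator measurableSet_ball, setIntegral_const, smul_eq_mul, hvol, ha, hcD,
      Real.mul_rpow (by norm_num) hρ.le, show -α = (N:ℝ) + -((N:ℝ) + α) by ring, Real.rpow_add hρ,
      Real.rpow_natCast]
    ring
  rw [integral_add' ((((I2 xs).add (I3 xs)).add ((I2 ys).add (I3 ys))).add ((I4 xs).add (I4 ys))) I5,
    integral_add' (((I2 xs).add (I3 xs)).add ((I2 ys).add (I3 ys))) ((I4 xs).add (I4 ys)),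
    integral_add' ((I2 xs).add (I3 xs)) ((I2 ys).add (I3 ys)),
    integral_add' (I2 xs) (I3 xs), integral_add' (I2 ys) (I3 ys), integral_add' (I4 xs) (I4 ys)] at hmono
  rw [L1, L2, L2, L3, L3, L5] at hmono
  have t1 := hT xs hxρ
  have t2 := hT ys hyρ
  have m1 := (abs_le.1 (hM xs hxρ)).1
  have m2 := (abs_le.1 (hM ys hyρ)).2
  have b1 := (abs_le.1 (hLbρ xs)).1
  have b2 := (abs_le.1 (hLbρ ys)).1
  have b3 := mul_le_mul_of_nonneg_left b1 (by positivity : 0 ≤ 2 * θ * w)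
  have b4 := mul_le_mul_of_nonneg_left b2 (by positivity : 0 ≤ 2 * θ * w)
  have key : (1 - θ) * w * (cD * ρ ^ (-α)) - 4 * θ * w * (Cb * ρ ^ (-α)) = cD / 2 * w * ρ ^ (-α) := by
    have : cD - θ * cD - 4 * θ * Cb = cD / 2 := by linarith
    rw [← this]; ring
  linarith

lemma tail_bound (N : ℕ) (hN : 3 ≤ N) (α : ℝ) (hα : 0 < α) (R ε M I : ℝ) (hR : 0 < R)
    (u : EN N → ℝ) (hu : Integrable u) (hI : ∫ y, |u y| ≤ I) (x0 x : EN N)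
    (hx : dist x x0 ≤ R / 4) (hM : |u x| ≤ M) :
    ∫ y, (ball x0 R)ᶜ.indicator (fun y => |u y - u x| * kr N α ε (y - x)) y ≤
      (R / 2) ^ (-((N : ℝ) + α)) * I + M * ∫ z, kr N α (R / 2) z := by
  have hR2 : 0 < R / 2 := by linarith
  have hM0 : 0 ≤ M := (abs_nonneg _).trans hM
  have hk := (kr_integrable N hN α (R / 2) hα hR2).comp_sub_right x
  have h1 : ∫ y, (ball x0 R)ᶜ.indicator (fun y => |u y - u x| * kr N α ε (y - x)) y ≤
      ∫ y, ((R / 2) ^ (-((N : ℝ) + α)) * |u y| + M * kr N α (R / 2) (y - x)) := by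
    refine integral_mono_of_nonneg (Eventually.of_forall fun y => ?_)
      ((hu.abs.const_mul _).add (hk.const_mul _)) (Eventually.of_forall fun y => ?_)
    · exact indicator_nonneg (fun y _ => mul_nonneg (abs_nonneg _) (kr_nonneg _ _ _ _)) y
    · have p2 := kr_nonneg N α (R / 2) (y - x)
      by_cases hy : y ∈ (ball x0 R)ᶜ
      · rw [indicator_of_mem hy]
        have hd : R / 2 < ‖y - x‖ := by
          rw [← dist_eq_norm]
          have := dist_triangle y x x0
          simp only [mem_compl_iff, mem_ball, not_lt] at hy
          linarith
        have e1 : kr N α ε (y - x) ≤ kr N α (R / 2) (y - x) := by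
          unfold kr
          rw [if_pos hd]
          split_ifs
          · exact le_rfl
          · positivity
        have e2 := kr_le N α (R / 2) hα hR2 (y - x)
        have e3 : |u y - u x| ≤ |u y| + M := (abs_sub _ _).trans (by linarith)
        calc |u y - u x| * kr N α ε (y - x) ≤ (|u y| + M) * kr N α (R / 2) (y - x) :=
              mul_le_mul e3 e1 (kr_nonneg _ _ _ _) (by positivity)
          _ ≤ _ := by nlinarith [mul_le_mul_of_nonneg_right e2 (abs_nonneg (u y))]
      · rw [indicator_of_notMem hy]
        positivity
  refine h1.trans ?_
  rw [integral_add (hu.abs.const_mul _) (hk.const_mul _), integral_const_mul, integral_const_mul,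
    integral_sub_right_eq_self (kr N α (R / 2)) x]
  have : 0 ≤ (R / 2) ^ (-((N : ℝ) + α)) := by positivity
  nlinarith [mul_le_mul_of_nonneg_left hI this]

lemma equicont (N : ℕ) (hN : 3 ≤ N) (α : ℝ) (hα : 0 < α) (hα2 : α < 2)
    (u : ℕ → EN N → ℝ) (ε : ℕ → ℝ) (hε : ∀ n, 0 < ε n) (hε0 : Tendsto ε atTop (𝓝 0)) (I : ℝ)
    (hu : ∀ n, Integrable (u n)) (hI : ∀ n, ∫ y, |u n y| ≤ I)
    (hb : ∀ s < 1, ∃ M : ℝ, 0 < M ∧ ∃ n0, ∀ n ≥ n0, ∀ x, ‖x‖ ≤ s →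
      |u n x| ≤ M ∧ |Lr N α (ε n) (u n) x| ≤ M) :
    ∀ s < 1, ∀ w > 0, ∃ ρ > 0, ∃ n0, ∀ n ≥ n0, ∀ x0, ‖x0‖ ≤ s →
      ∀ x ∈ ball x0 ρ, ∀ y ∈ ball x0 ρ, u n x - u n y ≤ w := by
  intro s hs w hw
  obtain ⟨θ, C, hθ, hθ1, hC, hstep⟩ := osc_step N hN α hα hα2
  obtain ⟨M, hM, n1, hMn⟩ := hb ((s + 1) / 2) (by linarith)
  set r0 := (1 - s) / 2 with hr0
  have hr0p : 0 < r0 := by rw [hr0]; linarith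
  have hin : ∀ x0 x : EN N, ‖x0‖ ≤ s → dist x x0 < r0 → ‖x‖ ≤ (s + 1) / 2 := by
    intro x0 x h0 hx
    have := norm_le_norm_add_norm_sub' x x0
    rw [dist_eq_norm] at hx
    linarith
  have key : ∀ k : ℕ, ∃ ρ, 0 < ρ ∧ ρ ≤ r0 ∧ ∃ n0, ∀ n ≥ n0, ∀ x0, ‖x0‖ ≤ s →
      ∀ x ∈ ball x0 ρ, ∀ y ∈ ball x0 ρ, u n x - u n y ≤ (1 - θ) ^ k * (2 * M) := by
    intro k
    induction k with
    | zero =>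
      refine ⟨r0, hr0p, le_rfl, n1, fun n hn x0 h0 x hx y hy => ?_⟩
      have a := (hMn n hn x (hin x0 x h0 hx)).1
      have b := (hMn n hn y (hin x0 y h0 hy)).1
      rw [abs_le] at a b
      simp; linarith
    | succ k ih =>
      obtain ⟨R, hR, hRr, n0, hn0⟩ := ih
      set W := (1 - θ) ^ k * (2 * M) with hW
      have hWp : 0 < W := by
        have : 0 < 1 - θ := by linarith
        positivity
      set T := (R / 2) ^ (-((N : ℝ) + α)) * I + M * ∫ z, kr N α (R / 2) z with hT
      have hlim : Tendsto (fun ρ : ℝ => C * W * ρ ^ (-α)) (𝓝[>] 0) atTop := by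
        refine Tendsto.const_mul_atTop (by positivity) ?_
        exact tendsto_rpow_neg_nhdsGT_zero (by linarith)
      have hA : ∀ᶠ ρ : ℝ in 𝓝[>] 0, 0 < ρ := self_mem_nhdsWithin
      have hB : ∀ᶠ ρ : ℝ in 𝓝[>] 0, ρ < R / 4 :=
        mem_nhdsWithin_of_mem_nhds (Iio_mem_nhds (by linarith))
      have hev := (hlim.eventually_gt_atTop (2 * M + 2 * T)).and (hA.and hB)
      obtain ⟨ρ, h1, h2, h3⟩ := hev.exists
      obtain ⟨n2, hn2⟩ := eventually_atTop.1 (hε0.eventually_lt_const h2)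
      refine ⟨ρ / 2, by linarith, by linarith, max n0 (max n1 n2), fun n hn x0 h0 => ?_⟩
      have hna : n0 ≤ n := (le_max_left _ _).trans hn
      have hnb : n1 ≤ n := (le_max_left _ _).trans ((le_max_right _ _).trans hn)
      have hnc : n2 ≤ n := (le_max_right _ _).trans ((le_max_right _ _).trans hn)
      have hbd : ∀ x ∈ ball x0 ρ, |u n x| ≤ M ∧ |Lr N α (ε n) (u n) x| ≤ M := by
        intro x hx
        rw [mem_ball] at hx
        exact hMn n hnb x (hin x0 x h0 (by linarith))
      have := hstep ρ (ε n) R W M T x0 (u n) (hε n) (hn2 n hnc) (by linarith) hWp (hu n)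
        (hn0 n hna x0 h0) (fun x hx => (hbd x hx).2) (fun x hx => by
          refine tail_bound N hN α hα R (ε n) M I hR (u n) (hu n) (hI n) x0 x ?_ (hbd x hx).1
          rw [mem_ball] at hx; linarith) h1
      rw [pow_succ', mul_assoc]
      exact this
  have hl : Tendsto (fun k : ℕ => (1 - θ) ^ k * (2 * M)) atTop (𝓝 (0 * (2 * M))) :=
    (tendsto_pow_atTop_nhds_zero_of_lt_one (by linarith) (by linarith)).mul_const _
  rw [zero_mul] at hl
  obtain ⟨k, hk⟩ := (hl.eventually_lt_const hw).exists
  obtain ⟨ρ, h1, _, n0, h2⟩ := key k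
  exact ⟨ρ, h1, n0, fun n hn x0 h0 x hx y hy => (h2 n hn x0 h0 x hx y hy).trans hk.le⟩

lemma extract_limit (N : ℕ) (u : ℕ → EN N → ℝ) (V : EN N → ℝ) (h0 : ∀ n x, 0 ≤ u n x)
    (hV : ∀ n x, u n x ≤ V x)
    (heq : ∀ s < 1, ∀ w > 0, ∃ ρ > 0, ∃ n0, ∀ n ≥ n0, ∀ x0, ‖x0‖ ≤ s →
      ∀ x ∈ ball x0 ρ, ∀ y ∈ ball x0 ρ, u n x - u n y ≤ w) :
    ∃ (ψ : ℕ → ℕ) (v : EN N → ℝ), StrictMono ψ ∧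
      (∀ x, ‖x‖ < 1 → Tendsto (fun n => u (ψ n) x) atTop (𝓝 (v x))) ∧
      (∀ x, ¬ ‖x‖ < 1 → v x = 0) ∧ ContinuousOn v (ball 0 1) := by
  set D := TopologicalSpace.denseSeq (EN N)
  have hc : IsCompact (Set.pi univ (fun k => Icc 0 (V (D k)))) :=
    isCompact_univ_pi fun k => isCompact_Icc
  obtain ⟨a, -, ψ, hψ, hlim⟩ := hc.tendsto_subseq (x := fun n k => u n (D k))
    (fun n => fun k _ => ⟨h0 n _, hV n _⟩)
  rw [tendsto_pi_nhds] at hlim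
  have habs : ∀ x : EN N, ‖x‖ < 1 → ∀ w > 0, ∃ ρ > 0, ∃ n0, ∀ n ≥ n0, ∀ y ∈ ball x ρ,
      |u (ψ n) y - u (ψ n) x| ≤ w := by
    intro x hx w hw
    obtain ⟨ρ, hρ, n0, h⟩ := heq ‖x‖ hx w hw
    refine ⟨ρ, hρ, n0, fun n hn y hy => ?_⟩
    have hn' : n0 ≤ ψ n := hn.trans (hψ.id_le n)
    have e1 := h (ψ n) hn' x le_rfl y hy x (mem_ball_self hρ)
    have e2 := h (ψ n) hn' x le_rfl x (mem_ball_self hρ) y hy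
    rw [abs_le]; constructor <;> linarith
  have hconv : ∀ x : EN N, ‖x‖ < 1 → ∃ l, Tendsto (fun n => u (ψ n) x) atTop (𝓝 l) := by
    intro x hx
    apply cauchySeq_tendsto_of_complete
    rw [Metric.cauchySeq_iff']
    intro e he
    obtain ⟨ρ, hρ, n0, h⟩ := habs x hx (e / 8) (by linarith)
    obtain ⟨k, hk⟩ := (TopologicalSpace.denseRange_denseSeq (EN N)).exists_dist_lt x hρ
    rw [dist_comm] at hk
    obtain ⟨n1, hn1⟩ := Metric.cauchySeq_iff'.1 (hlim k).cauchySeq (e / 8) (by linarith)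
    refine ⟨max n0 n1, fun n hn => ?_⟩
    have a1 := h n ((le_max_left _ _).trans hn) _ hk
    have a2 := h (max n0 n1) (le_max_left _ _) _ hk
    have a3 := hn1 n ((le_max_right _ _).trans hn)
    have a4 := hn1 (max n0 n1) (le_max_right _ _)
    simp only [Real.dist_eq, Function.comp] at a3 a4 ⊢
    have a3 := a3.le
    have a4 := a4.le
    rw [abs_le] at a1 a2 a3 a4
    rw [abs_lt]
    constructor <;> linarith
  choose! v0 hv0 using hconv
  refine ⟨ψ, fun x => if ‖x‖ < 1 then v0 x else 0, hψ, fun x hx => by simpa [hx] using hv0 x hx,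
    fun x hx => by simp [hx], ?_⟩
  have hcv : ContinuousOn v0 (ball 0 1) := by
    intro x hx
    have hx1 : ‖x‖ < 1 := by simpa using hx
    rw [ContinuousWithinAt, Metric.tendsto_nhdsWithin_nhds]
    intro e he
    obtain ⟨ρ, hρ, n0, h⟩ := habs x hx1 (e / 2) (by linarith)
    refine ⟨ρ, hρ, fun y hy hd => ?_⟩
    have hy1 : ‖y‖ < 1 := by simpa using hy
    have hl := ((hv0 y hy1).sub (hv0 x hx1)).abs
    have := le_of_tendsto hl (eventually_atTop.2 ⟨n0, fun n hn => h n hn y hd⟩)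
    rw [Real.dist_eq]; linarith
  refine hcv.congr fun x hx => ?_
  have hx1 : ‖x‖ < 1 := by simpa using hx
  simp [hx1]

lemma kprod_integrable (N : ℕ) (α r : ℝ) (hα : 0 < α) (hr : 0 < r)
    (u φ : EN N → ℝ) (hu : Integrable u) (hφ : Integrable φ) :
    Integrable (fun p : EN N × EN N => φ p.1 * u p.2 * kr N α r (p.2 - p.1))
      (volume.prod volume) := by
  refine (hφ.mul_prod hu).mul_bdd (c := r ^ (-((N : ℝ) + α))) ?_ (Eventually.of_forall fun z => ?_)
  · exact ((kr_measurable N α r).comp (measurable_snd.sub measurable_fst)).aestronglyMeasurable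
  · rw [Real.norm_of_nonneg (kr_nonneg _ _ _ _)]
    exact kr_le N α r hα hr _

lemma shift_eq (N : ℕ) (α r : ℝ) (u : EN N → ℝ) (x : EN N) :
    ∫ z, u (x + z) * kr N α r z = ∫ y, u y * kr N α r (y - x) := by
  have h := integral_sub_right_eq_self (μ := volume) (fun z => u (x + z) * kr N α r z) x
  simp only [add_sub_cancel] at h
  exact h.symm

lemma Lr_adj (N : ℕ) (hN : 3 ≤ N) (α r : ℝ) (hα : 0 < α) (hr : 0 < r)
    (u φ : EN N → ℝ) (hu : Integrable u) (hφ : Integrable φ) (hp : Integrable (fun x => φ x * u x)) :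
    ∫ x, φ x * Lr N α r u x = ∫ x, u x * Lr N α r φ x := by
  have h1 := kprod_integrable N α r hα hr u φ hu hφ
  have h2 := kprod_integrable N α r hα hr φ u hφ hu
  have e : ∀ (u φ : EN N → ℝ), Integrable u → Integrable φ → Integrable (fun x => φ x * u x) →
      ∫ x, φ x * Lr N α r u x = (∫ x, ∫ y, φ x * u y * kr N α r (y - x)) -
        (∫ x, φ x * u x) * ∫ z, kr N α r z := by
    intro u φ hu hφ hp
    rw [← integral_mul_const, ← integral_sub
      (kprod_integrable N α r hα hr u φ hu hφ).integral_prod_left (hp.mul_const _)]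
    congr 1; funext x
    rw [Lr_eq N hN α r hα hr u hu x, shift_eq]
    simp only [mul_assoc]
    rw [integral_const_mul]; ring
  have hp' : Integrable (fun x => u x * φ x) := by simpa only [mul_comm] using hp
  rw [e u φ hu hφ hp, e φ u hφ hu hp', integral_integral_swap h1]
  congr 1
  · congr 1; funext x; congr 1; funext y
    rw [← kr_neg, neg_sub]; ring
  · congr 1; congr 1; funext x; ring

lemma Lr_meas (N : ℕ) (hN : 3 ≤ N) (α r : ℝ) (hα : 0 < α) (hr : 0 < r)
    (φ : EN N → ℝ) (hφ : Integrable φ) (hm : Measurable φ) : StronglyMeasurable (Lr N α r φ) := by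
  have : Lr N α r φ = fun x => ∫ z, (φ (x + z) - φ x) * kr N α r z := rfl
  rw [this]
  refine StronglyMeasurable.integral_prod_right
    (f := fun x z : EN N => (φ (x + z) - φ x) * kr N α r z) ?_
  apply Measurable.stronglyMeasurable
  exact ((hm.comp (measurable_fst.add measurable_snd)).sub (hm.comp measurable_fst)).mul
    ((kr_measurable N α r).comp measurable_snd)

lemma sub_closedBall (N : ℕ) (K : Set (EN N)) (hK : IsCompact K) (h : K ⊆ ball 0 1) :
    ∃ s : ℝ, 0 ≤ s ∧ s < 1 ∧ ∀ x ∈ K, ‖x‖ ≤ s := by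
  rcases K.eq_empty_or_nonempty with rfl | hne
  · exact ⟨0, le_rfl, by norm_num, by simp⟩
  · obtain ⟨x, hx, hm⟩ := hK.exists_isMaxOn hne continuous_norm.continuousOn
    exact ⟨‖x‖, norm_nonneg _, by simpa using h hx, fun y hy => hm hy⟩

lemma Vq_le (N : ℕ) (q : ℝ) (hq : 0 < q) (s : ℝ) (h0 : 0 ≤ s) (h1 : s < 1) (x : EN N)
    (hx : ‖x‖ ≤ s) : Vq N q x ≤ (1 - s ^ 2) ^ (-q) := by
  rw [Vq_of_lt q x (by linarith)]
  refine Real.rpow_le_rpow_of_nonpos (by nlinarith) ?_ (by linarith)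
  nlinarith [norm_nonneg x]

lemma weak_limit (N : ℕ) (hN : 3 ≤ N) (α γ β c c2 : ℝ) (hα : 0 < α) (hα2 : α < 2) (hγ : 0 < γ)
    (hβ : 0 < β) (hβ1 : β < 1) (hc2 : 0 < c2) (hc : c = fracLapCoeff N α)
    (u : ℕ → EN N → ℝ) (ε : ℕ → ℝ) (hε : ∀ n, 0 < ε n) (hε0 : Tendsto ε atTop (𝓝 0))
    (hm : ∀ n, Measurable (u n)) (h0 : ∀ n x, 0 ≤ u n x) (hV : ∀ n x, u n x ≤ c2 * Vq N β x)
    (hu : ∀ n, Integrable (u n))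
    (heq : ∀ s < 1, ∃ n0, ∀ n ≥ n0, ∀ x, ‖x‖ ≤ s → c * Lr N α (ε n) (u n) x = u n x ^ γ)
    (v : EN N → ℝ) (hv : ∀ x, Tendsto (fun n => u n x) atTop (𝓝 (v x)))
    (φ : EN N → ℝ) (hφ : ContDiff ℝ (⊤ : ℕ∞) φ) (hs : HasCompactSupport φ)
    (hsup : tsupport φ ⊆ ball 0 1) :
    ∫ x, v x * fracLap N α φ x = ∫ x, v x ^ γ * φ x := by
  have hφ2 : ContDiff ℝ 2 φ := by exact_mod_cast contDiff_infty.1 hφ 2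
  have hφi := cs_integrable N φ hφ2 hs
  have hφm : Measurable φ := hφ.continuous.measurable
  obtain ⟨s, hs0, hs1, hsK⟩ := sub_closedBall N _ hs hsup
  have hφ0 : ∀ x, ¬ ‖x‖ ≤ s → φ x = 0 := fun x hx =>
    image_eq_zero_of_notMem_tsupport fun h => hx (hsK x h)
  obtain ⟨n0, hn0⟩ := heq s hs1
  obtain ⟨M, hM, hMb⟩ := Lr_bound N hN α hα hα2 φ hφ2 hs
  obtain ⟨Mφ, hMφ⟩ := hφ.continuous.bounded_above_of_compact_support hs
  have hε1 : Tendsto ε atTop (𝓝[>] 0) :=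
    tendsto_nhdsWithin_iff.2 ⟨hε0, Eventually.of_forall hε⟩
  have hVi := (Vq_integrable N hN β hβ hβ1).const_mul c2
  have hcp : 0 < c := hc ▸ coeff_pos N α hα hα2
  have l1 : Tendsto (fun n => ∫ x, u n x * (c * Lr N α (ε n) φ x)) atTop
      (𝓝 (∫ x, v x * fracLap N α φ x)) := by
    refine tendsto_integral_of_dominated_convergence (fun x => c2 * Vq N β x * (c * M)) ?_
      (hVi.mul_const _) ?_ ?_
    · intro n
      exact ((hm n).mul ((Lr_meas N hN α (ε n) hα (hε n) φ hφi hφm).measurable.const_mul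
        c)).aestronglyMeasurable
    · intro n
      refine Eventually.of_forall fun x => ?_
      rw [norm_mul, Real.norm_of_nonneg (h0 n x), norm_mul, Real.norm_of_nonneg hcp.le]
      have := hMb (ε n) (hε n) x
      have hVn := Vq_nonneg N β x
      exact mul_le_mul (hV n x) (mul_le_mul_of_nonneg_left this hcp.le) (by positivity)
        (by positivity)
    · refine Eventually.of_forall fun x => (hv x).mul ?_
      have := (fracLap_lim N hN α hα hα2 φ hφ2 hs x).comp hε1
      rw [hc]; exact this
  set K := (1 - s ^ 2) ^ (-β) with hK
  have hK0 : 0 ≤ K := by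
    have : 0 ≤ 1 - s ^ 2 := by nlinarith
    positivity
  have l2 : Tendsto (fun n => ∫ x, u n x ^ γ * φ x) atTop (𝓝 (∫ x, v x ^ γ * φ x)) := by
    refine tendsto_integral_of_dominated_convergence (fun x => (c2 * K) ^ γ * |φ x|) ?_
      (hφi.abs.const_mul _) ?_ ?_
    · intro n
      exact (((hm n).pow_const γ).mul hφm).aestronglyMeasurable
    · intro n
      refine Eventually.of_forall fun x => ?_
      by_cases hx : ‖x‖ ≤ s
      · rw [norm_mul, Real.norm_of_nonneg (Real.rpow_nonneg (h0 n x) _), Real.norm_eq_abs]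
        refine mul_le_mul_of_nonneg_right (Real.rpow_le_rpow (h0 n x) ?_ hγ.le) (abs_nonneg _)
        exact (hV n x).trans (mul_le_mul_of_nonneg_left (Vq_le N β hβ s hs0 hs1 x hx) hc2.le)
      · simp [hφ0 x hx]
    · exact Eventually.of_forall fun x =>
        ((hv x).rpow_const (Or.inr hγ.le)).mul_const _
  refine tendsto_nhds_unique l1 (l2.congr' ?_)
  filter_upwards [eventually_ge_atTop n0] with n hn
  have a1 : ∀ x, u n x ^ γ * φ x = c * (φ x * Lr N α (ε n) (u n) x) := by
    intro x
    by_cases hx : ‖x‖ ≤ s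
    · rw [← hn0 n hn x hx]; ring
    · simp [hφ0 x hx]
  have a2 : ∀ x, u n x * (c * Lr N α (ε n) φ x) = c * (u n x * Lr N α (ε n) φ x) := by
    intro x; ring
  simp only [a1, a2, integral_const_mul]
  rw [Lr_adj N hN α (ε n) hα (hε n) (u n) φ (hu n) hφi]
  exact (hu n).bdd_mul (c := Mφ) hφm.aestronglyMeasurable (Eventually.of_forall hMφ)

lemma delta_cmp {N : ℕ} (x : EN N) (hx : ‖x‖ < 1) :
    0 < delta1 x ∧ delta1 x ≤ 1 - ‖x‖ ^ 2 ∧ 1 - ‖x‖ ^ 2 ≤ 2 * delta1 x := by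
  simp only [delta1, hx, if_true]
  have := norm_nonneg x
  refine ⟨by linarith, by nlinarith, by nlinarith⟩

lemma blowup (N : ℕ) (q b c : ℝ) (hc : 0 < c) (hqb : q < b) (u : EN N → ℝ)
    (hu : ∀ x, ‖x‖ < 1 → c * delta1 x ^ (-b) ≤ u x) (z : EN N) (hz : ‖z‖ = 1) :
    Tendsto (fun x => delta1 x ^ q * u x) (𝓝[ball 0 1] z) atTop := by
  have hd : Tendsto (fun x : EN N => delta1 x) (𝓝[ball 0 1] z) (𝓝[>] 0) := by
    refine tendsto_nhdsWithin_iff.2 ⟨?_, ?_⟩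
    · have h1 : Tendsto (fun x : EN N => 1 - ‖x‖) (𝓝[ball 0 1] z) (𝓝 0) := by
        have : Continuous (fun x : EN N => 1 - ‖x‖) := by fun_prop
        have h := (this.tendsto z).mono_left (nhdsWithin_le_nhds (s := ball 0 1))
        simpa [hz] using h
      refine h1.congr' ?_
      filter_upwards [self_mem_nhdsWithin] with x hx
      have hx1 : ‖x‖ < 1 := by simpa using hx
      simp [delta1, hx1]
    · filter_upwards [self_mem_nhdsWithin] with x hx
      exact (delta_cmp x (by simpa using hx)).1
  have h2 : Tendsto (fun x : EN N => c * delta1 x ^ (q - b)) (𝓝[ball 0 1] z) atTop :=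
    Tendsto.const_mul_atTop hc ((tendsto_rpow_neg_nhdsGT_zero (by linarith)).comp hd)
  refine tendsto_atTop_mono' _ ?_ h2
  filter_upwards [self_mem_nhdsWithin] with x hx
  have hx1 : ‖x‖ < 1 := by simpa using hx
  have hp := (delta_cmp x hx1).1
  have e : delta1 x ^ (q - b) = delta1 x ^ q * delta1 x ^ (-b) := by
    rw [← Real.rpow_add hp]; rfl
  rw [e]
  have := mul_le_mul_of_nonneg_left (hu x hx1) (Real.rpow_nonneg hp.le q)
  linarith

/-- existence of a blow-up solution with rate `δ^{-α/(γ-1)}` for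
`1 + α < γ < (2+α)/(2-α)`. -/
theorem statement_11 (N : ℕ) (hN : 3 ≤ N) (α : ℝ) (hα0 : 0 < α) (hα2 : α < 2)
    (γ : ℝ) (hγ1 : 1 + α < γ) (hγ2 : γ < (2 + α) / (2 - α)) :
    ∃ u : EN N → ℝ, IsSolutionPinf N α γ u ∧
      ∃ c₁ c₂ : ℝ, 0 < c₁ ∧ c₁ ≤ c₂ ∧
        ∀ x : EN N, ‖x‖ < 1 →
          c₁ * delta1 x ^ (-α / (γ - 1)) ≤ u x ∧ u x ≤ c₂ * delta1 x ^ (-α / (γ - 1)) := by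
  have hg : 0 < γ - 1 := by linarith
  have hc := coeff_pos N α hα0 hα2
  set c := fracLapCoeff N α with hcdef
  obtain ⟨c1, c2, κ, hc1, hc12, hκ, hex⟩ := exist_seq N hN α γ c hα0 hα2 hγ1 hγ2 hc
  rw [neg_div]
  set β := α / (γ - 1) with hβ
  have hβ1 : β < 1 := by rw [hβ, div_lt_one hg]; linarith
  have hβ0 : 1 - α / 2 < β := by
    rw [hβ, lt_div_iff₀ hg]
    rw [lt_div_iff₀ (by linarith)] at hγ2
    nlinarith
  have hβp : 0 < β := by positivity
  have hγp : 0 < γ := by linarith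
  have hc2 : 0 < c2 := by linarith
  set ε : ℕ → ℝ := fun n => 1 / ((n : ℝ) + 1) with hεd
  have hε : ∀ n, 0 < ε n := fun n => by simp only [hεd]; positivity
  have hε0 : Tendsto ε atTop (𝓝 0) := tendsto_one_div_add_atTop_nhds_zero_nat
  choose u hm hl hV hE using fun n => hex (ε n) (hε n)
  have h0 : ∀ n x, 0 ≤ u n x := fun n x =>
    (mul_nonneg hc1.le (Vq_nonneg N β x)).trans (hl n x)
  have hVi := (Vq_integrable N hN β hβp hβ1).const_mul c2
  have hdom : ∀ w : EN N → ℝ, Measurable w → (∀ x, 0 ≤ w x) → (∀ x, w x ≤ c2 * Vq N β x) →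
      Integrable w := by
    intro w hw h0 h1
    refine hVi.mono' hw.aestronglyMeasurable (Eventually.of_forall fun x => ?_)
    rw [Real.norm_of_nonneg (h0 x)]; exact h1 x
  have hui : ∀ n, Integrable (u n) := fun n => hdom _ (hm n) (h0 n) (hV n)
  have heq : ∀ s < 1, ∃ n0, ∀ n ≥ n0, ∀ x, ‖x‖ ≤ s → c * Lr N α (ε n) (u n) x = u n x ^ γ := by
    intro s hs
    by_cases hs0 : 0 ≤ s
    · have : 0 < κ * (1 - s ^ 2) := mul_pos hκ (by nlinarith)
      obtain ⟨n0, hn0⟩ := eventually_atTop.1 (hε0.eventually_lt_const this)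
      refine ⟨n0, fun n hn x hx => ?_⟩
      have h := hE n x (by linarith)
      rw [min_eq_left] at h
      · exact h
      · refine (hn0 n hn).le.trans (mul_le_mul_of_nonneg_left ?_ hκ.le)
        nlinarith [norm_nonneg x]
    · exact ⟨0, fun n _ x hx => absurd ((norm_nonneg x).trans hx) hs0⟩
  have hb : ∀ s < 1, ∃ M : ℝ, 0 < M ∧ ∃ n0, ∀ n ≥ n0, ∀ x, ‖x‖ ≤ s →
      |u n x| ≤ M ∧ |Lr N α (ε n) (u n) x| ≤ M := by
    intro s hs
    obtain ⟨n0, hn0⟩ := heq s hs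
    by_cases hs0 : 0 ≤ s
    · have hp : 0 < 1 - s ^ 2 := by nlinarith
      set K := c2 * (1 - s ^ 2) ^ (-β) with hK
      have hKp : 0 < K := by positivity
      refine ⟨K + K ^ γ / c, by positivity, n0, fun n hn x hx => ?_⟩
      have hb1 : u n x ≤ K := (hV n x).trans
        (mul_le_mul_of_nonneg_left (Vq_le N β hβp s hs0 hs x hx) hc2.le)
      have hLe : Lr N α (ε n) (u n) x = u n x ^ γ / c := by
        rw [← hn0 n hn x hx]; field_simp
      have hb2 : u n x ^ γ ≤ K ^ γ := Real.rpow_le_rpow (h0 n x) hb1 hγp.le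
      have hb3 : u n x ^ γ / c ≤ K ^ γ / c := div_le_div_of_nonneg_right hb2 hc.le
      have hb4 : 0 ≤ u n x ^ γ / c := div_nonneg (Real.rpow_nonneg (h0 n x) _) hc.le
      rw [hLe, abs_of_nonneg (h0 n x), abs_of_nonneg hb4]
      have : 0 ≤ K ^ γ / c := by positivity
      constructor <;> linarith
    · exact ⟨1, one_pos, 0, fun n _ x hx => absurd ((norm_nonneg x).trans hx) hs0⟩
  have hI : ∀ n, ∫ y, |u n y| ≤ ∫ y, c2 * Vq N β y := by
    intro n
    refine integral_mono (hui n).abs hVi fun y => ?_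
    simp only [abs_of_nonneg (h0 n y)]; exact hV n y
  have hec := equicont N hN α hα0 hα2 u ε hε hε0 _ hui hI hb
  obtain ⟨ψ, v, hψ, hvl, hvo, hvc⟩ := extract_limit N u _ h0 hV hec
  have hv : ∀ x, Tendsto (fun n => u (ψ n) x) atTop (𝓝 (v x)) := by
    intro x
    by_cases hx : ‖x‖ < 1
    · exact hvl x hx
    · have : ∀ n, u (ψ n) x = 0 := fun n => le_antisymm
        (by have := hV (ψ n) x; rwa [Vq_of_ge β x hx, mul_zero] at this) (h0 _ _)
      simp only [this, hvo x hx]; exact tendsto_const_nhds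
  have hv0 : ∀ x, 0 ≤ v x := fun x => ge_of_tendsto' (hv x) fun n => h0 _ _
  have hvV : ∀ x, v x ≤ c2 * Vq N β x := fun x => le_of_tendsto' (hv x) fun n => hV _ _
  have hvl' : ∀ x, c1 * Vq N β x ≤ v x := fun x => ge_of_tendsto' (hv x) fun n => hl _ _
  have hvm : Measurable v := measurable_of_tendsto_metrizable (fun n => hm (ψ n))
    (tendsto_pi_nhds.2 hv)
  have hvi := hdom v hvm hv0 hvV
  have hmem : memLalpha N α v := by
    unfold memLalpha
    refine hvi.mul_bdd (c := 1) ?_ (Eventually.of_forall fun y => ?_)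
    · exact ((measurable_const.add measurable_norm).pow_const _).aestronglyMeasurable
    · have h1 : 1 ≤ 1 + ‖y‖ := by linarith [norm_nonneg y]
      rw [Real.norm_of_nonneg (by positivity)]
      exact Real.rpow_le_one_of_one_le_of_nonpos h1 (by
        have : (0:ℝ) ≤ N := by positivity
        linarith)
  have hlow : ∀ x : EN N, ‖x‖ < 1 → c1 * 2 ^ (-β) * delta1 x ^ (-β) ≤ v x := by
    intro x hx
    obtain ⟨d1, d2, d3⟩ := delta_cmp x hx
    refine le_trans ?_ (hvl' x)
    rw [Vq_of_lt β x hx, mul_assoc, ← Real.mul_rpow (by norm_num) d1.le]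
    exact mul_le_mul_of_nonneg_left
      (Real.rpow_le_rpow_of_nonpos (rho_pos x hx) d3 (by linarith)) hc1.le
  have hup : ∀ x : EN N, ‖x‖ < 1 → v x ≤ c2 * delta1 x ^ (-β) := by
    intro x hx
    obtain ⟨d1, d2, d3⟩ := delta_cmp x hx
    refine (hvV x).trans ?_
    rw [Vq_of_lt β x hx]
    exact mul_le_mul_of_nonneg_left
      (Real.rpow_le_rpow_of_nonpos d1 d2 (by linarith)) hc2.le
  refine ⟨v, ⟨hv0, hmem, hvo, ⟨hv0, hvc, hmem, ?_⟩, ?_⟩, c1 * 2 ^ (-β), c2, by positivity, ?_,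
    fun x hx => ⟨hlow x hx, hup x hx⟩⟩
  · intro φ hφ hs hsup _
    refine weak_limit N hN α γ β c c2 hα0 hα2 hγp hβp hβ1 hc2 hcdef (fun n => u (ψ n))
      (fun n => ε (ψ n)) (fun n => hε _) (hε0.comp hψ.tendsto_atTop) (fun n => hm _)
      (fun n => h0 _) (fun n => hV _) (fun n => hui _) ?_ v hv φ hφ hs hsup
    intro s hs
    obtain ⟨n0, hn0⟩ := heq s hs
    exact ⟨n0, fun n hn => hn0 (ψ n) (hn.trans (hψ.id_le n))⟩
  · intro z
    exact blowup N (1 - α / 2) β (c1 * 2 ^ (-β)) (by positivity) hβ0 v hlow z (by simpa using z.2)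
  · have : (2:ℝ) ^ (-β) ≤ 1 := Real.rpow_le_one_of_one_le_of_nonpos (by norm_num) (by linarith)
    nlinarith

end
end

section
/- There exist constants 0 < c₁ ≤ c₂, depending only on N and α, such that for every x ∈ B, c₁ (1−|x|)^{α/2−1} ≤ ∫_{∂B} (1−|x|²)^{α/2} |x−y|^{−N} dσ(y) ≤ c₂ (1−|x|)^{α/2−1}. -/
open MeasureTheory Real Filter Topology Metric Set

noncomputable section

lemma exists_basis_13 {n : ℕ} (e : EN (n+1)) (he : ‖e‖ = 1) :
    ∃ b : OrthonormalBasis (Fin (n+1)) ℝ (EN (n+1)), b 0 = e := by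
  have h : Orthonormal ℝ (({0} : Set (Fin (n+1))).domRestrict (fun _ => e)) := by
    constructor
    · intro i; simpa using he
    · intro i j hij
      exact absurd (Subsingleton.elim i j) hij
  obtain ⟨b, hb⟩ := h.exists_orthonormalBasis_extension_of_card_eq (by simp)
  exact ⟨b, hb 0 rfl⟩

lemma box_volume_13 {n : ℕ} (b : OrthonormalBasis (Fin (n+1)) ℝ (EN (n+1)))
    (l u : Fin (n+1) → ℝ) :
    volume {z : EN (n+1) | ∀ i, l i ≤ b.repr z i ∧ b.repr z i ≤ u i} =
      ∏ i, ENNReal.ofReal (u i - l i) := by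
  rw [← Real.volume_Icc_pi]
  have h1 := (PiLp.volume_preserving_ofLp (Fin (n+1))).comp b.measurePreserving_repr
  rw [← h1.measure_preimage measurableSet_Icc.nullMeasurableSet]
  congr 1
  ext z
  simp [Set.mem_Icc, Pi.le_def, forall_and]

lemma cap_meas_13 {n : ℕ} (e : EN (n+1)) (t : ℝ) :
    MeasurableSet {y : Metric.sphere (0 : EN (n+1)) 1 | ‖(y : EN (n+1)) - e‖ < t} := by
  apply IsOpen.measurableSet
  exact isOpen_lt (by fun_prop) continuous_const

open scoped Pointwise in
lemma cap_upper_13 {n : ℕ} (e : EN (n+1)) (he : ‖e‖ = 1) (t : ℝ) (ht : 0 ≤ t) :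
    sphereMeasure (n+1) {y | ‖(y : EN (n+1)) - e‖ < t} ≤
      ENNReal.ofReal ((n+1) * (2 * (2 * t)^n)) := by
  obtain ⟨b, hb⟩ := exists_basis_13 e he
  rw [sphereMeasure, Measure.toSphere_apply' _ (cap_meas_13 e t)]
  have hsub : Ioo (0:ℝ) 1 • (Subtype.val '' {y : Metric.sphere (0 : EN (n+1)) 1 | ‖(y : EN (n+1)) - e‖ < t})
      ⊆ {z : EN (n+1) | ∀ i, (Fin.cons (-1) (fun _ => -t) : Fin (n+1) → ℝ) i ≤ b.repr z i ∧
        b.repr z i ≤ (Fin.cons 1 (fun _ => t) : Fin (n+1) → ℝ) i} := by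
    rintro _ ⟨r, hr, _, ⟨y, hy, rfl⟩, rfl⟩
    have hy1 : ‖(y : EN (n+1))‖ = 1 := by simp
    have key : ∀ i, |b.repr (r • (y : EN (n+1))) i| ≤ |inner ℝ (b i) (y : EN (n+1))| := by
      intro i
      rw [b.repr_apply_apply, inner_smul_right, abs_mul, abs_of_pos hr.1]
      exact mul_le_of_le_one_left (abs_nonneg _) hr.2.le
    intro i
    refine Fin.cases ?_ (fun j => ?_) i
    · have := abs_real_inner_le_norm (b 0) (y : EN (n+1))
      have := key 0
      simp only [Fin.cons_zero]
      rw [← abs_le]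
      simp_all
      linarith
    · have h0 : inner ℝ (b j.succ) (y : EN (n+1)) = inner ℝ (b j.succ) ((y : EN (n+1)) - e) := by
        rw [inner_sub_right, ← hb, b.orthonormal.2 (Fin.succ_ne_zero j), sub_zero]
      have h2 := abs_real_inner_le_norm (b j.succ) ((y : EN (n+1)) - e)
      have h3 := key j.succ
      rw [h0] at h3
      rw [b.orthonormal.1, one_mul] at h2
      simp only [Fin.cons_succ]
      rw [← abs_le]
      have : ‖(y : EN (n+1)) - e‖ < t := hy
      linarith
  have hv := (measure_mono hsub).trans_eq (box_volume_13 b _ _)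
  rw [Fin.prod_univ_succ] at hv
  simp only [Fin.cons_zero, Fin.cons_succ, Finset.prod_const, Finset.card_univ, Fintype.card_fin] at hv
  rw [ENNReal.ofReal_mul (by positivity), ENNReal.ofReal_mul (by positivity), ENNReal.ofReal_pow (by positivity)]
  have e1 : ENNReal.ofReal ((n:ℝ)+1) = ((n+1 : ℕ) : ENNReal) := by
    rw [← ENNReal.ofReal_natCast]; push_cast; rfl
  rw [e1, finrank_euclideanSpace_fin]
  gcongr
  refine hv.trans_eq ?_
  congr 2 <;> [skip; congr 1] <;> ring_nf

open scoped Pointwise in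
lemma cap_lower_13 {n : ℕ} (e : EN (n+1)) (he : ‖e‖ = 1) (t : ℝ) (ht : 0 < t) (ht1 : t ≤ 1) :
    ENNReal.ofReal ((n+1) * (1/4 * (2 * (t / (16 * (n+1))))^n)) ≤
    sphereMeasure (n+1) {y | ‖(y : EN (n+1)) - e‖ < t} := by
  obtain ⟨b, hb⟩ := exists_basis_13 e he
  rw [sphereMeasure, Measure.toSphere_apply' _ (cap_meas_13 e t)]
  set s : ℝ := t / (16 * (n+1)) with hs
  have hs0 : 0 < s := by positivity
  have hsub : {z : EN (n+1) | ∀ i, (Fin.cons (1/4) (fun _ => -s) : Fin (n+1) → ℝ) i ≤ b.repr z i ∧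
        b.repr z i ≤ (Fin.cons (1/2) (fun _ => s) : Fin (n+1) → ℝ) i} ⊆ 
      Ioo (0:ℝ) 1 • (Subtype.val '' {y : Metric.sphere (0 : EN (n+1)) 1 | ‖(y : EN (n+1)) - e‖ < t}) := by
    intro z hz
    have h0 := hz 0
    simp only [Fin.cons_zero] at h0
    have hj : ∀ j : Fin n, |b.repr z j.succ| ≤ s := by
      intro j
      have := hz j.succ
      simp only [Fin.cons_succ] at this
      exact abs_le.2 this
    set z0 := b.repr z 0 with hz0
    have hdec : z - z0 • e = ∑ j : Fin n, b.repr z j.succ • b j.succ := by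
      conv_lhs => rw [← b.sum_repr z, Fin.sum_univ_succ, hb]
      simp [hz0]
    have hw : ‖z - z0 • e‖ ≤ t / 16 := by
      rw [hdec]
      refine (norm_sum_le _ _).trans ?_
      calc ∑ j : Fin n, ‖b.repr z j.succ • b j.succ‖ ≤ ∑ j : Fin n, s := by
            refine Finset.sum_le_sum fun j _ => ?_
            rw [norm_smul, b.orthonormal.1, mul_one]
            exact hj j
        _ = n * s := by simp
        _ ≤ (n+1) * s := by nlinarith
        _ = t / 16 := by rw [hs]; field_simp
    have hz0n : ‖z0 • e‖ = z0 := by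
      rw [norm_smul, he, mul_one, Real.norm_eq_abs, abs_of_pos (by linarith)]
    have hn1 : |‖z‖ - z0| ≤ t / 16 := by
      have := abs_norm_sub_norm_le z (z0 • e)
      rw [hz0n] at this
      linarith
    have hn2 := abs_le.1 hn1
    have hzpos : 0 < ‖z‖ := by linarith
    have hzlow : 1/8 < ‖z‖ := by linarith
    refine ⟨‖z‖, ⟨hzpos, by linarith⟩, ‖z‖⁻¹ • z, ⟨⟨‖z‖⁻¹ • z, ?_⟩, ?_, rfl⟩, ?_⟩
    · simp [norm_smul, hzpos.ne']
    · show ‖‖z‖⁻¹ • z - e‖ < t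
      have : ‖z‖⁻¹ • z - e = ‖z‖⁻¹ • ((z - z0 • e) - (‖z‖ - z0) • e) := by
        have : (z - z0 • e) - (‖z‖ - z0) • e = z - ‖z‖ • e := by module
        rw [this, smul_sub, smul_smul, inv_mul_cancel₀ hzpos.ne', one_smul]
      rw [this, norm_smul, norm_inv, norm_norm, inv_mul_lt_iff₀ hzpos]
      have h5 := norm_sub_le (z - z0 • e) ((‖z‖ - z0) • e)
      rw [norm_smul (‖z‖ - z0), he, mul_one, Real.norm_eq_abs] at h5
      nlinarith
    · show ‖z‖ • ‖z‖⁻¹ • z = z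
      rw [smul_smul, mul_inv_cancel₀ hzpos.ne', one_smul]
  have hv := (box_volume_13 b _ _).symm.trans_le (measure_mono hsub)
  rw [Fin.prod_univ_succ] at hv
  simp only [Fin.cons_zero, Fin.cons_succ, Finset.prod_const, Finset.card_univ, Fintype.card_fin] at hv
  rw [ENNReal.ofReal_mul (by positivity), ENNReal.ofReal_mul (by positivity), ENNReal.ofReal_pow (by positivity)]
  have e1 : ENNReal.ofReal ((n:ℝ)+1) = ((n+1 : ℕ) : ENNReal) := by
    rw [← ENNReal.ofReal_natCast]; push_cast; rfl
  rw [e1, finrank_euclideanSpace_fin]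
  gcongr
  refine Eq.trans_le ?_ hv
  congr 2 <;> [skip; congr 1] <;> ring_nf

/-- The closest boundary point. -/
lemma exists_dir_13 {n : ℕ} (x : EN (n+1)) (hx : ‖x‖ < 1) :
    ∃ e : EN (n+1), ‖e‖ = 1 ∧ ‖x - e‖ = 1 - ‖x‖ := by
  by_cases h : x = 0
  · obtain ⟨e, he⟩ := exists_norm_eq (EN (n+1)) (zero_le_one (α := ℝ))
    exact ⟨e, he, by simp [h, he]⟩
  · have hp : 0 < ‖x‖ := norm_pos_iff.2 h
    refine ⟨‖x‖⁻¹ • x, by simp [norm_smul, hp.ne'], ?_⟩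
    have : x - ‖x‖⁻¹ • x = (1 - ‖x‖⁻¹) • x := by module
    rw [this, norm_smul, Real.norm_eq_abs, abs_of_nonpos]
    · field_simp; ring
    · have := (one_le_inv₀ hp).2 hx.le
      linarith

lemma dist_lower_13 {n : ℕ} (x : EN (n+1)) (y : Metric.sphere (0 : EN (n+1)) 1) :
    1 - ‖x‖ ≤ ‖x - (y : EN (n+1))‖ := by
  have h := norm_sub_norm_le (y : EN (n+1)) x
  have hy1 : ‖(y : EN (n+1))‖ = 1 := by simp
  rw [norm_sub_rev, hy1] at h
  exact h

instance finite_sphere_13 (N : ℕ) : IsFiniteMeasure (sphereMeasure N) := by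
  unfold sphereMeasure; infer_instance

lemma integrable_13 {n : ℕ} (x : EN (n+1)) (hx : ‖x‖ < 1) :
    Integrable (fun y : Metric.sphere (0 : EN (n+1)) 1 =>
      (‖x - (y : EN (n+1))‖ ^ (n+1))⁻¹) (sphereMeasure (n+1)) := by
  have hc : Continuous (fun y : Metric.sphere (0 : EN (n+1)) 1 =>
      (‖x - (y : EN (n+1))‖ ^ (n+1))⁻¹) := by
    refine Continuous.inv₀ (by fun_prop) fun y => ?_
    have := dist_lower_13 x y
    have : 0 < ‖x - (y : EN (n+1))‖ := by linarith
    positivity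
  exact hc.integrable_of_hasCompactSupport (HasCompactSupport.of_compactSpace _)

lemma int_lower_13 {n : ℕ} (x : EN (n+1)) (hx : ‖x‖ < 1) :
    ((n+1) * (1/4 * (2 / (16 * (n+1)))^n) / 2^(n+1)) / (1 - ‖x‖) ≤
      ∫ y : Metric.sphere (0 : EN (n+1)) 1, (‖x - (y : EN (n+1))‖ ^ (n+1))⁻¹
        ∂(sphereMeasure (n+1)) := by
  obtain ⟨e, he, hxe⟩ := exists_dir_13 x hx
  set d := 1 - ‖x‖ with hd
  have hd0 : 0 < d := by linarith
  have hd1 : d ≤ 1 := by linarith [norm_nonneg x]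
  have hcap := cap_lower_13 e he d hd0 hd1
  set A := {y : Metric.sphere (0 : EN (n+1)) 1 | ‖(y : EN (n+1)) - e‖ < d} with hA
  have hcap' : (n+1) * (1/4 * (2 * (d / (16 * (n+1))))^n) ≤ (sphereMeasure (n+1)).real A := by
    rw [ENNReal.ofReal_le_iff_le_toReal (measure_ne_top _ _)] at hcap
    exact hcap
  have h1 : ∫ y in A, ((2*d)^(n+1))⁻¹ ∂(sphereMeasure (n+1)) ≤
      ∫ y in A, (‖x - (y : EN (n+1))‖ ^ (n+1))⁻¹ ∂(sphereMeasure (n+1)) := by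
    refine setIntegral_mono_on (integrable_const _) (integrable_13 x hx).integrableOn
      (cap_meas_13 e d) fun y hy => ?_
    have h2 := dist_lower_13 x y
    have h3 : ‖x - (y : EN (n+1))‖ ≤ 2 * d := by
      have h4 : x - (y : EN (n+1)) = (x - e) - ((y : EN (n+1)) - e) := by abel
      have h5 := norm_sub_le (x - e) ((y : EN (n+1)) - e)
      rw [← h4, hxe] at h5
      have : ‖(y : EN (n+1)) - e‖ < d := hy
      linarith
    have : 0 < ‖x - (y : EN (n+1))‖ := by linarith
    gcongr
  have h2 := setIntegral_le_integral (s := A) (integrable_13 x hx)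
    (Filter.Eventually.of_forall fun y => by positivity)
  rw [setIntegral_const, smul_eq_mul] at h1
  refine le_trans ?_ (h1.trans h2)
  calc ((n+1) * (1/4 * (2 / (16 * (n+1)))^n) / 2^(n+1)) / d
      = ((n+1) * (1/4 * (2 * (d / (16 * (n+1))))^n)) * ((2*d)^(n+1))⁻¹ := by
        rw [show (2 * (d / (16 * ((n:ℝ)+1)))) = (2 / (16 * (n+1))) * d by ring, mul_pow, mul_pow]
        field_simp
        ring
    _ ≤ _ := by gcongr

lemma int_upper_13 {n : ℕ} (x : EN (n+1)) (hx : ‖x‖ < 1) :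
      ∫ y : Metric.sphere (0 : EN (n+1)) 1, (‖x - (y : EN (n+1))‖ ^ (n+1))⁻¹
        ∂(sphereMeasure (n+1)) ≤ (4 * (n+1) * 8^n) / (1 - ‖x‖) := by
  obtain ⟨e, he, hxe⟩ := exists_dir_13 x hx
  set d := 1 - ‖x‖ with hd
  have hd0 : 0 < d := by linarith
  rw [integral_eq_lintegral_of_nonneg_ae (Filter.Eventually.of_forall fun y => by positivity)
    (integrable_13 x hx).aestronglyMeasurable]
  refine ENNReal.toReal_le_of_le_ofReal (by positivity) ?_
  let A : ℕ → Set (Metric.sphere (0 : EN (n+1)) 1) := fun k =>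
    {y | ‖(y : EN (n+1)) - e‖ < 2^(k+2) * d}
  calc ∫⁻ y : Metric.sphere (0 : EN (n+1)) 1, ENNReal.ofReal (‖x - (y : EN (n+1))‖ ^ (n+1))⁻¹
        ∂(sphereMeasure (n+1))
      ≤ ∫⁻ y : Metric.sphere (0 : EN (n+1)) 1, ∑' k : ℕ,
          (A k).indicator (fun _ => ENNReal.ofReal ((2^k * d)^(n+1))⁻¹) y
          ∂(sphereMeasure (n+1)) := by
        refine lintegral_mono fun y => ?_
        have h1 := dist_lower_13 x y
        obtain ⟨k, hk1, hk2⟩ := exists_nat_pow_near (x := ‖x - (y : EN (n+1))‖ / d) (y := 2)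
          ((one_le_div hd0).2 h1) (by norm_num)
        rw [le_div_iff₀ hd0] at hk1
        rw [div_lt_iff₀ hd0] at hk2
        refine le_trans ?_ (ENNReal.le_tsum k)
        rw [Set.indicator_of_mem]
        · apply ENNReal.ofReal_le_ofReal
          gcongr
        · show ‖(y : EN (n+1)) - e‖ < 2^(k+2) * d
          have h4 : (y : EN (n+1)) - e = (x - e) - (x - (y : EN (n+1))) := by abel
          have h5 := norm_sub_le (x - e) (x - (y : EN (n+1)))
          rw [← h4, hxe] at h5
          have : (2:ℝ)^(k+2) * d = 2 * (2^(k+1) * d) := by ring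
          linarith
    _ = ∑' k : ℕ, ENNReal.ofReal ((2^k * d)^(n+1))⁻¹ * sphereMeasure (n+1) (A k) := by
        rw [lintegral_tsum]
        · congr 1; ext k
          rw [lintegral_indicator_const (cap_meas_13 e _)]
        · intro k
          exact (measurable_const.indicator (cap_meas_13 e _)).aemeasurable
    _ ≤ ∑' k : ℕ, ENNReal.ofReal (2 * (n+1) * 8^n / d * (1/2)^k) := by
        refine ENNReal.tsum_le_tsum fun k => ?_
        refine (mul_le_mul_right (cap_upper_13 e he _ (by positivity)) _).trans ?_
        rw [← ENNReal.ofReal_mul (by positivity)]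
        apply ENNReal.ofReal_le_ofReal
        apply le_of_eq
        rw [show (2:ℝ) * (2^(k+2) * d) = 8 * (2^k * d) by ring, mul_pow 8, one_div, inv_pow]
        field_simp
        ring
    _ = ENNReal.ofReal (4 * (n+1) * 8^n / d) := by
        rw [← ENNReal.ofReal_tsum_of_nonneg (fun k => by positivity)
          (summable_geometric_two.mul_left _), tsum_mul_left, tsum_geometric_two]
        congr 1; ring

/-- `M_B^α 1 ≈ δ^{α/2 - 1}`. -/
theorem statement_13 (N : ℕ) (hN : 3 ≤ N) (α : ℝ) (hα0 : 0 < α) (hα2 : α < 2) :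
    ∃ c₁ c₂ : ℝ, 0 < c₁ ∧ c₁ ≤ c₂ ∧
      ∀ x : EN N, ‖x‖ < 1 →
        c₁ * (1 - ‖x‖) ^ (α / 2 - 1) ≤
            (∫ y : Metric.sphere (0 : EN N) 1,
              (1 - ‖x‖ ^ 2) ^ (α / 2) * ‖x - (y : EN N)‖ ^ (-(N : ℝ)) ∂(sphereMeasure N)) ∧
        (∫ y : Metric.sphere (0 : EN N) 1,
            (1 - ‖x‖ ^ 2) ^ (α / 2) * ‖x - (y : EN N)‖ ^ (-(N : ℝ)) ∂(sphereMeasure N)) ≤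
          c₂ * (1 - ‖x‖) ^ (α / 2 - 1) := by
  obtain ⟨n, rfl⟩ : ∃ n, N = n + 1 := ⟨N - 1, by omega⟩
  set a : ℝ := ((n+1) * (1/4 * (2 / (16 * (n+1)))^n) / 2^(n+1)) with ha
  set c : ℝ := (4 * (n+1) * 8^n) with hc
  have ha0 : 0 < a := by positivity
  have hc0 : 0 < c := by positivity
  have hmain : ∀ x : EN (n+1), ‖x‖ < 1 →
        a * (1 - ‖x‖) ^ (α / 2 - 1) ≤
            (∫ y : Metric.sphere (0 : EN (n+1)) 1,
              (1 - ‖x‖ ^ 2) ^ (α / 2) * ‖x - (y : EN (n+1))‖ ^ (-((n+1 : ℕ) : ℝ)) ∂(sphereMeasure (n+1))) ∧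
        (∫ y : Metric.sphere (0 : EN (n+1)) 1,
            (1 - ‖x‖ ^ 2) ^ (α / 2) * ‖x - (y : EN (n+1))‖ ^ (-((n+1 : ℕ) : ℝ)) ∂(sphereMeasure (n+1))) ≤
          (2 ^ (α/2) * c) * (1 - ‖x‖) ^ (α / 2 - 1) := by
    intro x hx
    have hlow := int_lower_13 x hx
    have hup := int_upper_13 x hx
    rw [← ha] at hlow
    rw [← hc] at hup
    have heq : ∀ y : Metric.sphere (0 : EN (n+1)) 1,
        ‖x - (y : EN (n+1))‖ ^ (-((n+1 : ℕ) : ℝ)) = (‖x - (y : EN (n+1))‖ ^ (n+1))⁻¹ := by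
      intro y
      rw [Real.rpow_neg (norm_nonneg _), Real.rpow_natCast]
    simp_rw [heq]
    rw [integral_const_mul]
    set J := ∫ y : Metric.sphere (0 : EN (n+1)) 1, (‖x - (y : EN (n+1))‖ ^ (n+1))⁻¹
        ∂(sphereMeasure (n+1))
    have hx0 := norm_nonneg x
    have hd0 : 0 < 1 - ‖x‖ := by linarith
    have hp : (1 - ‖x‖) ^ (α / 2 - 1) = (1 - ‖x‖) ^ (α / 2) / (1 - ‖x‖) := by
      rw [Real.rpow_sub hd0, Real.rpow_one]
    have h1 : (1 - ‖x‖) ^ (α / 2) ≤ (1 - ‖x‖ ^ 2) ^ (α / 2) :=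
      Real.rpow_le_rpow hd0.le (by nlinarith) (by linarith)
    have h2 : (1 - ‖x‖ ^ 2) ^ (α / 2) ≤ 2 ^ (α / 2) * (1 - ‖x‖) ^ (α / 2) := by
      rw [← Real.mul_rpow (by norm_num) hd0.le]
      exact Real.rpow_le_rpow (by nlinarith) (by nlinarith) (by linarith)
    have hJ : 0 ≤ J := le_trans (by positivity) hlow
    have hq : 0 < (1 - ‖x‖) ^ (α / 2) := Real.rpow_pos_of_pos hd0 _
    rw [hp]
    constructor
    · calc a * ((1 - ‖x‖) ^ (α / 2) / (1 - ‖x‖)) = (1 - ‖x‖) ^ (α / 2) * (a / (1 - ‖x‖)) := by ring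
        _ ≤ _ := mul_le_mul h1 hlow (by positivity) (hq.le.trans h1)
    · calc _ ≤ (2 ^ (α / 2) * (1 - ‖x‖) ^ (α / 2)) * (c / (1 - ‖x‖)) :=
            mul_le_mul h2 hup hJ (by positivity)
        _ = _ := by ring
  refine ⟨a, 2 ^ (α/2) * c, ha0, ?_, hmain⟩
  have h := hmain 0 (by simp)
  simpa using h.1.trans h.2

end
end

section
/- Let 0 < t < 1 and β < 1. Then ∫_{t<|y|<1} K_{B(0,t)}(0,y) (1−|y|²)^{−β} dy = (2 sin(απ/2)/π) · ∫_t^1 t^α / (s (1−s²)^β (s²−t²)^{α/2}) ds, and both integrals are finite. -/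
open MeasureTheory Real Filter Topology Metric Set

noncomputable section

/-- Integrability of the one-dimensional integrand. -/
lemma aux_intervalIntegrable (α : ℝ) (hα2 : α < 2)
    (t β : ℝ) (ht0 : 0 < t) (ht1 : t < 1) (hβ : β < 1) :
    IntervalIntegrable
      (fun s : ℝ => t ^ α / (s * (1 - s ^ 2) ^ β * (s ^ 2 - t ^ 2) ^ (α / 2))) volume t 1 := by
  obtain ⟨m, htm, hm1⟩ := exists_between ht1
  have h1 : IntervalIntegrable (fun s : ℝ => (s - t) ^ (-(α / 2))) volume t m := by
    have h := (intervalIntegral.intervalIntegrable_rpow' (a := 0) (b := m - t)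
      (r := -(α / 2)) (by linarith)).comp_sub_right t
    simpa using h
  have h2 : IntervalIntegrable (fun s : ℝ => (1 - s) ^ (-β)) volume m 1 := by
    have h := (intervalIntegral.intervalIntegrable_rpow' (a := 1 - m) (b := 0)
      (r := -β) (by linarith)).comp_sub_left 1
    simpa using h
  have c1 : ContinuousOn (fun s : ℝ => t ^ α / (s * (1 - s ^ 2) ^ β * (s + t) ^ (α / 2)))
      (uIcc t m) := by
    rw [uIcc_of_le htm.le]
    have k : ∀ s ∈ Icc t m, 0 < s ∧ 0 < 1 - s ^ 2 ∧ 0 < s + t := fun s hs =>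
      ⟨by linarith [hs.1], by nlinarith [hs.1, hs.2], by linarith [hs.1]⟩
    refine ContinuousOn.div (by fun_prop) ?_ ?_
    · refine (ContinuousOn.mul (by fun_prop) ?_).mul ?_
      · exact ContinuousOn.rpow_const (by fun_prop) fun s hs => Or.inl (k s hs).2.1.ne'
      · exact ContinuousOn.rpow_const (by fun_prop) fun s hs => Or.inl (k s hs).2.2.ne'
    · intro s hs
      obtain ⟨a, b, c⟩ := k s hs
      positivity
  have c2 : ContinuousOn
      (fun s : ℝ => t ^ α / (s * (1 + s) ^ β * (s ^ 2 - t ^ 2) ^ (α / 2)))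
      (uIcc m 1) := by
    rw [uIcc_of_le hm1.le]
    have k : ∀ s ∈ Icc m 1, 0 < s ∧ 0 < 1 + s ∧ 0 < s ^ 2 - t ^ 2 := fun s hs =>
      ⟨by linarith [hs.1], by linarith [hs.1, hs.2], by nlinarith [hs.1]⟩
    refine ContinuousOn.div (by fun_prop) ?_ ?_
    · refine (ContinuousOn.mul (by fun_prop) ?_).mul ?_
      · exact ContinuousOn.rpow_const (by fun_prop) fun s hs => Or.inl (k s hs).2.1.ne'
      · exact ContinuousOn.rpow_const (by fun_prop) fun s hs => Or.inl (k s hs).2.2.ne'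
    · intro s hs
      obtain ⟨a, b, c⟩ := k s hs
      positivity
  refine IntervalIntegrable.trans (b := m) ?_ ?_
  · refine (h1.mul_continuousOn c1).congr_uIoo ?_
    rw [uIoo_of_le htm.le]
    intro s hs
    have e : s ^ 2 - t ^ 2 = (s - t) * (s + t) := by ring
    have p1 : 0 < s - t := by linarith [hs.1]
    have p2 : 0 < s + t := by linarith [hs.1]
    simp only [e]
    rw [mul_rpow p1.le p2.le, rpow_neg p1.le]
    have := rpow_pos_of_pos p1 (α / 2)
    simp only [div_eq_mul_inv, mul_inv]
    ring
  · refine (h2.mul_continuousOn c2).congr_uIoo ?_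
    rw [uIoo_of_le hm1.le]
    intro s hs
    have e : 1 - s ^ 2 = (1 - s) * (1 + s) := by ring
    have p1 : 0 < 1 - s := by linarith [hs.2]
    have p2 : 0 < 1 + s := by linarith [hs.1]
    simp only [e]
    rw [mul_rpow p1.le p2.le, rpow_neg p1.le]
    simp only [div_eq_mul_inv, mul_inv]
    ring

/-- The constants match. -/
lemma aux_const (N : ℕ) (hN : 3 ≤ N) (α : ℝ) :
    (N : ℝ) * (volume.real (ball (0 : EN N) 1)) * poissonCoeff N α =
      2 * Real.sin (α * Real.pi / 2) / Real.pi := by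
  have hne : Nonempty (Fin N) := ⟨⟨0, by omega⟩⟩
  have hNp : (0 : ℝ) < N := by exact_mod_cast (by omega : 0 < N)
  have hG : 0 < Real.Gamma ((N : ℝ) / 2) := Real.Gamma_pos_of_pos (by positivity)
  have hv : volume.real (ball (0 : EN N) 1) = Real.pi ^ ((N : ℝ) / 2) /
      ((N : ℝ) / 2 * Real.Gamma ((N : ℝ) / 2)) := by
    rw [Measure.real, EuclideanSpace.volume_ball, ← Real.Gamma_add_one (by positivity)]
    have hG' : 0 < Real.Gamma ((N : ℝ) / 2 + 1) := Real.Gamma_pos_of_pos (by positivity)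
    simp only [ENNReal.ofReal_one, one_pow, one_mul, Fintype.card_fin]
    rw [ENNReal.toReal_ofReal (by positivity), sqrt_eq_rpow, ← rpow_natCast, ← rpow_mul pi_pos.le]
    congr 2
    ring
  rw [hv, poissonCoeff, rpow_sub pi_pos, rpow_neg pi_pos.le, rpow_one, mul_comm α]
  have hp : 0 < Real.pi ^ ((N : ℝ) / 2) := rpow_pos_of_pos pi_pos _
  have := pi_pos
  field_simp

/-- Poisson integral of `(1-|y|²)^{-β}` at the origin as a one-dimensional
integral, together with finiteness of both integrals. -/
theorem statement_15 (N : ℕ) (hN : 3 ≤ N) (α : ℝ) (hα0 : 0 < α) (hα2 : α < 2)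
    (t β : ℝ) (ht0 : 0 < t) (ht1 : t < 1) (hβ : β < 1) :
    IntegrableOn (fun y : EN N => poissonBall N α 0 t 0 y * (1 - ‖y‖ ^ 2) ^ (-β))
      {y : EN N | t < ‖y‖ ∧ ‖y‖ < 1} ∧
    IntervalIntegrable
      (fun s : ℝ => t ^ α / (s * (1 - s ^ 2) ^ β * (s ^ 2 - t ^ 2) ^ (α / 2))) volume t 1 ∧
    (∫ y in {y : EN N | t < ‖y‖ ∧ ‖y‖ < 1},
        poissonBall N α 0 t 0 y * (1 - ‖y‖ ^ 2) ^ (-β)) =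
      (2 * Real.sin (α * Real.pi / 2) / Real.pi) *
        ∫ s in t..1, t ^ α / (s * (1 - s ^ 2) ^ β * (s ^ 2 - t ^ 2) ^ (α / 2)) := by
  have hg := aux_intervalIntegrable α hα2 t β ht0 ht1 hβ
  have hmeas : MeasurableSet {y : EN N | t < ‖y‖ ∧ ‖y‖ < 1} :=
    (measurableSet_lt measurable_const measurable_norm).inter
      (measurableSet_lt measurable_norm measurable_const)
  have hne : Nontrivial (EN N) := by
    have : Nonempty (Fin N) := ⟨⟨0, by omega⟩⟩
    infer_instance
  have hdim : Module.finrank ℝ (EN N) = N := by simp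
  set g : ℝ → ℝ := fun s => t ^ α / (s * (1 - s ^ 2) ^ β * (s ^ 2 - t ^ 2) ^ (α / 2)) with hgdef
  set F : EN N → ℝ := fun y => poissonBall N α 0 t 0 y * (1 - ‖y‖ ^ 2) ^ (-β) with hF
  set f : ℝ → ℝ := (Ioo t 1).indicator fun s => poissonCoeff N α * (t ^ 2 / (s ^ 2 - t ^ 2)) ^ (α / 2)
    * s ^ (-(N : ℝ)) * (1 - s ^ 2) ^ (-β) with hf
  have hFf : {y : EN N | t < ‖y‖ ∧ ‖y‖ < 1}.indicator F = fun y => f ‖y‖ := by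
    funext y
    by_cases hy : t < ‖y‖ ∧ ‖y‖ < 1
    · rw [indicator_of_mem (show y ∈ {y : EN N | t < ‖y‖ ∧ ‖y‖ < 1} from hy), hf,
        indicator_of_mem (show ‖y‖ ∈ Ioo t 1 from hy)]
      simp [hF, poissonBall]
    · rw [indicator_of_notMem (show y ∉ {y : EN N | t < ‖y‖ ∧ ‖y‖ < 1} from hy), hf,
        indicator_of_notMem (show ‖y‖ ∉ Ioo t 1 from hy)]
  have hrad : (fun s : ℝ => s ^ (Module.finrank ℝ (EN N) - 1) • f s) =
      (Ioo t 1).indicator fun s => poissonCoeff N α * g s := by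
    funext s
    by_cases hs : s ∈ Ioo t 1
    · have p0 : 0 < s := ht0.trans hs.1
      have p1 : 0 < s ^ 2 - t ^ 2 := by nlinarith [hs.1]
      have p2 : 0 < 1 - s ^ 2 := by nlinarith [hs.2]
      have e1 : s ^ (N - 1) * s ^ (-(N : ℝ)) = s⁻¹ := by
        rw [rpow_neg p0.le, rpow_natCast]
        obtain ⟨k, rfl⟩ : ∃ k, N = k + 1 := ⟨N - 1, by omega⟩
        rw [Nat.add_sub_cancel, pow_succ]
        field_simp
      have e2 : (t ^ 2) ^ (α / 2) = t ^ α := by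
        rw [← rpow_natCast, ← rpow_mul ht0.le]
        congr 1
        push_cast
        ring
      rw [hf, indicator_of_mem hs, indicator_of_mem hs, hdim, hgdef, smul_eq_mul,
        div_rpow (by positivity) p1.le, e2, rpow_neg p2.le]
      simp only [div_eq_mul_inv, mul_inv]
      rw [← e1]
      ring
    · rw [hf, indicator_of_notMem hs, indicator_of_notMem hs, smul_zero]
  have hgI : IntegrableOn g (Ioo t 1) :=
    ((intervalIntegrable_iff_integrableOn_Ioc_of_le ht1.le).1 hg).mono_set Ioo_subset_Ioc_self
  refine ⟨?_, hg, ?_⟩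
  · rw [← integrable_indicator_iff hmeas, hFf, integrable_fun_norm_addHaar, hrad]
    exact ((integrable_indicator_iff measurableSet_Ioo).2 (hgI.const_mul _)).integrableOn
  · rw [← integral_indicator hmeas, hFf, integral_fun_norm_addHaar, hrad,
      setIntegral_indicator measurableSet_Ioo,
      inter_eq_right.2 (show Ioo t 1 ⊆ Ioi 0 from fun s hs => ht0.trans hs.1), integral_const_mul,
      intervalIntegral.integral_of_le ht1.le, integral_Ioc_eq_integral_Ioo, hdim,
      ← aux_const N hN α]
    simp only [nsmul_eq_mul, smul_eq_mul]
    ring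

end
end
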